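/- Let n ≥ 2, s ∈ ℝ, n/(n+1) < p < ∞, min(2,p) ≤ q ≤ max(2,p) and set ν = (n−1)|1/p − 1/2|. For Schwartz functions f_0, f_1 on ℝ^n with Fourier transforms f̂_0, f̂_1 define, for t ∈ ℝ, u(t,x) = (2π)^{−n} ∫ e^{i(x·ξ + t|ξ|)} ( f̂_0(ξ)/2 + f̂_1(ξ)/(2i|ξ|) ) dξ + (2π)^{−n} ∫ e^{i(x·ξ − t|ξ|)} ( f̂_0(ξ)/2 − f̂_1(ξ)/(2i|ξ|) ) dξ (this is the solution of ∂_t^2 u = Δ_x u with u(0,·) = f_0 and ∂_t u(0,·) = f_1). Then for every τ > 0 there exists a constant C_τ such that sup_{t ∈ [−τ,τ]} ‖u(t,·)‖_{F^s_{p,q}} ≤ C_τ ( ‖f_0‖_{F^{s+ν}_{p,q}} + ‖f_1‖_{F^{s+ν−1}_{p,q}} ). -/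

import Mathlib

noncomputable section

open MeasureTheory Complex
open scoped ENNReal NNReal InnerProductSpace

/-- Euclidean space `ℝ^n`. -/
abbrev Rn (n : ℕ) := EuclideanSpace ℝ (Fin n)

/-- The Fourier transform `f̂(ξ) = ∫ e^{-i x·ξ} f(x) dx`. -/
def ftransform (n : ℕ) (f : Rn n → ℂ) (ξ : Rn n) : ℂ :=
  ∫ x : Rn n, Complex.exp (-(Complex.I * ((⟪x, ξ⟫_ℝ : ℝ) : ℂ))) * f x

/-- The Fourier integral operator `T_a^φ f(x) = (2π)^{-n} ∫ a(x,ξ) e^{iφ(x,ξ)} f̂(ξ) dξ`. -/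
def fio (n : ℕ) (a : Rn n → Rn n → ℂ) (φ : Rn n → Rn n → ℝ) (f : Rn n → ℂ) (x : Rn n) : ℂ :=
  ((((2 * Real.pi) ^ n)⁻¹ : ℝ) : ℂ) *
    ∫ ξ : Rn n, a x ξ * Complex.exp (Complex.I * ((φ x ξ : ℝ) : ℂ)) * ftransform n f ξ

/-- The Littlewood–Paley pieces `ψ_j` built from `ψ_0`. -/
def lpPiece (n : ℕ) (ψ0 : Rn n → ℝ) (j : ℕ) (ξ : Rn n) : ℝ :=
  if j = 0 then ψ0 ξ
  else ψ0 ((2 : ℝ) ^ (-(j : ℤ)) • ξ) - ψ0 ((2 : ℝ) ^ (-(j : ℤ) + 1) • ξ)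

/-- Hypotheses on the base function `ψ_0` of a Littlewood–Paley partition of unity. -/
def IsLPBase (n : ℕ) (ψ0 : Rn n → ℝ) : Prop :=
  ContDiff ℝ (⊤ : ℕ∞) ψ0 ∧ (∀ ξ : Rn n, ‖ξ‖ ≤ 1 → ψ0 ξ = 1) ∧ (∀ ξ : Rn n, 2 < ‖ξ‖ → ψ0 ξ = 0)

/-- Inverse Fourier transform of a real-valued function. -/
def invFT (n : ℕ) (h : Rn n → ℝ) (x : Rn n) : ℂ :=
  ((((2 * Real.pi) ^ n)⁻¹ : ℝ) : ℂ) *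
    ∫ ξ : Rn n, Complex.exp (Complex.I * ((⟪x, ξ⟫_ℝ : ℝ) : ℂ)) * ((h ξ : ℝ) : ℂ)

/-- The operator `h(D) g`: convolution of `g` with the inverse Fourier transform of `h`. -/
def smoothOp (n : ℕ) (h : Rn n → ℝ) (g : Rn n → ℂ) (x : Rn n) : ℂ :=
  ∫ y : Rn n, invFT n h (x - y) * g y

/-- `ℓ^q`-norm of a sequence in `ℝ≥0∞`, for `0 < q ≤ ∞`. -/
def lqSum (q : ℝ≥0∞) (u : ℕ → ℝ≥0∞) : ℝ≥0∞ :=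
  if q = ∞ then ⨆ j, u j else (∑' j, u j ^ q.toReal) ^ (1 / q.toReal)

/-- Besov–Lipschitz quasi-norm `‖g‖_{B^s_{p,q}}`. -/
def besovNorm (n : ℕ) (ψ0 : Rn n → ℝ) (s : ℝ) (p q : ℝ≥0∞) (g : Rn n → ℂ) : ℝ≥0∞ :=
  lqSum q fun j =>
    ENNReal.ofReal ((2 : ℝ) ^ ((j : ℝ) * s)) * eLpNorm (smoothOp n (lpPiece n ψ0 j) g) p volume

/-- Triebel–Lizorkin quasi-norm `‖g‖_{F^s_{p,q}}`. -/
def tlNorm (n : ℕ) (ψ0 : Rn n → ℝ) (s : ℝ) (p q : ℝ≥0∞) (g : Rn n → ℂ) : ℝ≥0∞ :=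
  if p = ∞ then
    essSup (fun x : Rn n => lqSum q fun j =>
      ENNReal.ofReal ((2 : ℝ) ^ ((j : ℝ) * s)) *
        (‖smoothOp n (lpPiece n ψ0 j) g x‖₊ : ℝ≥0∞)) volume
  else
    (∫⁻ x : Rn n, (lqSum q fun j =>
      ENNReal.ofReal ((2 : ℝ) ^ ((j : ℝ) * s)) *
        (‖smoothOp n (lpPiece n ψ0 j) g x‖₊ : ℝ≥0∞)) ^ p.toReal ∂volume) ^ (1 / p.toReal)

/-- Critical order `m_c(p) = -(n-1)|1/p - 1/2|`. -/
def criticalOrder (n : ℕ) (p : ℝ≥0∞) : ℝ := -((n : ℝ) - 1) * |p⁻¹.toReal - 1 / 2|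

/-- The symbol class `S^m(ℝ^n)`. -/
def SymbolClass (n : ℕ) (m : ℝ) (a : Rn n → Rn n → ℂ) : Prop :=
  ContDiff ℝ (⊤ : ℕ∞) (fun p : Rn n × Rn n => a p.1 p.2) ∧
  ∀ k l : ℕ, ∃ C : ℝ, ∀ x ξ : Rn n,
    ‖iteratedFDeriv ℝ k (fun ξ' => iteratedFDeriv ℝ l (fun x' => a x' ξ') x) ξ‖ ≤
      C * (1 + ‖ξ‖ ^ 2) ^ ((m - (k : ℝ)) / 2)

/-- Smoothness away from `ξ = 0` and positive homogeneity of degree 1 in `ξ` of a phase. -/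
def PhaseSmoothHomog (n : ℕ) (φ : Rn n → Rn n → ℝ) : Prop :=
  ContDiffOn ℝ (⊤ : ℕ∞) (fun p : Rn n × Rn n => φ p.1 p.2) {p : Rn n × Rn n | p.2 ≠ 0} ∧
  ∀ (x ξ : Rn n) (t : ℝ), 0 < t → φ x (t • ξ) = t * φ x ξ

/-- The phase class `Φ^k`. -/
def PhaseClass (n : ℕ) (k : ℕ) (φ : Rn n → Rn n → ℝ) : Prop :=
  PhaseSmoothHomog n φ ∧
  ∀ a b : ℕ, k ≤ a + b → ∃ C : ℝ, ∀ x ξ : Rn n, ξ ≠ 0 →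
    ‖ξ‖ ^ ((a : ℝ) - 1) *
      ‖iteratedFDerivWithin ℝ a
        (fun ξ' => iteratedFDeriv ℝ b (fun x' => φ x' ξ') x) {ξ' : Rn n | ξ' ≠ 0} ξ‖ ≤ C

/-- Determinant of the mixed Hessian `(∂²φ/∂x_i∂ξ_k)`. -/
def mixedHessianDet (n : ℕ) (φ : Rn n → Rn n → ℝ) (x ξ : Rn n) : ℝ :=
  Matrix.det (Matrix.of fun i k : Fin n =>
    fderiv ℝ (fun x' => fderiv ℝ (fun ξ' => φ x' ξ') ξ (EuclideanSpace.single k 1)) x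
      (EuclideanSpace.single i 1))

/-- The strong non-degeneracy (SND) condition. -/
def SNDCondition (n : ℕ) (φ : Rn n → Rn n → ℝ) : Prop :=
  ∃ δ : ℝ, 0 < δ ∧ ∀ x ξ : Rn n, ξ ≠ 0 → δ ≤ |mixedHessianDet n φ x ξ|

/-- Non-degeneracy of the phase on a compact set `K`. -/
def NonDegenerateOn (n : ℕ) (φ : Rn n → Rn n → ℝ) (K : Set (Rn n)) : Prop :=
  ∀ x ∈ K, ∀ ξ : Rn n, ξ ≠ 0 → mixedHessianDet n φ x ξ ≠ 0

/-- The solution of the Cauchy problem for the wave equation with initial data `f0, f1`. -/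
def waveSol (n : ℕ) (f0 f1 : Rn n → ℂ) (t : ℝ) (x : Rn n) : ℂ :=
  ((((2 * Real.pi) ^ n)⁻¹ : ℝ) : ℂ) *
      (∫ ξ : Rn n, Complex.exp (Complex.I * (((⟪x, ξ⟫_ℝ + t * ‖ξ‖ : ℝ)) : ℂ)) *
        (ftransform n f0 ξ / 2 + ftransform n f1 ξ / (2 * Complex.I * (‖ξ‖ : ℂ)))) +
    ((((2 * Real.pi) ^ n)⁻¹ : ℝ) : ℂ) *
      (∫ ξ : Rn n, Complex.exp (Complex.I * (((⟪x, ξ⟫_ℝ - t * ‖ξ‖ : ℝ)) : ℂ)) *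
        (ftransform n f0 ξ / 2 - ftransform n f1 ξ / (2 * Complex.I * (‖ξ‖ : ℂ))))

open scoped SchwartzMap FourierTransform Convolution Topology

/-- The geometric series with ratio `2^{-ε}`. -/
def geomSum (ε : ℝ) : ℝ≥0∞ := ∑' i : ℕ, (2 : ℝ≥0∞) ^ (-((i : ℝ) * ε))

lemma geomSum_ne_top {ε : ℝ} (hε : 0 < ε) : geomSum ε ≠ ∞ := by
  have h : geomSum ε = ∑' i : ℕ, ((2 : ℝ≥0∞) ^ (-ε)) ^ i := by
    unfold geomSum
    congr 1; ext i
    rw [← ENNReal.rpow_natCast, ← ENNReal.rpow_mul]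
    congr 1; ring
  rw [h, ENNReal.tsum_geometric]
  have : (2 : ℝ≥0∞) ^ (-ε) < 1 := ENNReal.rpow_lt_one_of_one_lt_of_neg (by norm_num) (by linarith)
  exact ENNReal.inv_ne_top.mpr (tsub_pos_of_lt this).ne'

lemma one_le_geomSum (ε : ℝ) : 1 ≤ geomSum ε := by
  refine le_trans ?_ (ENNReal.le_tsum 0)
  simp

lemma geomSum_ne_zero (ε : ℝ) : geomSum ε ≠ 0 :=
  (lt_of_lt_of_le one_pos (one_le_geomSum ε)).ne'

lemma two_rpow_ne_zero (x : ℝ) : (2 : ℝ≥0∞) ^ x ≠ 0 :=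
  (ENNReal.rpow_pos (by norm_num) (by norm_num)).ne'

lemma two_rpow_ne_top (x : ℝ) : (2 : ℝ≥0∞) ^ x ≠ ∞ :=
  ENNReal.rpow_ne_top_of_ne_zero (by norm_num) (by norm_num)

lemma two_rpow_add (x y : ℝ) : (2 : ℝ≥0∞) ^ (x + y) = 2 ^ x * 2 ^ y :=
  ENNReal.rpow_add _ _ (by norm_num) (by norm_num)

lemma two_rpow_le {x y : ℝ} (h : x ≤ y) : (2 : ℝ≥0∞) ^ x ≤ 2 ^ y :=
  ENNReal.rpow_le_rpow_of_exponent_le (by norm_num) h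

lemma exists_dyadic_Ico {a : ℝ≥0∞} (h0 : a ≠ 0) (h1 : a ≠ ∞) :
    ∃ k : ℤ, (2 : ℝ≥0∞) ^ (k : ℝ) ≤ a ∧ a < 2 ^ ((k : ℝ) + 1) := by
  obtain ⟨k, hk1, hk2⟩ := ENNReal.exists_mem_Ico_zpow h0 h1 (y := 2) (by norm_num) (by norm_num)
  refine ⟨k, by rwa [ENNReal.rpow_intCast], ?_⟩
  have : ((k : ℝ) + 1) = ((k + 1 : ℤ) : ℝ) := by push_cast; ring
  rwa [this, ENNReal.rpow_intCast]

lemma exists_dyadic_Ioc {a : ℝ≥0∞} (h0 : a ≠ 0) (h1 : a ≠ ∞) :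
    ∃ k : ℤ, (2 : ℝ≥0∞) ^ (k : ℝ) < a ∧ a ≤ 2 ^ ((k : ℝ) + 1) := by
  obtain ⟨k, hk1, hk2⟩ := ENNReal.exists_mem_Ioc_zpow h0 h1 (y := 2) (by norm_num) (by norm_num)
  refine ⟨k, by rwa [ENNReal.rpow_intCast], ?_⟩
  have : ((k : ℝ) + 1) = ((k + 1 : ℤ) : ℝ) := by push_cast; ring
  rwa [this, ENNReal.rpow_intCast]

open Classical in
lemma rpow_le_dyadic_sum {p : ℝ} (hp : 0 < p) (a : ℝ≥0∞) :
    a ^ p ≤ 2 ^ p * ∑' k : ℤ, if (2 : ℝ≥0∞) ^ (k : ℝ) < a then (2 : ℝ≥0∞) ^ ((k : ℝ) * p) else 0 := by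
  by_cases h0 : a = 0
  · simp [h0, hp]
  by_cases h1 : a = ∞
  · subst h1
    have : (∑' k : ℤ, if (2 : ℝ≥0∞) ^ (k : ℝ) < ∞ then (2 : ℝ≥0∞) ^ ((k : ℝ) * p) else 0) = ∞ := by
      rw [eq_top_iff]
      calc (∞ : ℝ≥0∞) = ∑' _ : ℕ, (1 : ℝ≥0∞) :=
            (ENNReal.tsum_const_eq_top_of_ne_zero one_ne_zero).symm
        _ ≤ ∑' k : ℕ, (if (2 : ℝ≥0∞) ^ (((k : ℤ)) : ℝ) < ∞ then
              (2 : ℝ≥0∞) ^ ((((k : ℤ)) : ℝ) * p) else 0) := by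
            refine ENNReal.tsum_le_tsum fun k => ?_
            rw [if_pos (two_rpow_ne_top _).lt_top]
            have h := two_rpow_le (x := 0) (y := ((k : ℤ) : ℝ) * p) (by positivity)
            rwa [ENNReal.rpow_zero] at h
        _ ≤ _ := ENNReal.tsum_comp_le_tsum_of_injective (f := fun k : ℕ => (k : ℤ))
              Nat.cast_injective
              (fun k : ℤ => if (2 : ℝ≥0∞) ^ (k : ℝ) < ∞ then (2 : ℝ≥0∞) ^ ((k : ℝ) * p) else 0)
    rw [this, ENNReal.mul_top (two_rpow_ne_zero p)]
    exact le_top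
  obtain ⟨k, hk1, hk2⟩ := exists_dyadic_Ioc h0 h1
  calc a ^ p ≤ (2 ^ ((k : ℝ) + 1)) ^ p := ENNReal.rpow_le_rpow hk2 hp.le
    _ = 2 ^ p * 2 ^ ((k : ℝ) * p) := by
        rw [← ENNReal.rpow_mul, ← two_rpow_add]; congr 1; ring
    _ ≤ _ := by
        gcongr
        refine le_trans ?_ (ENNReal.le_tsum k)
        rw [if_pos hk1]

open Classical in
lemma dyadic_sum_le {ε : ℝ} (hε : 0 < ε) (a : ℝ≥0∞) :
    (∑' k : ℤ, if (2 : ℝ≥0∞) ^ (k : ℝ) ≤ a then (2 : ℝ≥0∞) ^ ((k : ℝ) * ε) else 0) ≤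
      geomSum ε * a ^ ε := by
  by_cases h0 : a = 0
  · subst h0
    have : ∀ k : ℤ, ¬ (2 : ℝ≥0∞) ^ (k : ℝ) ≤ 0 := fun k h => two_rpow_ne_zero _ (le_zero_iff.mp h)
    simp only [if_neg (this _), tsum_zero]
    exact zero_le
  by_cases h1 : a = ∞
  · subst h1
    rw [ENNReal.top_rpow_of_pos hε, ENNReal.mul_top (geomSum_ne_zero ε)]
    exact le_top
  obtain ⟨k, hk1, hk2⟩ := exists_dyadic_Ico h0 h1
  set f : ℤ → ℝ≥0∞ := fun k => if (2 : ℝ≥0∞) ^ (k : ℝ) ≤ a then (2 : ℝ≥0∞) ^ ((k : ℝ) * ε) else 0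
    with hf
  have hsupp : Function.support f ⊆ Set.range fun i : ℕ => k - (i : ℤ) := by
    intro l hl
    have hl' : (2 : ℝ≥0∞) ^ (l : ℝ) ≤ a := by
      by_contra h
      exact hl (if_neg h)
    have h3 : (l : ℝ) < (k : ℝ) + 1 := by
      by_contra h
      exact absurd (hl'.trans_lt hk2) (not_lt.mpr (two_rpow_le (not_lt.mp h)))
    have h4 : l < k + 1 := by exact_mod_cast h3
    exact ⟨(k - l).toNat, by simp only; omega⟩
  have hinj : Function.Injective fun i : ℕ => k - (i : ℤ) := fun i j h => by simpa using h
  rw [← hinj.tsum_eq hsupp, geomSum, ← ENNReal.tsum_mul_right]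
  refine ENNReal.tsum_le_tsum fun i => ?_
  simp only [hf]
  split_ifs
  · calc (2 : ℝ≥0∞) ^ (((k - (i : ℤ) : ℤ) : ℝ) * ε) = 2 ^ (-((i : ℝ) * ε)) * (2 ^ (k : ℝ)) ^ ε := by
          rw [← ENNReal.rpow_mul, ← two_rpow_add]; congr 1; push_cast; ring
      _ ≤ _ := by gcongr
  · exact zero_le

open Classical in
lemma dyadic_sum_ge_le {ε : ℝ} (hε : 0 < ε) (a : ℝ≥0∞) :
    (∑' k : ℤ, if a ≤ (2 : ℝ≥0∞) ^ (k : ℝ) then (2 : ℝ≥0∞) ^ (-((k : ℝ) * ε)) else 0) ≤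
      geomSum ε * a ^ (-ε) := by
  have := dyadic_sum_le hε a⁻¹
  rw [← (Equiv.neg ℤ).tsum_eq] at this
  refine le_trans (le_of_eq ?_) (this.trans (le_of_eq ?_))
  · congr 1; ext k
    simp only [Equiv.neg_apply, Int.cast_neg, ENNReal.rpow_neg, neg_mul, ENNReal.inv_le_inv]
  · rw [ENNReal.inv_rpow, ENNReal.rpow_neg]

open Classical in
lemma lintegral_rpow_le_dyadic {α : Type*} [MeasurableSpace α] {μ : Measure α} {p : ℝ} (hp : 0 < p)
    {F : α → ℝ≥0∞} (hF : Measurable F) :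
    ∫⁻ x, F x ^ p ∂μ ≤
      2 ^ p * ∑' k : ℤ, (2 : ℝ≥0∞) ^ ((k : ℝ) * p) * μ {x | (2 : ℝ≥0∞) ^ (k : ℝ) < F x} := by
  have hm : ∀ k : ℤ, MeasurableSet {x | (2 : ℝ≥0∞) ^ (k : ℝ) < F x} := fun k =>
    measurableSet_lt measurable_const hF
  calc ∫⁻ x, F x ^ p ∂μ ≤ ∫⁻ x, 2 ^ p * ∑' k : ℤ, {x | (2 : ℝ≥0∞) ^ (k : ℝ) < F x}.indicator
          (fun _ => (2 : ℝ≥0∞) ^ ((k : ℝ) * p)) x ∂μ := by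
        refine lintegral_mono fun x => (rpow_le_dyadic_sum hp (F x)).trans (le_of_eq ?_)
        simp only [Set.indicator_apply, Set.mem_ofPred_eq]
    _ = _ := by
        rw [lintegral_const_mul' _ _ (two_rpow_ne_top p), lintegral_tsum]
        · congr 2; ext k
          rw [lintegral_indicator_const (hm k)]
        · exact fun k => (measurable_const.indicator (hm k)).aemeasurable

open Classical in
lemma dyadic_upper_sum_le {α : Type*} [MeasurableSpace α] {μ : Measure α} {p p0 : ℝ} (hp0 : 0 < p0)
    (hp : p0 < p) {γ : ℝ≥0∞} (hγ0 : γ ≠ 0) (hγ1 : γ ≠ ∞) {d : α → ℝ≥0∞} (hd : Measurable d) :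
    ∑' k : ℤ, (2 : ℝ≥0∞) ^ ((k : ℝ) * p) * (2 ^ (-((k : ℝ) * p0)) *
        ∫⁻ x, (if γ * 2 ^ (k : ℝ) < d x then d x else 0) ^ p0 ∂μ) ≤
      geomSum (p - p0) * γ ^ (p0 - p) * ∫⁻ x, d x ^ p ∂μ := by
  have hm : ∀ k : ℤ, Measurable fun x => (if γ * 2 ^ (k : ℝ) < d x then d x else 0) := fun k =>
    Measurable.ite (measurableSet_lt measurable_const hd) hd measurable_const
  have hC : geomSum (p - p0) * γ ^ (p0 - p) ≠ ∞ :=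
    ENNReal.mul_ne_top (geomSum_ne_top (by linarith)) (ENNReal.rpow_ne_top_of_ne_zero hγ0 hγ1)
  have h1 : ∀ k : ℤ, (2 : ℝ≥0∞) ^ ((k : ℝ) * p) * (2 ^ (-((k : ℝ) * p0)) *
        ∫⁻ x, (if γ * 2 ^ (k : ℝ) < d x then d x else 0) ^ p0 ∂μ) =
      ∫⁻ x, (2 : ℝ≥0∞) ^ ((k : ℝ) * (p - p0)) *
        (if γ * 2 ^ (k : ℝ) < d x then d x else 0) ^ p0 ∂μ := by
    intro k
    rw [lintegral_const_mul' _ _ (two_rpow_ne_top _), ← mul_assoc, ← two_rpow_add]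
    congr 2; ring
  simp_rw [h1]
  rw [← lintegral_tsum (fun k => (((hm k).pow_const p0).const_mul _).aemeasurable),
    ← lintegral_const_mul' _ _ hC]
  refine lintegral_mono fun x => ?_
  calc ∑' k : ℤ, (2 : ℝ≥0∞) ^ ((k : ℝ) * (p - p0)) *
        (if γ * 2 ^ (k : ℝ) < d x then d x else 0) ^ p0
      ≤ ∑' k : ℤ, (if (2 : ℝ≥0∞) ^ (k : ℝ) ≤ d x / γ then (2 : ℝ≥0∞) ^ ((k : ℝ) * (p - p0)) else 0) *
        d x ^ p0 := by
        refine ENNReal.tsum_le_tsum fun k => ?_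
        by_cases h : γ * 2 ^ (k : ℝ) < d x
        · have h2 : (2 : ℝ≥0∞) ^ (k : ℝ) ≤ d x / γ := by
            rw [ENNReal.le_div_iff_mul_le (Or.inl hγ0) (Or.inl hγ1), mul_comm]
            exact h.le
          rw [if_pos h, if_pos h2]
        · rw [if_neg h, ENNReal.zero_rpow_of_pos hp0, mul_zero]
          exact zero_le
    _ ≤ (geomSum (p - p0) * (d x / γ) ^ (p - p0)) * d x ^ p0 := by
        rw [ENNReal.tsum_mul_right]
        gcongr
        exact dyadic_sum_le (by linarith) _
    _ = _ := by
        rw [ENNReal.div_rpow_of_nonneg _ _ (by linarith : 0 ≤ p - p0), div_eq_mul_inv,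
          ← ENNReal.rpow_neg, neg_sub]
        have : d x ^ p = d x ^ (p - p0) * d x ^ p0 := by
          rw [← ENNReal.rpow_add_of_nonneg _ _ (by linarith) hp0.le]; congr 1; ring
        rw [this]; ring

open Classical in
lemma dyadic_lower_sum_le {α : Type*} [MeasurableSpace α] {μ : Measure α} {p : ℝ} (hp0 : 0 < p)
    (hp : p < 2) {γ : ℝ≥0∞} (hγ0 : γ ≠ 0) (hγ1 : γ ≠ ∞) {d : α → ℝ≥0∞} (hd : Measurable d) :
    ∑' k : ℤ, (2 : ℝ≥0∞) ^ ((k : ℝ) * p) * (2 ^ (-((k : ℝ) * 2)) *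
        ∫⁻ x, (if γ * 2 ^ (k : ℝ) < d x then 0 else d x) ^ (2 : ℝ) ∂μ) ≤
      geomSum (2 - p) * γ ^ (2 - p) * ∫⁻ x, d x ^ p ∂μ := by
  have hm : ∀ k : ℤ, Measurable fun x => (if γ * 2 ^ (k : ℝ) < d x then 0 else d x) := fun k =>
    Measurable.ite (measurableSet_lt measurable_const hd) measurable_const hd
  have hC : geomSum (2 - p) * γ ^ (2 - p) ≠ ∞ :=
    ENNReal.mul_ne_top (geomSum_ne_top (by linarith)) (ENNReal.rpow_ne_top_of_ne_zero hγ0 hγ1)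
  have h1 : ∀ k : ℤ, (2 : ℝ≥0∞) ^ ((k : ℝ) * p) * (2 ^ (-((k : ℝ) * 2)) *
        ∫⁻ x, (if γ * 2 ^ (k : ℝ) < d x then 0 else d x) ^ (2 : ℝ) ∂μ) =
      ∫⁻ x, (2 : ℝ≥0∞) ^ (-((k : ℝ) * (2 - p))) *
        (if γ * 2 ^ (k : ℝ) < d x then 0 else d x) ^ (2 : ℝ) ∂μ := by
    intro k
    rw [lintegral_const_mul' _ _ (two_rpow_ne_top _), ← mul_assoc, ← two_rpow_add]
    congr 2; ring
  simp_rw [h1]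
  rw [← lintegral_tsum (fun k => (((hm k).pow_const _).const_mul _).aemeasurable),
    ← lintegral_const_mul' _ _ hC]
  refine lintegral_mono fun x => ?_
  calc ∑' k : ℤ, (2 : ℝ≥0∞) ^ (-((k : ℝ) * (2 - p))) *
        (if γ * 2 ^ (k : ℝ) < d x then 0 else d x) ^ (2 : ℝ)
      ≤ ∑' k : ℤ, (if d x / γ ≤ (2 : ℝ≥0∞) ^ (k : ℝ) then
          (2 : ℝ≥0∞) ^ (-((k : ℝ) * (2 - p))) else 0) * d x ^ (2 : ℝ) := by
        refine ENNReal.tsum_le_tsum fun k => ?_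
        by_cases h : γ * 2 ^ (k : ℝ) < d x
        · rw [if_pos h, ENNReal.zero_rpow_of_pos (by norm_num), mul_zero]
          exact zero_le
        · have h2 : d x / γ ≤ (2 : ℝ≥0∞) ^ (k : ℝ) := by
            rw [ENNReal.div_le_iff_le_mul (Or.inl hγ0) (Or.inl hγ1), mul_comm]
            exact not_lt.mp h
          rw [if_neg h, if_pos h2]
    _ ≤ (geomSum (2 - p) * (d x / γ) ^ (-(2 - p))) * d x ^ (2 : ℝ) := by
        rw [ENNReal.tsum_mul_right]
        gcongr
        exact dyadic_sum_ge_le (by linarith) _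
    _ ≤ _ := by
        rw [mul_assoc, mul_assoc]
        refine mul_le_mul' le_rfl ?_
        rcases eq_or_ne (d x) 0 with h | h
        · simp [h, hp0]
        rcases eq_or_ne (d x) ∞ with h' | h'
        · rw [h', ENNReal.top_rpow_of_pos hp0, ENNReal.mul_top]
          · exact le_top
          · exact (ENNReal.rpow_pos (pos_iff_ne_zero.mpr hγ0) hγ1).ne'
        · rw [ENNReal.rpow_neg, ENNReal.div_rpow_of_nonneg _ _ (by linarith : 0 ≤ 2 - p),
            ENNReal.inv_div (Or.inl (ENNReal.rpow_ne_top_of_ne_zero hγ0 hγ1))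
              (Or.inl (ENNReal.rpow_pos (pos_iff_ne_zero.mpr hγ0) hγ1).ne'),
            div_eq_mul_inv, ← ENNReal.rpow_neg, mul_assoc, ← ENNReal.rpow_add _ _ h h']
          apply le_of_eq
          congr 2; ring

/-- Marcinkiewicz-type interpolation from a two-sided level set estimate. -/
lemma lintegral_rpow_le_of_meas_le {α : Type*} [MeasurableSpace α] {μ : Measure α} {p p0 : ℝ}
    (hp0 : 0 < p0) (hp : p0 < p) (hp2 : p < 2) {γ A B : ℝ≥0∞} (hγ0 : γ ≠ 0) (hγ1 : γ ≠ ∞)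
    {F d : α → ℝ≥0∞} (hF : Measurable F) (hd : Measurable d)
    (h : ∀ k : ℤ, μ {x | (2 : ℝ≥0∞) ^ (k : ℝ) < F x} ≤
      A * (2 ^ (-((k : ℝ) * p0)) *
        ∫⁻ x, (open Classical in if γ * 2 ^ (k : ℝ) < d x then d x else 0) ^ p0 ∂μ) +
      B * (2 ^ (-((k : ℝ) * 2)) *
        ∫⁻ x, (open Classical in if γ * 2 ^ (k : ℝ) < d x then 0 else d x) ^ (2 : ℝ) ∂μ)) :
    ∫⁻ x, F x ^ p ∂μ ≤ 2 ^ p * (A * (geomSum (p - p0) * γ ^ (p0 - p)) +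
      B * (geomSum (2 - p) * γ ^ (2 - p))) * ∫⁻ x, d x ^ p ∂μ := by
  have hp' : 0 < p := hp0.trans hp
  refine (lintegral_rpow_le_dyadic hp' hF).trans ?_
  rw [mul_assoc]
  gcongr
  calc _ ≤ ∑' k : ℤ, (2 : ℝ≥0∞) ^ ((k : ℝ) * p) * (A * (2 ^ (-((k : ℝ) * p0)) *
        ∫⁻ x, (open Classical in if γ * 2 ^ (k : ℝ) < d x then d x else 0) ^ p0 ∂μ) +
      B * (2 ^ (-((k : ℝ) * 2)) *
        ∫⁻ x, (open Classical in if γ * 2 ^ (k : ℝ) < d x then 0 else d x) ^ (2 : ℝ) ∂μ)) :=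
        ENNReal.tsum_le_tsum fun k => by gcongr; exact h k
    _ = A * _ + B * _ := by
        simp_rw [mul_add, mul_left_comm _ A, mul_left_comm _ B]
        rw [ENNReal.tsum_add, ENNReal.tsum_mul_left, ENNReal.tsum_mul_left]
    _ ≤ A * (geomSum (p - p0) * γ ^ (p0 - p) * ∫⁻ x, d x ^ p ∂μ) +
        B * (geomSum (2 - p) * γ ^ (2 - p) * ∫⁻ x, d x ^ p ∂μ) := by
        gcongr
        · exact dyadic_upper_sum_le hp0 hp hγ0 hγ1 hd
        · exact dyadic_lower_sum_le hp' hp2 hγ0 hγ1 hd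
    _ = _ := by ring

lemma tsum_rpow_le_geom {δ p : ℝ} (hp : 0 < p) (a : ℕ → ℝ≥0∞) :
    (∑' i, a i) ^ p ≤ geomSum δ ^ p * ∑' i : ℕ, (2 : ℝ≥0∞) ^ ((i : ℝ) * δ * p) * a i ^ p := by
  set S := ∑' i : ℕ, (2 : ℝ≥0∞) ^ ((i : ℝ) * δ * p) * a i ^ p with hS
  have h1 : ∀ i, a i ≤ 2 ^ (-((i : ℝ) * δ)) * S ^ (1 / p) := by
    intro i
    have h2 : (2 : ℝ≥0∞) ^ ((i : ℝ) * δ) * a i ≤ S ^ (1 / p) := by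
      rw [← ENNReal.rpow_le_rpow_iff hp, ← ENNReal.rpow_mul, one_div_mul_cancel hp.ne',
        ENNReal.rpow_one, ENNReal.mul_rpow_of_nonneg _ _ hp.le, ← ENNReal.rpow_mul]
      exact ENNReal.le_tsum i
    calc a i = 2 ^ (-((i : ℝ) * δ)) * (2 ^ ((i : ℝ) * δ) * a i) := by
          rw [← mul_assoc, ← two_rpow_add]; simp
      _ ≤ _ := by gcongr
  calc (∑' i, a i) ^ p ≤ (geomSum δ * S ^ (1 / p)) ^ p := by
        refine ENNReal.rpow_le_rpow ?_ hp.le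
        rw [geomSum, ← ENNReal.tsum_mul_right]
        exact ENNReal.tsum_le_tsum h1
    _ = _ := by
        rw [ENNReal.mul_rpow_of_nonneg _ _ hp.le, ← ENNReal.rpow_mul, one_div_mul_cancel hp.ne',
          ENNReal.rpow_one]

lemma finset_sum_rpow_le {ι : Type*} {p : ℝ} (hp0 : 0 < p) (hp : p ≤ 1) (s : Finset ι)
    (a : ι → ℝ≥0∞) : (∑ i ∈ s, a i) ^ p ≤ ∑ i ∈ s, a i ^ p := by
  classical
  induction s using Finset.induction_on with
  | empty => simp [hp0]
  | insert i s hi ih =>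
    rw [Finset.sum_insert hi, Finset.sum_insert hi]
    exact (ENNReal.rpow_add_le_add_rpow _ _ hp0.le hp).trans (by gcongr)

lemma tsum_rpow_le_tsum_rpow {ι : Type*} {p : ℝ} (hp0 : 0 < p) (hp : p ≤ 1)
    (a : ι → ℝ≥0∞) : (∑' i, a i) ^ p ≤ ∑' i, a i ^ p := by
  have h : ∑' i, a i ≤ (∑' i, a i ^ p) ^ (1 / p) := by
    rw [ENNReal.tsum_eq_iSup_sum]
    refine iSup_le fun s => ?_
    rw [← ENNReal.rpow_le_rpow_iff hp0, ← ENNReal.rpow_mul, one_div_mul_cancel hp0.ne',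
      ENNReal.rpow_one]
    exact (finset_sum_rpow_le hp0 hp s a).trans (ENNReal.sum_le_tsum s)
  calc _ ≤ ((∑' i, a i ^ p) ^ (1 / p)) ^ p := ENNReal.rpow_le_rpow h hp0.le
    _ = _ := by rw [← ENNReal.rpow_mul, one_div_mul_cancel hp0.ne', ENNReal.rpow_one]

/-- The weight `2^{jn} (1 + 2^j |z|)^{-(n+1)}`. -/
def kap (n j : ℕ) (z : Rn n) : ℝ≥0∞ :=
  ENNReal.ofReal (((2 : ℝ) ^ j) ^ n / (1 + 2 ^ j * ‖z‖) ^ (n + 1))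

/-- The maximal function built from the weights `kap`. -/
def maxFun (n : ℕ) (h : Rn n → ℝ≥0∞) (x : Rn n) : ℝ≥0∞ :=
  ⨆ j : ℕ, ∫⁻ y, kap n j (x - y) * h y

/-- Volume of the unit ball. -/
def ballVol (n : ℕ) : ℝ≥0∞ := volume (Metric.ball (0 : Rn n) 1)

lemma ballVol_ne_top (n : ℕ) : ballVol n ≠ ∞ := measure_ball_lt_top.ne

lemma ballVol_ne_zero (n : ℕ) : ballVol n ≠ 0 := (Metric.measure_ball_pos _ _ one_pos).ne'

lemma volume_closedBall_Rn (n : ℕ) (x : Rn n) {r : ℝ} (hr : 0 ≤ r) :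
    volume (Metric.closedBall x r) = ENNReal.ofReal r ^ n * ballVol n := by
  rw [Measure.addHaar_closedBall _ _ hr, finrank_euclideanSpace, Fintype.card_fin,
    ENNReal.ofReal_pow hr, ballVol]

lemma measurable_kap (n j : ℕ) : Measurable (kap n j) := by
  unfold kap
  fun_prop

lemma measurable_kap_lintegral (n j : ℕ) {h : Rn n → ℝ≥0∞} (hh : Measurable h) :
    Measurable fun x => ∫⁻ y, kap n j (x - y) * h y := by
  apply Measurable.lintegral_prod_right'
    (f := fun z : Rn n × Rn n => kap n j (z.1 - z.2) * h z.2)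
  exact ((measurable_kap n j).comp (measurable_fst.sub measurable_snd)).mul
    (hh.comp measurable_snd)

lemma measurable_maxFun (n : ℕ) {h : Rn n → ℝ≥0∞} (hh : Measurable h) :
    Measurable (maxFun n h) :=
  Measurable.iSup fun j => measurable_kap_lintegral n j hh

lemma kap_le_tsum (n j : ℕ) (x y : Rn n) :
    kap n j (x - y) ≤ ∑' k : ℕ, ENNReal.ofReal (2 ^ (n + 1) * (1 / 2) ^ k *
      ((2 : ℝ) ^ j / 2 ^ k) ^ n) *
      (Metric.closedBall x ((2 : ℝ) ^ k / 2 ^ j)).indicator 1 y := by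
  have hex : ∃ k : ℕ, (2 : ℝ) ^ j * ‖x - y‖ ≤ 2 ^ k := by
    obtain ⟨k, hk⟩ := pow_unbounded_of_one_lt ((2 : ℝ) ^ j * ‖x - y‖) (one_lt_two)
    exact ⟨k, hk.le⟩
  classical
  set k := Nat.find hex with hk
  have hk1 : (2 : ℝ) ^ j * ‖x - y‖ ≤ 2 ^ k := Nat.find_spec hex
  refine le_trans ?_ (ENNReal.le_tsum k)
  have hmem : y ∈ Metric.closedBall x ((2 : ℝ) ^ k / 2 ^ j) := by
    rw [Metric.mem_closedBall, dist_comm, dist_eq_norm, le_div_iff₀ (by positivity), mul_comm]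
    exact hk1
  rw [Set.indicator_of_mem hmem, Pi.one_apply, mul_one, kap]
  apply ENNReal.ofReal_le_ofReal
  have h2 : (2 : ℝ) ^ k ≤ 2 * (1 + 2 ^ j * ‖x - y‖) := by
    rcases Nat.eq_zero_or_pos k with h0 | h0
    · rw [h0]
      have : 0 ≤ (2 : ℝ) ^ j * ‖x - y‖ := by positivity
      norm_num; linarith
    · have h3 := Nat.find_min hex (Nat.sub_lt h0 one_pos)
      rw [not_le] at h3
      have : (2 : ℝ) ^ k = 2 * 2 ^ (k - 1) := by
        rw [← pow_succ', Nat.sub_add_cancel h0]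
      rw [this]; linarith
  have h4 : ((2 : ℝ) ^ k) ^ (n + 1) ≤ 2 ^ (n + 1) * (1 + 2 ^ j * ‖x - y‖) ^ (n + 1) := by
    rw [← mul_pow]; gcongr
  have hpos : 0 < (1 + 2 ^ j * ‖x - y‖) := by positivity
  rw [div_le_iff₀ (by positivity), div_pow]
  have h5 : ((2 : ℝ) ^ j) ^ n = ((2 : ℝ) ^ j) ^ n * (((2 : ℝ) ^ k) ^ (n + 1)) / ((2 : ℝ) ^ k) ^ (n + 1) := by
    field_simp
  rw [h5, div_le_iff₀ (by positivity)]
  calc ((2 : ℝ) ^ j) ^ n * (((2 : ℝ) ^ k) ^ (n + 1)) ≤ ((2 : ℝ) ^ j) ^ n *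
        (2 ^ (n + 1) * (1 + 2 ^ j * ‖x - y‖) ^ (n + 1)) := by gcongr
    _ = _ := by
      simp only [div_pow, one_pow]
      field_simp
      ring

lemma kap_lintegral_le_of_ball (n j : ℕ) {h : Rn n → ℝ≥0∞} (hh : Measurable h) (x : Rn n)
    {A : ℝ≥0∞} (hA : ∀ r : ℝ, 0 < r → ∫⁻ y in Metric.closedBall x r, h y ≤ A * ENNReal.ofReal r ^ n) :
    ∫⁻ y, kap n j (x - y) * h y ≤ 2 ^ (n + 2) * A := by
  calc ∫⁻ y, kap n j (x - y) * h y
      ≤ ∫⁻ y, ∑' k : ℕ, ENNReal.ofReal (2 ^ (n + 1) * (1 / 2) ^ k *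
      ((2 : ℝ) ^ j / 2 ^ k) ^ n) *
      (Metric.closedBall x ((2 : ℝ) ^ k / 2 ^ j)).indicator h y := by
        refine lintegral_mono fun y => ?_
        refine (mul_le_mul_left (kap_le_tsum n j x y) _).trans (le_of_eq ?_)
        rw [← ENNReal.tsum_mul_right]
        congr 1; ext k
        by_cases hy : y ∈ Metric.closedBall x ((2 : ℝ) ^ k / 2 ^ j)
        · rw [Set.indicator_of_mem hy, Set.indicator_of_mem hy, Pi.one_apply, mul_one]
        · rw [Set.indicator_of_notMem hy, Set.indicator_of_notMem hy, mul_zero, zero_mul]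
    _ = ∑' k : ℕ, ENNReal.ofReal (2 ^ (n + 1) * (1 / 2) ^ k *
      ((2 : ℝ) ^ j / 2 ^ k) ^ n) * ∫⁻ y in Metric.closedBall x ((2 : ℝ) ^ k / 2 ^ j), h y := by
        rw [lintegral_tsum]
        · congr 1; ext k
          rw [lintegral_const_mul' _ _ ENNReal.ofReal_ne_top,
            lintegral_indicator Metric.isClosed_closedBall.measurableSet]
        · exact fun k => ((hh.indicator Metric.isClosed_closedBall.measurableSet).const_mul
            _).aemeasurable
    _ ≤ ∑' k : ℕ, ENNReal.ofReal (2 ^ (n + 1) * (1 / 2) ^ k *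
      ((2 : ℝ) ^ j / 2 ^ k) ^ n) * (A * ENNReal.ofReal ((2 : ℝ) ^ k / 2 ^ j) ^ n) := by
        gcongr with k
        exact hA _ (by positivity)
    _ = ∑' k : ℕ, (2 ^ (n + 1) * A) * (2⁻¹ : ℝ≥0∞) ^ k := by
        congr 1; ext k
        rw [← ENNReal.ofReal_pow (by positivity), mul_left_comm, ← ENNReal.ofReal_mul (by positivity)]
        have : (2 : ℝ) ^ (n + 1) * (1 / 2) ^ k * (2 ^ j / 2 ^ k) ^ n * (2 ^ k / 2 ^ j) ^ n =
            2 ^ (n + 1) * (1 / 2) ^ k := by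
          rw [mul_assoc, ← mul_pow, div_mul_div_cancel₀ (by positivity), div_self (by positivity),
            one_pow, mul_one]
        rw [this, ENNReal.ofReal_mul (by positivity), ENNReal.ofReal_pow (by norm_num),
          ENNReal.ofReal_pow (by norm_num), one_div, ENNReal.ofReal_inv_of_pos (by norm_num),
          ENNReal.ofReal_ofNat]
        ring
    _ = 2 ^ (n + 2) * A := by
        rw [ENNReal.tsum_mul_left, ENNReal.tsum_geometric, ENNReal.one_sub_inv_two, inv_inv]
        ring

lemma maxFun_le_of_le (n : ℕ) {h : Rn n → ℝ≥0∞} (hh : Measurable h) {b : ℝ≥0∞}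
    (hb : ∀ y, h y ≤ b) (x : Rn n) : maxFun n h x ≤ 2 ^ (n + 2) * (b * ballVol n) := by
  refine iSup_le fun j => kap_lintegral_le_of_ball n j hh x fun r hr => ?_
  calc _ ≤ ∫⁻ y in Metric.closedBall x r, b := lintegral_mono fun y => hb y
    _ = _ := by
      rw [lintegral_const, Measure.restrict_apply_univ, volume_closedBall_Rn n x hr.le]
      ring

lemma lintegral_kap_le (n j : ℕ) (x : Rn n) :
    ∫⁻ y, kap n j (x - y) ≤ 2 ^ (n + 2) * ballVol n := by
  have h := kap_lintegral_le_of_ball n j (h := fun _ => 1) measurable_const x (A := ballVol n)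
    fun r hr => by
      rw [lintegral_const, Measure.restrict_apply_univ, volume_closedBall_Rn n x hr.le, one_mul,
        mul_comm]
  simpa using h

/-- Weak type (1,1) bound for the maximal function. -/
lemma maxFun_weak_type (n : ℕ) (hn : n ≠ 0) {h : Rn n → ℝ≥0∞} (hh : Measurable h) {lam : ℝ≥0∞}
    (h0 : lam ≠ 0) (h1 : lam ≠ ∞) :
    volume {x | lam < maxFun n h x} ≤
      (5 ^ n * ballVol n * 2 ^ (n + 2)) * (lam⁻¹ * ∫⁻ y, h y) := by
  set lam' := lam / 2 ^ (n + 2) with hlam'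
  have hl0 : lam' ≠ 0 := by simp [hlam', h0, ENNReal.div_eq_zero_iff]
  have hl1 : lam' ≠ ∞ := ENNReal.div_ne_top h1 (by positivity)
  have hl : lam'⁻¹ = 2 ^ (n + 2) * lam⁻¹ := by
    rw [hlam', ENNReal.inv_div (Or.inl (by simp)) (Or.inl (by simp)), div_eq_mul_inv]
  by_cases hI : ∫⁻ y, h y = ∞
  · rw [hI, ENNReal.mul_top (by simpa using h1), ENNReal.mul_top]
    · exact le_top
    · simp [ballVol_ne_zero]
  set I := ∫⁻ y, h y
  set E := {x | lam < maxFun n h x}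
  have hE : ∀ x ∈ E, ∃ r : ℝ, 0 < r ∧
      lam' * ENNReal.ofReal r ^ n < ∫⁻ y in Metric.closedBall x r, h y := by
    intro x hx
    by_contra hcon
    push Not at hcon
    have : maxFun n h x ≤ 2 ^ (n + 2) * lam' :=
      iSup_le fun j => kap_lintegral_le_of_ball n j hh x hcon
    rw [hlam', ENNReal.mul_div_cancel (by simp) (by simp)] at this
    exact absurd hx (not_lt.mpr this)
  choose! r hr0 hr using hE
  have hbdd : ∀ x ∈ E, r x ≤ ((I / lam') ^ (1 / (n : ℝ))).toReal := by
    intro x hx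
    have h2 : lam' * ENNReal.ofReal (r x) ^ n ≤ I :=
      (hr x hx).le.trans (setLIntegral_le_lintegral _ _)
    have h3 : ENNReal.ofReal (r x) ^ n ≤ I / lam' := by
      rw [ENNReal.le_div_iff_mul_le (Or.inl hl0) (Or.inl hl1), mul_comm]; exact h2
    have h4 : ENNReal.ofReal (r x) ≤ (I / lam') ^ (1 / (n : ℝ)) := by
      rw [one_div, ENNReal.le_rpow_inv_iff (by positivity), ENNReal.rpow_natCast]
      exact h3
    have h5 : (I / lam') ^ (1 / (n : ℝ)) ≠ ∞ :=
      ENNReal.rpow_ne_top_of_nonneg (by positivity) (ENNReal.div_ne_top hI hl0)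
    exact (ENNReal.ofReal_le_iff_le_toReal h5).mp h4
  obtain ⟨u, huE, hud, hu⟩ := Vitali.exists_disjoint_subfamily_covering_enlargement_closedBall
    E id r _ hbdd 5 (by norm_num)
  have huc : u.Countable := by
    refine hud.countable_of_nonempty_interior fun x hx => ?_
    refine ⟨x, ?_⟩
    exact Metric.ball_subset_interior_closedBall (Metric.mem_ball_self (hr0 x (huE hx)))
  have hcov : E ⊆ ⋃ b ∈ u, Metric.closedBall b (5 * r b) := by
    intro x hx
    obtain ⟨b, hb, hsub⟩ := hu x hx
    exact Set.mem_biUnion hb (hsub (Metric.mem_closedBall_self (hr0 x hx).le))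
  have hud' : u.PairwiseDisjoint fun a => Metric.closedBall a (r a) := hud
  calc volume E ≤ volume (⋃ b ∈ u, Metric.closedBall b (5 * r b)) := measure_mono hcov
    _ ≤ ∑' b : u, volume (Metric.closedBall (b : Rn n) (5 * r b)) := measure_biUnion_le _ huc _
    _ ≤ ∑' b : u, (5 ^ n * ballVol n * lam'⁻¹) * ∫⁻ y in Metric.closedBall (b : Rn n) (r b), h y := by
        refine ENNReal.tsum_le_tsum fun b => ?_
        have hb := huE b.2
        rw [volume_closedBall_Rn n _ (by linarith [hr0 b hb]), ENNReal.ofReal_mul (by norm_num),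
          mul_pow, ENNReal.ofReal_ofNat]
        calc 5 ^ n * ENNReal.ofReal (r b) ^ n * ballVol n
            = 5 ^ n * ballVol n * lam'⁻¹ * (lam' * ENNReal.ofReal (r b) ^ n) := by
              rw [mul_assoc _ lam'⁻¹, ← mul_assoc lam'⁻¹, ENNReal.inv_mul_cancel hl0 hl1]; ring
          _ ≤ _ := by gcongr; exact (hr b hb).le
    _ = (5 ^ n * ballVol n * lam'⁻¹) * ∫⁻ y in ⋃ b ∈ u, Metric.closedBall (b : Rn n) (r b), h y := by
        rw [ENNReal.tsum_mul_left, lintegral_biUnion huc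
          (fun b _ => Metric.isClosed_closedBall.measurableSet) hud']
    _ ≤ (5 ^ n * ballVol n * lam'⁻¹) * I := by
        gcongr
        exact setLIntegral_le_lintegral _ _
    _ = _ := by rw [hl]; ring

lemma maxFun_le_add (n : ℕ) {h h1 h2 : Rn n → ℝ≥0∞} (hh1 : Measurable h1)
    (hle : ∀ y, h y ≤ h1 y + h2 y) (x : Rn n) :
    maxFun n h x ≤ maxFun n h1 x + maxFun n h2 x := by
  refine iSup_le fun j => ?_
  calc ∫⁻ y, kap n j (x - y) * h y ≤ ∫⁻ y, (kap n j (x - y) * h1 y + kap n j (x - y) * h2 y) := by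
        refine lintegral_mono fun y => ?_
        simp only []
        rw [← mul_add]; gcongr; exact hle y
    _ = (∫⁻ y, kap n j (x - y) * h1 y) + ∫⁻ y, kap n j (x - y) * h2 y :=
        lintegral_add_left (((measurable_kap n j).comp (measurable_const.sub measurable_id)).mul
          hh1) _
    _ ≤ _ := add_le_add (le_iSup (fun j => ∫⁻ y, kap n j (x - y) * h1 y) j)
        (le_iSup (fun j => ∫⁻ y, kap n j (x - y) * h2 y) j)

/-- Strong type bound for the maximal function. -/
lemma maxFun_strong_type (n : ℕ) (hn : n ≠ 0) {a : ℝ} (ha : 1 < a) :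
    ∃ C : ℝ≥0∞, C ≠ ∞ ∧ ∀ h : Rn n → ℝ≥0∞, Measurable h →
      ∫⁻ x, maxFun n h x ^ a ≤ C * ∫⁻ x, h x ^ a := by
  classical
  set γ : ℝ≥0∞ := (2 ^ (n + 3) * ballVol n)⁻¹ with hγ
  have hγ0 : γ ≠ 0 := by
    simp [hγ, ENNReal.mul_eq_top, ballVol_ne_top]
  have hγ1 : γ ≠ ∞ := by
    simp [hγ, ballVol_ne_zero]
  set D : ℝ≥0∞ := 5 ^ n * ballVol n * 2 ^ (n + 2) with hD
  have hD1 : D ≠ ∞ := ENNReal.mul_ne_top (ENNReal.mul_ne_top (by simp) (ballVol_ne_top n)) (by simp)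
  refine ⟨2 ^ a * (2 * D * (geomSum (a - 1) * γ ^ (1 - a))), ?_, fun h hh => ?_⟩
  · refine ENNReal.mul_ne_top (two_rpow_ne_top _) (ENNReal.mul_ne_top
      (ENNReal.mul_ne_top (by simp) hD1) (ENNReal.mul_ne_top (geomSum_ne_top (by linarith))
        (ENNReal.rpow_ne_top_of_ne_zero hγ0 hγ1)))
  refine (lintegral_rpow_le_dyadic (by linarith) (measurable_maxFun n hh)).trans ?_
  rw [mul_assoc (2 ^ a)]
  gcongr
  have key : ∀ k : ℤ, volume {x | (2 : ℝ≥0∞) ^ (k : ℝ) < maxFun n h x} ≤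
      2 * D * (2 ^ (-((k : ℝ) * 1)) *
        ∫⁻ x, (if γ * 2 ^ (k : ℝ) < h x then h x else 0) ^ (1 : ℝ)) := by
    intro k
    set h1 : Rn n → ℝ≥0∞ := fun x => if γ * 2 ^ (k : ℝ) < h x then h x else 0 with hh1
    set h2 : Rn n → ℝ≥0∞ := fun x => if γ * 2 ^ (k : ℝ) < h x then 0 else h x with hh2
    have hm1 : Measurable h1 := Measurable.ite (measurableSet_lt measurable_const hh) hh
      measurable_const
    have hm2 : Measurable h2 := Measurable.ite (measurableSet_lt measurable_const hh)
      measurable_const hh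
    have hle : ∀ y, h y ≤ h1 y + h2 y := by
      intro y; simp only [hh1, hh2]; split_ifs <;> simp
    have hb : ∀ y, h2 y ≤ γ * 2 ^ (k : ℝ) := by
      intro y; simp only [hh2]; split_ifs with h'
      · exact zero_le
      · exact not_lt.mp h'
    have hhalf : (2 : ℝ≥0∞) ^ (n + 2) * (γ * 2 ^ (k : ℝ) * ballVol n) = 2 ^ ((k : ℝ) - 1) := by
      have : (2 : ℝ≥0∞) ^ (k : ℝ) = 2 * 2 ^ ((k : ℝ) - 1) := by
        have h3 := two_rpow_add 1 ((k : ℝ) - 1)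
        rw [ENNReal.rpow_one] at h3
        rw [← h3]; congr 1; ring
      rw [this]
      calc (2 : ℝ≥0∞) ^ (n + 2) * (γ * (2 * 2 ^ ((k : ℝ) - 1)) * ballVol n)
          = (γ * (2 ^ (n + 3) * ballVol n)) * 2 ^ ((k : ℝ) - 1) := by ring
        _ = _ := by
          rw [hγ, ENNReal.inv_mul_cancel, one_mul]
          · simp [ballVol_ne_zero]
          · simp [ENNReal.mul_eq_top, ballVol_ne_top]
    have hsub : {x | (2 : ℝ≥0∞) ^ (k : ℝ) < maxFun n h x} ⊆
        {x | (2 : ℝ≥0∞) ^ ((k : ℝ) - 1) < maxFun n h1 x} := by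
      intro x hx
      rw [Set.mem_ofPred_eq] at hx ⊢
      by_contra hcon
      have h4 := (maxFun_le_add n hm1 hle x).trans (add_le_add (not_lt.mp hcon)
        (maxFun_le_of_le n hm2 hb x))
      rw [hhalf] at h4
      have h5 : (2 : ℝ≥0∞) ^ ((k : ℝ) - 1) + 2 ^ ((k : ℝ) - 1) = 2 ^ (k : ℝ) := by
        have h3 := two_rpow_add 1 ((k : ℝ) - 1)
        rw [ENNReal.rpow_one] at h3
        rw [← two_mul, ← h3]; congr 1; ring
      rw [h5] at h4
      exact absurd hx (not_lt.mpr h4)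
    refine (measure_mono hsub).trans ((maxFun_weak_type n hn hm1 (two_rpow_ne_zero _)
      (two_rpow_ne_top _)).trans (le_of_eq ?_))
    simp only [ENNReal.rpow_one, mul_one]
    rw [← hD, ← ENNReal.rpow_neg]
    have h3 := two_rpow_add 1 (-(k : ℝ))
    rw [ENNReal.rpow_one] at h3
    rw [show -((k : ℝ) - 1) = 1 + -(k : ℝ) by ring, h3]
    ring
  calc _ ≤ ∑' k : ℤ, (2 : ℝ≥0∞) ^ ((k : ℝ) * a) * (2 * D * (2 ^ (-((k : ℝ) * 1)) *
        ∫⁻ x, (if γ * 2 ^ (k : ℝ) < h x then h x else 0) ^ (1 : ℝ))) :=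
        ENNReal.tsum_le_tsum fun k => by gcongr; exact key k
    _ = 2 * D * ∑' k : ℤ, (2 : ℝ≥0∞) ^ ((k : ℝ) * a) * (2 ^ (-((k : ℝ) * 1)) *
        ∫⁻ x, (if γ * 2 ^ (k : ℝ) < h x then h x else 0) ^ (1 : ℝ)) := by
        rw [← ENNReal.tsum_mul_left]; congr 1; ext k; ring
    _ ≤ 2 * D * (geomSum (a - 1) * γ ^ (1 - a) * ∫⁻ x, h x ^ a) := by
        gcongr
        exact dyadic_upper_sum_le one_pos ha hγ0 hγ1 hh
    _ = _ := by ring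

/-- Points at distance `≲ 2^{-j}` have comparable weights. -/
lemma kap_le_of_dist (n j : ℕ) {R : ℝ} (hR : 0 ≤ R) {x x' : Rn n}
    (hx : 2 ^ j * ‖x - x'‖ ≤ R) (y : Rn n) :
    kap n j (x - y) ≤ ENNReal.ofReal ((1 + R) ^ (n + 1)) * kap n j (x' - y) := by
  rw [kap, kap, ← ENNReal.ofReal_mul (by positivity)]
  apply ENNReal.ofReal_le_ofReal
  have h1 : 1 + 2 ^ j * ‖x' - y‖ ≤ (1 + R) * (1 + 2 ^ j * ‖x - y‖) := by
    have h2 : ‖x' - y‖ ≤ ‖x - x'‖ + ‖x - y‖ := by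
      have := norm_sub_le (x - y) (x - x')
      rw [show x - y - (x - x') = x' - y by abel] at this
      linarith
    have h3 : (2 : ℝ) ^ j * ‖x' - y‖ ≤ R + 2 ^ j * ‖x - y‖ := by
      calc _ ≤ (2 : ℝ) ^ j * (‖x - x'‖ + ‖x - y‖) := by gcongr
        _ ≤ _ := by rw [mul_add]; gcongr
    have : 0 ≤ R * (2 ^ j * ‖x - y‖) := by positivity
    nlinarith
  rw [mul_div_assoc', div_le_div_iff₀ (by positivity) (by positivity)]
  calc ((2 : ℝ) ^ j) ^ n * (1 + 2 ^ j * ‖x' - y‖) ^ (n + 1)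
      ≤ ((2 : ℝ) ^ j) ^ n * ((1 + R) * (1 + 2 ^ j * ‖x - y‖)) ^ (n + 1) := by gcongr
    _ = _ := by rw [mul_pow]; ring

/-- The index of the dyadic cube of side `2^{-m}` containing `x`. -/
def cell (n m : ℕ) (x : Rn n) : Fin n → ℤ := fun i => ⌊(2 : ℝ) ^ m * x i⌋

lemma measurable_cell (n m : ℕ) : Measurable (cell n m) := by
  refine measurable_pi_lambda _ fun i => ?_
  have : Measurable fun x : Rn n => (2 : ℝ) ^ m * x i := by fun_prop
  exact Int.measurable_floor.comp this

lemma measurableSet_cell (n m : ℕ) (v : Fin n → ℤ) : MeasurableSet {x | cell n m x = v} :=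
  measurable_cell n m (MeasurableSet.singleton v)

lemma volume_cell (n m : ℕ) (v : Fin n → ℤ) :
    volume {x | cell n m x = v} = (2 : ℝ≥0∞) ^ (-((m : ℝ) * n)) := by
  have h2 : (0 : ℝ) < 2 ^ m := by positivity
  have h : {x | cell n m x = v} = (MeasurableEquiv.toLp 2 (Fin n → ℝ)).symm ⁻¹'
      (Set.pi Set.univ fun i => Set.Ico ((v i : ℝ) / 2 ^ m) (((v i : ℝ) + 1) / 2 ^ m)) := by
    ext x
    simp only [Set.mem_preimage, Set.mem_pi, Set.mem_univ, true_implies, Set.mem_ofPred_eq,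
      Set.mem_Ico, cell, funext_iff, Int.floor_eq_iff]
    refine forall_congr' fun i => ?_
    rw [div_le_iff₀' h2, lt_div_iff₀' h2]
    rfl
  rw [h, (EuclideanSpace.volume_preserving_symm_measurableEquiv_toLp (Fin n)).measure_preimage
    (MeasurableSet.univ_pi fun i => measurableSet_Ico).nullMeasurableSet, Real.volume_pi_Ico]
  have h3 : ∀ i : Fin n, ENNReal.ofReal (((v i : ℝ) + 1) / 2 ^ m - (v i : ℝ) / 2 ^ m) =
      (2 : ℝ≥0∞) ^ (-(m : ℝ)) := by
    intro i
    rw [← sub_div, add_sub_cancel_left, one_div, ENNReal.ofReal_inv_of_pos h2,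
      ENNReal.ofReal_pow (by norm_num), ENNReal.ofReal_ofNat, ENNReal.rpow_neg,
      ENNReal.rpow_natCast]
  simp only [h3, Finset.prod_const, Finset.card_univ, Fintype.card_fin]
  rw [← ENNReal.rpow_natCast, ← ENNReal.rpow_mul, neg_mul]

lemma cell_eq_of_le {n m j : ℕ} (hmj : m ≤ j) {x y : Rn n} (h : cell n j x = cell n j y) :
    cell n m x = cell n m y := by
  have key : ∀ z : Rn n, cell n m z = fun i => cell n j z i / ((2 ^ (j - m) : ℕ) : ℤ) := by
    intro z
    ext i
    simp only [cell]
    rw [← Int.floor_div_natCast]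
    congr 1
    obtain ⟨k, rfl⟩ := Nat.exists_eq_add_of_le hmj
    rw [Nat.add_sub_cancel_left]
    push_cast
    field_simp
    ring
  rw [key x, key y, h]

lemma dist_le_of_cell_eq {n j : ℕ} {x y : Rn n} (h : cell n j x = cell n j y) :
    2 ^ j * ‖x - y‖ ≤ Real.sqrt n := by
  have h2 : (0 : ℝ) < 2 ^ j := by positivity
  have h1 : ‖(2 : ℝ) ^ j • (x - y)‖ ≤ Real.sqrt n := by
    rw [EuclideanSpace.norm_eq]
    apply Real.sqrt_le_sqrt
    calc ∑ i, ‖((2 : ℝ) ^ j • (x - y)) i‖ ^ 2 ≤ ∑ i : Fin n, (1 : ℝ) := by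
          refine Finset.sum_le_sum fun i _ => ?_
          have h3 : |(2 : ℝ) ^ j * x i - 2 ^ j * y i| < 1 :=
            Int.abs_sub_lt_one_of_floor_eq_floor (congrFun h i)
          have h4 : ((2 : ℝ) ^ j • (x - y)) i = (2 : ℝ) ^ j * x i - 2 ^ j * y i := by
            simp [mul_sub]
          rw [h4, Real.norm_eq_abs]
          exact pow_le_one₀ (abs_nonneg _) h3.le
      _ = n := by simp
  rwa [norm_smul, Real.norm_of_nonneg h2.le] at h1

open Classical in
lemma measurable_of_cell {n m : ℕ} {f : Rn n → ℝ≥0∞}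
    (hf : ∀ x y, cell n m x = cell n m y → f x = f y) : Measurable f := by
  have : f = (fun v => if h : ∃ x, cell n m x = v then f h.choose else 0) ∘ cell n m := by
    ext x
    have h : ∃ y, cell n m y = cell n m x := ⟨x, rfl⟩
    simp only [Function.comp_apply]
    rw [dif_pos h]
    exact hf _ _ h.choose_spec.symm
  rw [this]
  exact (measurable_of_countable _).comp (measurable_cell n m)

open Classical in
/-- Every function which is controlled by `G` on dyadic cubes splits into pieces controlled by
functions `d m` which are constant on cubes of side `2^{-m}`. -/
lemma exists_dyadic_decomposition (n : ℕ) {p : ℝ} (hp : 0 < p) (G : Rn n → ℝ≥0∞) :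
    ∃ d : ℕ → Rn n → ℝ≥0∞,
      (∀ m x y, cell n m x = cell n m y → d m x = d m y) ∧
      (∀ x, ∑' m, d m x ^ p ≤ geomSum p * G x ^ p) ∧
      ∀ (j : ℕ) (f : Rn n → ℝ≥0∞), (∀ x y, cell n j x = cell n j y → f x ≤ G y) →
        ∀ x, f x ≠ ∞ → ∃ m ≤ j, f x ≤ 2 * d m x := by
  set a : ℕ → Rn n → ℝ≥0∞ := fun m x => ⨅ y, ⨅ _ : cell n m y = cell n m x, G y with ha
  have ha_cell : ∀ m x y, cell n m x = cell n m y → a m x = a m y := by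
    intro m x y h; simp only [ha, h]
  have ha_mono : ∀ m m', m ≤ m' → ∀ x, a m x ≤ a m' x := by
    intro m m' hm x
    exact le_iInf₂ fun y hy => iInf₂_le y (cell_eq_of_le hm hy)
  have ha_le : ∀ m x, a m x ≤ G x := fun m x =>
    iInf₂_le (f := fun y (_ : cell n m y = cell n m x) => G y) x rfl
  set P : ℕ → ℤ → Rn n → Prop := fun m k x =>
    (∀ i < m, a i x < (2 : ℝ≥0∞) ^ (k : ℝ)) ∧ (2 : ℝ≥0∞) ^ (k : ℝ) ≤ a m x with hP
  set D : ℕ → Rn n → ℝ≥0∞ := fun m x =>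
    ∑' k : ℤ, if P m k x then (2 : ℝ≥0∞) ^ ((k : ℝ) * p) else 0 with hD
  refine ⟨fun m x => D m x ^ (1 / p), ?_, ?_, ?_⟩
  · intro m x y h
    have h1 : ∀ i ≤ m, a i x = a i y := fun i hi => ha_cell i x y (cell_eq_of_le hi h)
    have h2 : ∀ k, P m k x ↔ P m k y := by
      intro k
      simp only [hP]
      rw [h1 m le_rfl]
      refine and_congr_left' ?_
      exact forall₂_congr fun i hi => by rw [h1 i hi.le]
    simp only [hD, h2]
  · intro x
    have h1 : ∀ m, (D m x ^ (1 / p)) ^ p = D m x := fun m => by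
      rw [← ENNReal.rpow_mul, one_div_mul_cancel hp.ne', ENNReal.rpow_one]
    simp only [h1]
    simp only [hD]
    rw [ENNReal.tsum_comm]
    refine le_trans (ENNReal.tsum_le_tsum fun k => ?_) (dyadic_sum_le hp (G x))
    by_cases hex : ∃ m, P m k x
    · obtain ⟨m, hm⟩ := hex
      rw [tsum_eq_single m, if_pos hm, if_pos (hm.2.trans (ha_le m x))]
      intro m' hm'
      refine if_neg fun hm2 => ?_
      rcases lt_or_gt_of_ne hm' with h | h
      · exact absurd (hm.1 m' h) (not_lt.mpr hm2.2)
      · exact absurd (hm2.1 m h) (not_lt.mpr hm.2)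
    · have : ∀ m, ¬ P m k x := fun m hm => hex ⟨m, hm⟩
      simp only [if_neg (this _), tsum_zero]
      exact zero_le
  · intro j f hf x hx
    rcases eq_or_ne (f x) 0 with h0 | h0
    · exact ⟨0, Nat.zero_le _, by rw [h0]; exact zero_le⟩
    obtain ⟨k, hk1, hk2⟩ := exists_dyadic_Ico h0 hx
    have haj : (2 : ℝ≥0∞) ^ (k : ℝ) ≤ a j x :=
      hk1.trans (le_iInf₂ fun y hy => hf x y hy.symm)
    have hex : ∃ m, (2 : ℝ≥0∞) ^ (k : ℝ) ≤ a m x := ⟨j, haj⟩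
    refine ⟨Nat.find hex, Nat.find_min' hex haj, ?_⟩
    have hPm : P (Nat.find hex) k x :=
      ⟨fun i hi => not_le.mp (Nat.find_min hex hi), Nat.find_spec hex⟩
    have h1 : (2 : ℝ≥0∞) ^ ((k : ℝ) * p) ≤ D (Nat.find hex) x := by
      refine le_trans ?_ (ENNReal.le_tsum k)
      rw [if_pos hPm]
    have h2 : (2 : ℝ≥0∞) ^ (k : ℝ) ≤ D (Nat.find hex) x ^ (1 / p) := by
      rw [one_div, ENNReal.le_rpow_inv_iff hp, ← ENNReal.rpow_mul]
      exact h1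
    refine hk2.le.trans ?_
    rw [add_comm, two_rpow_add, ENNReal.rpow_one]
    gcongr

/-- Convolution `∫ K(x - y) g(y) dy`. -/
def kconv (n : ℕ) (K g : Rn n → ℂ) (x : Rn n) : ℂ := ∫ y, K (x - y) * g y

lemma kconv_eq_convolution {n : ℕ} (K g : 𝓢(Rn n, ℂ)) :
    kconv n K g = SchwartzMap.convolution (ContinuousLinearMap.mul ℂ ℂ) g K := by
  ext x
  rw [SchwartzMap.convolution_apply]
  simp only [kconv, MeasureTheory.convolution, ContinuousLinearMap.mul_apply', mul_comm]

/-- Convolution with the inverse Fourier transform of `S` is the Fourier multiplier `S`. -/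
lemma fourier_convolution_mul {n : ℕ} (S g : 𝓢(Rn n, ℂ)) (ξ : Rn n) :
    (𝓕 (SchwartzMap.convolution (ContinuousLinearMap.mul ℂ ℂ) g (𝓕⁻ S)) : 𝓢(Rn n, ℂ)) ξ =
      S ξ * (𝓕 g : 𝓢(Rn n, ℂ)) ξ := by
  rw [SchwartzMap.fourier_convolution]
  simp [mul_comm]

lemma kconv_fourierInv {n : ℕ} (S g h : 𝓢(Rn n, ℂ)) (hh : ∀ ξ, h ξ = S ξ * (𝓕 g : 𝓢(Rn n, ℂ)) ξ) :
    kconv n ⇑(𝓕⁻ S : 𝓢(Rn n, ℂ)) g = (𝓕⁻ h : 𝓢(Rn n, ℂ)) := by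
  rw [kconv_eq_convolution]
  congr 1
  have : 𝓕 (SchwartzMap.convolution (ContinuousLinearMap.mul ℂ ℂ) g (𝓕⁻ S)) = h := by
    ext ξ; rw [fourier_convolution_mul, hh]
  rw [← this]; simp

lemma eLpNorm_fourier {n : ℕ} (g : 𝓢(Rn n, ℂ)) : eLpNorm ⇑(𝓕 g : 𝓢(Rn n, ℂ)) 2 volume = eLpNorm g 2 volume := by
  have h := SchwartzMap.norm_fourier_toL2_eq g
  rw [SchwartzMap.norm_toLp, SchwartzMap.norm_toLp] at h
  exact (ENNReal.toReal_eq_toReal_iff' (SchwartzMap.eLpNorm_lt_top _ _ _).ne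
    (SchwartzMap.eLpNorm_lt_top _ _ _).ne).mp h

lemma eLpNorm_kconv_schwartz_le {n : ℕ} (S g : 𝓢(Rn n, ℂ)) {B : ℝ≥0} (hB : ∀ ξ, ‖S ξ‖ ≤ B) :
    eLpNorm (kconv n ⇑(𝓕⁻ S : 𝓢(Rn n, ℂ)) g) 2 volume ≤ B * eLpNorm g 2 volume := by
  rw [kconv_eq_convolution, ← eLpNorm_fourier, ← eLpNorm_fourier g]
  have h := eLpNorm_le_nnreal_smul_eLpNorm_of_ae_le_mul (μ := volume)
    (f := ⇑(𝓕 (SchwartzMap.convolution (ContinuousLinearMap.mul ℂ ℂ) g (𝓕⁻ S)) : 𝓢(Rn n, ℂ)))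
    (g := ⇑(𝓕 g : 𝓢(Rn n, ℂ))) (c := B) (Filter.Eventually.of_forall fun ξ => by
      rw [fourier_convolution_mul, nnnorm_mul]
      gcongr
      exact_mod_cast hB ξ) 2
  simpa [ENNReal.smul_def] using h

lemma enorm_kconv_le {n : ℕ} {K g : Rn n → ℂ} (hK : Measurable K) (hg : AEStronglyMeasurable g volume)
    (x : Rn n) : ‖kconv n K g x‖ₑ ≤ eLpNorm K 2 volume * eLpNorm g 2 volume := by
  calc ‖kconv n K g x‖ₑ ≤ ∫⁻ y, ‖K (x - y) * g y‖ₑ := enorm_integral_le_lintegral_enorm _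
    _ = ∫⁻ y, ((fun y => ‖K (x - y)‖ₑ) * fun y => ‖g y‖ₑ) y := by simp [enorm_mul]
    _ ≤ (∫⁻ y, ‖K (x - y)‖ₑ ^ (2 : ℝ)) ^ (1 / (2 : ℝ)) * (∫⁻ y, ‖g y‖ₑ ^ (2 : ℝ)) ^ (1 / (2 : ℝ)) := by
        apply ENNReal.lintegral_mul_le_Lp_mul_Lq _ Real.HolderConjugate.two_two
        · exact (hK.comp (measurable_const.sub measurable_id)).enorm.aemeasurable
        · exact hg.enorm
    _ = _ := by
        rw [eLpNorm_eq_lintegral_rpow_enorm_toReal (by norm_num) (by norm_num),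
          eLpNorm_eq_lintegral_rpow_enorm_toReal (by norm_num) (by norm_num)]
        simp only [ENNReal.toReal_ofNat]
        rw [lintegral_sub_left_eq_self (fun y => ‖K y‖ₑ ^ (2 : ℝ)) x]

lemma integrable_kconv {n : ℕ} {K g : Rn n → ℂ} (hK : MemLp K 2 volume) (hg : MemLp g 2 volume)
    (x : Rn n) : Integrable (fun y => K (x - y) * g y) volume := by
  have h1 : MemLp (fun y => K (x - y)) 2 volume :=
    hK.comp_measurePreserving (Measure.measurePreserving_sub_left volume x)
  exact h1.integrable_mul hg

/-- `L²` bound for Fourier multipliers acting on `L²` functions. -/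
lemma eLpNorm_kconv_le {n : ℕ} (S : 𝓢(Rn n, ℂ)) {B : ℝ≥0} (hB : ∀ ξ, ‖S ξ‖ ≤ B)
    {g : Rn n → ℂ} (hg : MemLp g 2 volume) :
    eLpNorm (kconv n ⇑(𝓕⁻ S : 𝓢(Rn n, ℂ)) g) 2 volume ≤ B * eLpNorm g 2 volume := by
  have hex : ∀ k : ℕ, ∃ h : 𝓢(Rn n, ℂ), eLpNorm (g - ⇑h) 2 volume ≤ ENNReal.ofReal (1 / (k + 1)) := by
    intro k
    obtain ⟨h, h1, h2, h3⟩ := hg.exist_eLpNorm_sub_le (by norm_num) (by norm_num)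
      (ε := 1 / ((k : ℝ) + 1)) (by positivity)
    exact ⟨h1.toSchwartzMap h2, h3⟩
  choose h hh using hex
  set K : 𝓢(Rn n, ℂ) := 𝓕⁻ S with hK
  have hlim0 : Filter.Tendsto (fun k : ℕ => ENNReal.ofReal (1 / ((k : ℝ) + 1))) Filter.atTop (𝓝 0) := by
    have := ENNReal.tendsto_ofReal (tendsto_one_div_add_atTop_nhds_zero_nat (𝕜 := ℝ))
    simpa using this
  have hKfin : eLpNorm K 2 volume ≠ ∞ := (SchwartzMap.eLpNorm_lt_top _ _ _).ne
  have hlim : ∀ x, Filter.Tendsto (fun k => kconv n K (h k) x) Filter.atTop (𝓝 (kconv n K g x)) := by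
    intro x
    rw [tendsto_iff_edist_tendsto_0]
    refine tendsto_of_tendsto_of_tendsto_of_le_of_le tendsto_const_nhds
      (h := fun k : ℕ => eLpNorm K 2 volume * ENNReal.ofReal (1 / ((k : ℝ) + 1))) ?_
      (fun _ => zero_le) fun k => ?_
    · simpa using ENNReal.Tendsto.const_mul hlim0 (Or.inr hKfin)
    · rw [edist_comm, edist_eq_enorm_sub]
      have : kconv n K g x - kconv n K (h k) x = kconv n K (g - ⇑(h k)) x := by
        simp only [kconv]
        rw [← integral_sub (integrable_kconv (K.memLp 2) hg x)
          (integrable_kconv (K.memLp 2) ((h k).memLp 2) x)]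
        simp [mul_sub]
      rw [this]
      exact (enorm_kconv_le K.continuous.measurable
        (hg.1.sub (h k).continuous.aestronglyMeasurable) x).trans
        (mul_le_mul' le_rfl (hh k))
  have h1 := Lp.eLpNorm_lim_le_liminf_eLpNorm (μ := volume) (p := 2) (f := fun k => kconv n K (h k))
    (fun k => by
      rw [kconv_eq_convolution]; exact (SchwartzMap.continuous _).aestronglyMeasurable)
    (kconv n K g) (Filter.Eventually.of_forall hlim)
  refine h1.trans ?_
  have h2 : Filter.Tendsto (fun k : ℕ => (B : ℝ≥0∞) * (eLpNorm g 2 volume + ENNReal.ofReal (1 / ((k : ℝ) + 1))))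
      Filter.atTop (𝓝 (B * eLpNorm g 2 volume)) := by
    have := ENNReal.Tendsto.const_mul (hlim0.const_add (eLpNorm g 2 volume)) (a := B)
      (Or.inr ENNReal.coe_ne_top)
    simpa using this
  rw [← h2.liminf_eq]
  refine Filter.liminf_le_liminf (Filter.Eventually.of_forall fun k => ?_)
  refine (eLpNorm_kconv_schwartz_le S (h k) hB).trans ?_
  gcongr
  have h3 : (h k : Rn n → ℂ) = g - (g - ⇑(h k)) := by simp
  rw [h3]
  refine (eLpNorm_sub_le hg.1 (hg.1.sub (h k).continuous.aestronglyMeasurable) (by norm_num)).trans ?_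
  gcongr
  exact hh k

section

open scoped ContDiff

/-- Smooth compactly supported functions. -/
def SmoothCpt (n : ℕ) (F : Rn n → ℂ) : Prop := ContDiff ℝ ∞ F ∧ HasCompactSupport F

/-- Smooth compactly supported functions vanishing near the origin. -/
def Ann (n : ℕ) (c : Rn n → ℂ) : Prop := SmoothCpt n c ∧ c =ᶠ[𝓝 0] 0

/-- The Schwartz function underlying a smooth compactly supported function. -/
def SmoothCpt.toS {n : ℕ} {F : Rn n → ℂ} (h : SmoothCpt n F) : 𝓢(Rn n, ℂ) := h.2.toSchwartzMap h.1

@[simp] lemma SmoothCpt.coe_toS {n : ℕ} {F : Rn n → ℂ} (h : SmoothCpt n F) : ⇑h.toS = F := rfl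

lemma SmoothCpt.fourierInv_toS {n : ℕ} {F : Rn n → ℂ} (h : SmoothCpt n F) :
    ⇑(𝓕⁻ h.toS : 𝓢(Rn n, ℂ)) = 𝓕⁻ F := by
  rw [SchwartzMap.fourierInv_coe]; rfl

/-- The differential operator `(i / 2π) ∂_i`. -/
def dirD (n : ℕ) (i : Fin n) (F : Rn n → ℂ) (η : Rn n) : ℂ :=
  (I / (2 * Real.pi)) * fderiv ℝ F η (EuclideanSpace.single i 1)

lemma SmoothCpt.dirD {n : ℕ} {F : Rn n → ℂ} (h : SmoothCpt n F) (i : Fin n) :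
    SmoothCpt n (dirD n i F) := by
  constructor
  · exact contDiff_const.mul ((h.1.fderiv_right (m := ∞) (by simp)).clm_apply contDiff_const)
  · have : HasCompactSupport fun η => fderiv ℝ F η (EuclideanSpace.single i 1) :=
      (h.2.fderiv (𝕜 := ℝ)).comp_left (g := fun L : Rn n →L[ℝ] ℂ => L (EuclideanSpace.single i 1)) rfl
    exact this.mul_left

lemma Ann.dirD {n : ℕ} {c : Rn n → ℂ} (h : Ann n c) (i : Fin n) : Ann n (dirD n i c) := by
  refine ⟨h.1.dirD i, ?_⟩
  filter_upwards [h.2.fderiv (𝕜 := ℝ)] with η hη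
  have h0 : fderiv ℝ (0 : Rn n → ℂ) η = 0 := by simp
  simp [_root_.dirD, hη, h0]

lemma mul_fourierInv {n : ℕ} {F : Rn n → ℂ} (h : SmoothCpt n F) (i : Fin n) (z : Rn n) :
    (z i : ℂ) * 𝓕⁻ F z = 𝓕⁻ (dirD n i F) z := by
  have h1 := SchwartzMap.fourierInv_lineDerivOp_eq h.toS (EuclideanSpace.single i (1 : ℝ))
  have hg : (inner ℝ · (EuclideanSpace.single i (1 : ℝ)) : Rn n → ℝ).HasTemperateGrowth := by fun_prop
  have h2 : (h.dirD i).toS = (I / (2 * Real.pi)) •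
      (LineDeriv.lineDerivOp (EuclideanSpace.single i (1 : ℝ)) h.toS : 𝓢(Rn n, ℂ)) := by
    ext η; rfl
  have h3 : (𝓕⁻ (h.dirD i).toS : 𝓢(Rn n, ℂ)) z = (z i : ℂ) * (𝓕⁻ h.toS : 𝓢(Rn n, ℂ)) z := by
    rw [h2, FourierTransform.fourierInv_smul, h1]
    have hpi : (Real.pi : ℂ) ≠ 0 := by exact_mod_cast Real.pi_ne_zero
    have hg' : (fun x : Rn n => x i).HasTemperateGrowth := by
      simpa [EuclideanSpace.inner_single_right] using hg
    simp only [smul_apply, smul_eq_mul, EuclideanSpace.inner_single_right, one_mul, mul_neg, conj_trivial, neg_apply, neg_smul, SchwartzMap.smulLeftCLM_apply_apply hg', real_smul]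
    field_simp
    simp
  rw [← h.fourierInv_toS, ← (h.dirD i).fourierInv_toS, h3]

lemma hasFDerivAt_norm_of_ne_zero {n : ℕ} {η : Rn n} (hη : η ≠ 0) :
    HasFDerivAt (fun x : Rn n => ‖x‖) (‖η‖⁻¹ • innerSL ℝ η) η := by
  have h := (hasStrictFDerivAt_norm_sq η).hasFDerivAt.sqrt (by simpa using hη)
  have h2 : (fun x : Rn n => √(‖x‖ ^ 2)) = fun x => ‖x‖ := by
    ext x; rw [Real.sqrt_sq (norm_nonneg _)]
  rw [h2, Real.sqrt_sq (norm_nonneg _)] at h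
  have : ‖η‖⁻¹ • innerSL ℝ η = (1 / (2 * ‖η‖)) • 2 • innerSL ℝ η := by
    rw [two_nsmul, ← two_smul ℝ, smul_smul]
    congr 1
    have : ‖η‖ ≠ 0 := by simpa using hη
    field_simp
  rw [this]
  exact h

/-- The direction cosines `η_i / |η|`. -/
def omg (n : ℕ) (i : Fin n) (η : Rn n) : ℂ := ((η i / ‖η‖ : ℝ) : ℂ)

lemma Ann.mul {n : ℕ} {c f : Rn n → ℂ} (h : Ann n c) (hf : ∀ η ≠ 0, ContDiffAt ℝ ∞ f η) :
    Ann n (fun η => f η * c η) := by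
  refine ⟨⟨contDiff_iff_contDiffAt.mpr fun η => ?_, h.1.2.mul_left⟩, ?_⟩
  · by_cases hη : η = 0
    · subst hη
      have : (fun η => f η * c η) =ᶠ[𝓝 0] fun _ => (0 : ℂ) := by
        filter_upwards [h.2] with η hη; simp [hη]
      exact contDiffAt_const.congr_of_eventuallyEq this
    · exact (hf η hη).mul h.1.1.contDiffAt
  · filter_upwards [h.2] with η hη; simp [hη]

lemma contDiffAt_omg {n : ℕ} (i : Fin n) {η : Rn n} (hη : η ≠ 0) : ContDiffAt ℝ ∞ (omg n i) η := by
  have h1 : ContDiffAt ℝ ∞ (fun η : Rn n => η i / ‖η‖) η :=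
    ContDiffAt.div (by fun_prop) (contDiffAt_norm ℝ hη) (by simpa using hη)
  exact Complex.ofRealCLM.contDiff.contDiffAt.comp η h1

lemma Ann.omg {n : ℕ} {c : Rn n → ℂ} (h : Ann n c) (i : Fin n) :
    Ann n (fun η => omg n i η * c η) := h.mul fun _ hη => contDiffAt_omg i hη

lemma Ann.scale {n : ℕ} {c : Rn n → ℂ} (h : Ann n c) {a : ℝ} (ha : a ≠ 0) :
    Ann n (fun η => c (a • η)) := by
  refine ⟨⟨h.1.1.comp (by fun_prop : ContDiff ℝ ∞ fun η : Rn n => a • η), ?_⟩, ?_⟩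
  · exact h.1.2.comp_homeomorph (Homeomorph.smulOfNeZero a ha)
  · have : Filter.Tendsto (fun η : Rn n => a • η) (𝓝 0) (𝓝 0) := by
      have : Continuous fun η : Rn n => a • η := by fun_prop
      simpa using this.tendsto 0
    exact this.eventually h.2

/-- The half-wave symbol `e^{2πit|η|} c(aη)`. -/
def symb (n : ℕ) (c : Rn n → ℂ) (a t : ℝ) (η : Rn n) : ℂ :=
  exp (((2 * Real.pi * t * ‖η‖ : ℝ) : ℂ) * I) * c (a • η)

lemma Ann.symb {n : ℕ} {c : Rn n → ℂ} (h : Ann n c) {a : ℝ} (ha : a ≠ 0) (t : ℝ) :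
    Ann n (symb n c a t) := by
  refine (h.scale ha).mul fun η hη => ?_
  refine ContDiffAt.cexp (ContDiffAt.mul ?_ contDiffAt_const)
  exact Complex.ofRealCLM.contDiff.contDiffAt.comp η
    (contDiffAt_const.mul (contDiffAt_norm ℝ hη))

lemma norm_symb_le {n : ℕ} {c : Rn n → ℂ} {B : ℝ} (hB : ∀ η, ‖c η‖ ≤ B) (a t : ℝ) (η : Rn n) :
    ‖symb n c a t η‖ ≤ B := by
  rw [symb, norm_mul, norm_exp_ofReal_mul_I, one_mul]; exact hB _

lemma Ann.bound {n : ℕ} {c : Rn n → ℂ} (h : Ann n c) : ∃ B : ℝ≥0, ∀ η, ‖c η‖ ≤ B := by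
  obtain ⟨C, hC⟩ := h.1.2.exists_bound_of_continuous h.1.1.continuous
  exact ⟨⟨C, (norm_nonneg _).trans (hC 0)⟩, hC⟩

lemma dirD_symb {n : ℕ} {c : Rn n → ℂ} (h : Ann n c) {a : ℝ} (ha : 0 < a) (t : ℝ) (i : Fin n)
    (η : Rn n) :
    dirD n i (symb n c a t) η =
      -(t : ℂ) * symb n (fun η => omg n i η * c η) a t η + (a : ℂ) * symb n (dirD n i c) a t η := by
  by_cases hη : η = 0
  · subst hη
    have h1 := ((h.symb ha.ne' t).dirD i).2.eq_of_nhds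
    have h2 := (((h.omg i).symb ha.ne' t)).2.eq_of_nhds
    have h3 := (((h.dirD i).symb ha.ne' t)).2.eq_of_nhds
    rw [h1, h2, h3]; simp
  have hn : HasFDerivAt (fun x : Rn n => ‖x‖) (‖η‖⁻¹ • innerSL ℝ η) η := hasFDerivAt_norm_of_ne_zero hη
  have hc1 : HasFDerivAt (fun x : Rn n => c (a • x))
      ((fderiv ℝ c (a • η)).comp (a • ContinuousLinearMap.id ℝ (Rn n))) η :=
    ((h.1.1.differentiable (by simp)).differentiableAt.hasFDerivAt (x := a • η)).comp η
      ((hasFDerivAt_id η).const_smul a)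
  have he : HasFDerivAt (fun x : Rn n => exp (((2 * Real.pi * t * ‖x‖ : ℝ) : ℂ) * I)) _ η :=
    ((Complex.ofRealCLM.hasFDerivAt.comp η (hn.const_mul (2 * Real.pi * t))).mul_const I).cexp
  have hm := he.mul hc1
  have hs : fderiv ℝ (symb n c a t) η = _ := hm.fderiv
  rw [dirD, hs]
  have hnz : (‖η‖ : ℂ) ≠ 0 := by simpa using hη
  have hpi : (Real.pi : ℂ) ≠ 0 := by exact_mod_cast Real.pi_ne_zero
  have hom : omg n i (a • η) = omg n i η := by
    simp only [omg, PiLp.smul_apply, smul_eq_mul, norm_smul, Real.norm_eq_abs, abs_of_pos ha]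
    rw [mul_div_mul_left _ _ ha.ne']
  simp only [symb, hom]
  simp [dirD, EuclideanSpace.inner_single_right, omg]
  field_simp
  ring_nf
  simp only [I_sq]
  ring

end

section

open scoped ContDiff

lemma SmoothCpt.const_mul {n : ℕ} {F : Rn n → ℂ} (h : SmoothCpt n F) (α : ℂ) :
    SmoothCpt n (fun η => α * F η) := ⟨contDiff_const.mul h.1, h.2.mul_left⟩

lemma fourierInv_lincomb {n : ℕ} {F G H : Rn n → ℂ} (hF : SmoothCpt n F) (hG : SmoothCpt n G)
    (hH : SmoothCpt n H) (α β : ℂ) (h : ∀ η, H η = α * F η + β * G η) (z : Rn n) :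
    𝓕⁻ H z = α * 𝓕⁻ F z + β * 𝓕⁻ G z := by
  rw [← hF.fourierInv_toS, ← hG.fourierInv_toS, ← hH.fourierInv_toS]
  have : hH.toS = α • hF.toS + β • hG.toS := by
    ext η; exact h η
  rw [this, FourierTransform.fourierInv_add, FourierTransform.fourierInv_smul,
    FourierTransform.fourierInv_smul]
  rfl

lemma fourierInv_sum_eq {n : ℕ} {ι : Type*} [Fintype ι] {F : ι → Rn n → ℂ} {H : Rn n → ℂ}
    (hF : ∀ i, SmoothCpt n (F i)) (hH : SmoothCpt n H) (h : ∀ η, H η = ∑ i, F i η) (z : Rn n) :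
    𝓕⁻ H z = ∑ i, 𝓕⁻ (F i) z := by
  simp_rw [← (hF _).fourierInv_toS]
  rw [← hH.fourierInv_toS]
  have : hH.toS = ∑ i, (hF i).toS := by
    ext η; rw [sum_apply]; exact h η
  rw [this, FourierTransform.fourierInv_sum, sum_apply]

/-- The half-wave kernel. -/
def wk (n : ℕ) (c : Rn n → ℂ) (a t : ℝ) : Rn n → ℂ := 𝓕⁻ (symb n c a t)

lemma Ann.wk_eq {n : ℕ} {c : Rn n → ℂ} (h : Ann n c) {a : ℝ} (ha : 0 < a) (t : ℝ) :
    wk n c a t = ⇑(𝓕⁻ (h.symb ha.ne' t).1.toS : 𝓢(Rn n, ℂ)) := by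
  rw [SmoothCpt.fourierInv_toS]; rfl

lemma Ann.continuous_wk {n : ℕ} {c : Rn n → ℂ} (h : Ann n c) {a : ℝ} (ha : 0 < a) (t : ℝ) :
    Continuous (wk n c a t) := by rw [h.wk_eq ha]; exact SchwartzMap.continuous _

lemma Ann.memLp_wk {n : ℕ} {c : Rn n → ℂ} (h : Ann n c) {a : ℝ} (ha : 0 < a) (t : ℝ) (p : ℝ≥0∞) :
    MemLp (wk n c a t) p volume := by rw [h.wk_eq ha]; exact SchwartzMap.memLp _ p volume

lemma mul_wk {n : ℕ} {c : Rn n → ℂ} (h : Ann n c) {a : ℝ} (ha : 0 < a) (t : ℝ) (i : Fin n)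
    (z : Rn n) :
    (z i : ℂ) * wk n c a t z =
      -(t : ℂ) * wk n (fun η => omg n i η * c η) a t z + (a : ℂ) * wk n (dirD n i c) a t z := by
  rw [wk, mul_fourierInv (h.symb ha.ne' t).1]
  exact fourierInv_lincomb ((h.omg i).symb ha.ne' t).1 ((h.dirD i).symb ha.ne' t).1
    ((h.symb ha.ne' t).dirD i).1 _ _ (dirD_symb h ha t i) z

lemma sum_wk_omg {n : ℕ} {c : Rn n → ℂ} (h : Ann n c) {a : ℝ} (ha : 0 < a) (t : ℝ) (z : Rn n) :
    wk n c a t z = ∑ i, wk n (fun η => omg n i η * (omg n i η * c η)) a t z := by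
  refine fourierInv_sum_eq (fun i => (((h.omg i).omg i).symb ha.ne' t).1) (h.symb ha.ne' t).1
    (fun η => ?_) z
  by_cases hη : η = 0
  · subst hη
    rw [(h.symb ha.ne' t).2.eq_of_nhds]
    simp [(((h.omg _).omg _).symb ha.ne' t).2.eq_of_nhds]
  simp only [symb, ← Finset.mul_sum]
  congr 1
  simp only [← mul_assoc, ← Finset.sum_mul]
  have hs : a • η ≠ 0 := smul_ne_zero ha.ne' hη
  have : ∑ i, omg n i (a • η) * omg n i (a • η) = 1 := by
    have hn : ‖a • η‖ ≠ 0 := by simpa using hs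
    have h2 := EuclideanSpace.real_norm_sq_eq (a • η)
    simp only [omg, ← ofReal_mul, ← ofReal_sum]
    norm_cast
    simp only [div_mul_div_comm, ← Finset.sum_div]
    rw [div_eq_one_iff_eq (by positivity), ← sq, h2]
    simp only [sq]
  rw [this, one_mul]

lemma kconv_memLp_meas {n : ℕ} {g : Rn n → ℂ} {b r : ℝ} (hg : Measurable g) (hb : ∀ y, ‖g y‖ ≤ b)
    (hs : ∀ y, r < ‖y‖ → g y = 0) (p : ℝ≥0∞) : MemLp g p volume := by
  have h1 : g = (Metric.closedBall 0 r).indicator g := by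
    ext y
    by_cases hy : y ∈ Metric.closedBall (0 : Rn n) r
    · rw [Set.indicator_of_mem hy]
    · rw [Set.indicator_of_notMem hy]
      exact hs y (by simpa using hy)
  rw [h1, memLp_indicator_iff_restrict Metric.isClosed_closedBall.measurableSet]
  have : IsFiniteMeasure (volume.restrict (Metric.closedBall (0 : Rn n) r)) :=
    ⟨by simpa using measure_closedBall_lt_top⟩
  exact MemLp.of_bound hg.aestronglyMeasurable b (Filter.Eventually.of_forall hb)

/-- The amplitudes in the expansion of the weighted half-wave operator. -/
def ampC (n : ℕ) (c : Rn n → ℂ) (i : Fin n) : Fin 6 → Rn n → ℂ :=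
  ![dirD n i (fun η => omg n i η * c η), fun η => omg n i η * dirD n i c η,
    dirD n i (dirD n i c), fun η => omg n i η * c η, dirD n i c, c]

/-- The multipliers in the expansion of the weighted half-wave operator. -/
def ampF (n : ℕ) (i : Fin n) (a t : ℝ) : Fin 6 → Rn n → ℝ :=
  ![fun _ => -(a * t), fun _ => -(a * t), fun _ => a ^ 2, fun y => -(2 * t * y i),
    fun y => 2 * a * y i, fun y => y i ^ 2]

lemma ann_ampC {n : ℕ} {c : Rn n → ℂ} (h : Ann n c) (i : Fin n) (k : Fin 6) : Ann n (ampC n c i k) := by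
  fin_cases k
  · exact (h.omg i).dirD i
  · exact (h.dirD i).omg i
  · exact (h.dirD i).dirD i
  · exact h.omg i
  · exact h.dirD i
  · exact h

lemma continuous_ampF {n : ℕ} (i : Fin n) (a t : ℝ) (k : Fin 6) : Continuous (ampF n i a t k) := by
  fin_cases k <;> simp [ampF] <;> fun_prop

lemma abs_ampF_le {n : ℕ} (i : Fin n) {a t τ ρ R : ℝ} (ha : 0 < a) (haρ : a ≤ ρ) (hρ : ρ ≤ 1)
    (ht : |t| ≤ τ) (hR : 0 ≤ R) (k : Fin 6) {y : Rn n} (hy : ‖y‖ ≤ R * ρ) :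
    |ampF n i a t k y| ≤ (1 + τ + 2 * τ * R + 2 * R + R ^ 2) * ρ := by
  have hρ0 : 0 < ρ := ha.trans_le haρ
  have hτ : 0 ≤ τ := (abs_nonneg _).trans ht
  have hyi : |y i| ≤ R * ρ := (by simpa using PiLp.norm_apply_le y i : |y i| ≤ ‖y‖).trans hy
  have e1 : |a * t| ≤ ρ * τ := by
    rw [abs_mul, abs_of_pos ha]; gcongr
  have e2 : a ^ 2 ≤ ρ := by nlinarith
  have e3 : |t * y i| ≤ τ * (R * ρ) := by rw [abs_mul]; gcongr
  have e4 : |a * y i| ≤ 1 * (R * ρ) := by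
    rw [abs_mul, abs_of_pos ha]; gcongr; linarith
  have e5 : y i ^ 2 ≤ R ^ 2 * ρ := by
    rw [← sq_abs]
    calc |y i| ^ 2 ≤ (R * ρ) ^ 2 := by gcongr
      _ = R ^ 2 * (ρ * ρ) := by ring
      _ ≤ R ^ 2 * (ρ * 1) := by gcongr
      _ = _ := by ring
  have p1 : 0 ≤ τ * ρ := by positivity
  have p2 : 0 ≤ τ * R * ρ := by positivity
  have p3 : 0 ≤ R * ρ := by positivity
  have p4 : 0 ≤ R ^ 2 * ρ := by positivity
  fin_cases k <;> simp only [ampF, Fin.mk_one, Fin.zero_eta, Fin.isValue, Fin.reduceFinMk] <;> simp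
  · rw [← abs_mul]; nlinarith
  · rw [← abs_mul]; nlinarith
  · nlinarith
  · rw [abs_mul] at e3; nlinarith
  · rw [abs_mul] at e4; nlinarith
  · nlinarith

lemma sq_mul_kconv_wk {n : ℕ} {c : Rn n → ℂ} (h : Ann n c) {a : ℝ} (ha : 0 < a) (t : ℝ)
    {g : Rn n → ℂ} {b r : ℝ} (hg : Measurable g) (hb : ∀ y, ‖g y‖ ≤ b)
    (hs : ∀ y, r < ‖y‖ → g y = 0) (i : Fin n) (x : Rn n) :
    (x i : ℂ) ^ 2 * kconv n (wk n c a t) g x -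
        (t : ℂ) ^ 2 * kconv n (wk n (fun η => omg n i η * (omg n i η * c η)) a t) g x =
      ∑ k, kconv n (wk n (ampC n c i k) a t) (fun y => (ampF n i a t k y : ℂ) * g y) x := by
  have hI : ∀ {c' : Rn n → ℂ} (_ : Ann n c') {f : Rn n → ℝ} (_ : Continuous f),
      Integrable (fun y => wk n c' a t (x - y) * ((f y : ℂ) * g y)) volume := by
    intro c' hc' f hf
    obtain ⟨M, hM⟩ := (isCompact_closedBall (0 : Rn n) r).exists_bound_of_continuousOn hf.continuousOn
    refine integrable_kconv (hc'.memLp_wk ha t 2) (kconv_memLp_meas (b := |M| * |b|) (r := r)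
      (g := fun y => (f y : ℂ) * g y) ((measurable_ofReal.comp hf.measurable).mul hg) (fun y => ?_) (fun y hy => by simp [hs y hy]) 2) x
    by_cases hy : r < ‖y‖
    · simp only [hs y hy, mul_zero, norm_zero]; positivity
    · rw [norm_mul]
      gcongr
      · rw [norm_real]; exact (hM y (by simpa using hy)).trans (le_abs_self _)
      · exact (hb y).trans (le_abs_self _)
  have hI1 : ∀ {c' : Rn n → ℂ} (_ : Ann n c'), Integrable (fun y => wk n c' a t (x - y) * g y) volume := by
    intro c' hc'
    simpa using hI hc' (f := fun _ => 1) continuous_const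
  simp only [kconv]
  rw [← integral_finsetSum _ fun k _ => hI (ann_ampC h i k) (continuous_ampF i a t k),
    ← integral_const_mul, ← integral_const_mul,
    ← integral_sub ((hI1 h).const_mul _) ((hI1 ((h.omg i).omg i)).const_mul _)]
  congr 1
  ext y
  have hx : (x i : ℂ) = ((x - y) i : ℝ) + (y i : ℝ) := by simp
  set z := x - y
  have e0 := mul_wk h ha t i z
  have e1 := mul_wk (h.omg i) ha t i z
  have e2 := mul_wk (h.dirD i) ha t i z
  rw [hx]
  simp only [Fin.sum_univ_six, ampC, ampF, Fin.isValue, Matrix.cons_val]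
  push_cast
  linear_combination (z i + 2 * y i) * g y * e0 - t * g y * e1 + a * g y * e2

end

lemma eLpNorm_le_of_ball {n : ℕ} {g : Rn n → ℂ} {b R ρ : ℝ} (hR : 0 ≤ R) (hρ : 0 ≤ ρ)
    (hg : ∀ y, ‖g y‖ ≤ b) (hs : ∀ y, R * ρ < ‖y‖ → g y = 0) :
    eLpNorm g 2 volume ≤ (ENNReal.ofReal R ^ n * ballVol n) ^ (1 / (2 : ℝ)) *
      ENNReal.ofReal (b * ρ ^ ((n : ℝ) / 2)) := by
  have hb : 0 ≤ b := (norm_nonneg _).trans (hg 0)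
  have h1 : g = (Metric.closedBall 0 (R * ρ)).indicator g := by
    ext y
    by_cases hy : y ∈ Metric.closedBall (0 : Rn n) (R * ρ)
    · rw [Set.indicator_of_mem hy]
    · rw [Set.indicator_of_notMem hy]
      exact hs y (by simpa using hy)
  rw [h1, eLpNorm_indicator_eq_eLpNorm_restrict Metric.isClosed_closedBall.measurableSet]
  refine (eLpNorm_le_of_ae_bound (Filter.Eventually.of_forall hg)).trans ?_
  rw [Measure.restrict_apply_univ, volume_closedBall_Rn n 0 (by positivity),
    ENNReal.ofReal_mul hR, ENNReal.ofReal_mul hb, mul_pow]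
  have h2 : ENNReal.ofReal (ρ ^ ((n : ℝ) / 2)) = (ENNReal.ofReal ρ ^ n) ^ (1 / (2 : ℝ)) := by
    rw [← ENNReal.ofReal_rpow_of_nonneg hρ (by positivity), ← ENNReal.rpow_natCast,
      ← ENNReal.rpow_mul]
    congr 1; ring
  have h3 : ((2 : ℝ≥0∞).toReal)⁻¹ = 1 / (2 : ℝ) := by simp
  rw [h2, h3, mul_right_comm, ENNReal.mul_rpow_of_nonneg _ _ (by norm_num)]
  apply le_of_eq
  ring

lemma Ann.eLpNorm_kconv_le {n : ℕ} {c : Rn n → ℂ} (h : Ann n c) {B : ℝ≥0} (hB : ∀ η, ‖c η‖ ≤ B)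
    {a : ℝ} (ha : 0 < a) (t : ℝ) {g : Rn n → ℂ} (hg : MemLp g 2 volume) :
    eLpNorm (kconv n (wk n c a t) g) 2 volume ≤ B * eLpNorm g 2 volume := by
  rw [h.wk_eq ha]
  exact _root_.eLpNorm_kconv_le _ (fun η => norm_symb_le hB a t η) hg

lemma aestronglyMeasurable_kconv {n : ℕ} {K g : Rn n → ℂ} (hK : Continuous K)
    (hg : AEStronglyMeasurable g volume) : AEStronglyMeasurable (kconv n K g) volume := by
  have : AEStronglyMeasurable (fun p : Rn n × Rn n => K (p.1 - p.2) * g p.2)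
      ((volume : Measure (Rn n)).prod volume) :=
    (hK.comp (continuous_fst.sub continuous_snd)).aestronglyMeasurable.mul hg.comp_snd
  exact this.integral_prod_right'

/-- The function `|x|² - t²`. -/
def cone (n : ℕ) (t : ℝ) (x : Rn n) : ℂ := ((‖x‖ ^ 2 - t ^ 2 : ℝ) : ℂ)

lemma continuous_cone (n : ℕ) (t : ℝ) : Continuous (cone n t) := by unfold cone; fun_prop

lemma cone_mul_kconv {n : ℕ} {c : Rn n → ℂ} (h : Ann n c) {a : ℝ} (ha : 0 < a) (t : ℝ)
    {g : Rn n → ℂ} {b r : ℝ} (hg : Measurable g) (hb : ∀ y, ‖g y‖ ≤ b)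
    (hs : ∀ y, r < ‖y‖ → g y = 0) (x : Rn n) :
    cone n t x * kconv n (wk n c a t) g x =
      ∑ ik : Fin n × Fin 6,
        kconv n (wk n (ampC n c ik.1 ik.2) a t) (fun y => (ampF n ik.1 a t ik.2 y : ℂ) * g y) x := by
  rw [Fintype.sum_prod_type]
  simp_rw [← sq_mul_kconv_wk h ha t hg hb hs]
  rw [Finset.sum_sub_distrib, ← Finset.mul_sum, ← Finset.sum_mul]
  have h1 : kconv n (wk n c a t) g x =
      ∑ i, kconv n (wk n (fun η => omg n i η * (omg n i η * c η)) a t) g x := by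
    simp only [kconv]
    rw [← integral_finsetSum]
    · simp_rw [sum_wk_omg h ha t, Finset.sum_mul]
    · exact fun i _ => integrable_kconv (((h.omg i).omg i).memLp_wk ha t 2)
        (kconv_memLp_meas hg hb hs 2) x
  rw [← h1, cone, EuclideanSpace.real_norm_sq_eq]
  push_cast
  ring

lemma cone_pow_kconv_bound (n N : ℕ) {R τ : ℝ} (hR : 0 ≤ R) (hτ : 0 ≤ τ) :
    ∀ c : Rn n → ℂ, Ann n c → ∃ C : ℝ≥0, ∀ (a ρ t b : ℝ) (g : Rn n → ℂ), 0 < a → a ≤ ρ → ρ ≤ 1 →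
      |t| ≤ τ → Measurable g → (∀ y, ‖g y‖ ≤ b) → (∀ y, R * ρ < ‖y‖ → g y = 0) →
      eLpNorm (fun x => cone n t x ^ N * kconv n (wk n c a t) g x) 2 volume ≤
        C * ENNReal.ofReal (b * ρ ^ N * ρ ^ ((n : ℝ) / 2)) := by
  induction N with
  | zero =>
    intro c hc
    obtain ⟨B, hB⟩ := hc.bound
    have hfin : (ENNReal.ofReal R ^ n * ballVol n) ^ (1 / (2 : ℝ)) ≠ ∞ :=
      ENNReal.rpow_ne_top_of_nonneg (by norm_num : (0 : ℝ) ≤ 1 / 2)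
        (ENNReal.mul_ne_top (ENNReal.pow_ne_top ENNReal.ofReal_ne_top) (ballVol_ne_top n))
    lift (ENNReal.ofReal R ^ n * ballVol n) ^ (1 / (2 : ℝ)) to ℝ≥0 using hfin with D hD
    refine ⟨B * D, fun a ρ t b g ha haρ hρ ht hg hb hs => ?_⟩
    simp only [pow_zero, one_mul, mul_one]
    refine (hc.eLpNorm_kconv_le hB ha t (kconv_memLp_meas hg hb hs 2)).trans ?_
    push_cast
    rw [mul_assoc]
    gcongr
    rw [hD]
    exact eLpNorm_le_of_ball hR (ha.trans_le haρ).le hb hs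
  | succ N ih =>
    intro c hc
    choose C hC using fun ik : Fin n × Fin 6 => ih _ (ann_ampC hc ik.1 ik.2)
    set M : ℝ := 1 + τ + 2 * τ * R + 2 * R + R ^ 2 with hM
    have hM0 : 0 ≤ M := by positivity
    refine ⟨(∑ ik, C ik) * M.toNNReal, fun a ρ t b g ha haρ hρ ht hg hb hs => ?_⟩
    have hb0 : 0 ≤ b := (norm_nonneg _).trans (hb 0)
    have hρ0 : 0 < ρ := ha.trans_le haρ
    have h1 : (fun x => cone n t x ^ (N + 1) * kconv n (wk n c a t) g x) =
        ∑ ik : Fin n × Fin 6, fun x => cone n t x ^ N *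
          kconv n (wk n (ampC n c ik.1 ik.2) a t) (fun y => (ampF n ik.1 a t ik.2 y : ℂ) * g y) x := by
      ext x
      rw [pow_succ, mul_assoc, cone_mul_kconv hc ha t hg hb hs, Finset.sum_apply, Finset.mul_sum]
    have hmeas : ∀ ik : Fin n × Fin 6, Measurable fun y => (ampF n ik.1 a t ik.2 y : ℂ) * g y :=
      fun ik => ((continuous_ofReal.comp (continuous_ampF _ a t _)).measurable).mul hg
    rw [h1]
    refine (eLpNorm_sum_le (fun ik _ => ?_) (by norm_num)).trans ?_
    · exact ((continuous_cone n t).pow N).aestronglyMeasurable.mul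
        (aestronglyMeasurable_kconv ((ann_ampC hc _ _).continuous_wk ha t)
          (hmeas ik).aestronglyMeasurable)
    push_cast
    rw [Finset.sum_mul, Finset.sum_mul]
    refine Finset.sum_le_sum fun ik _ => ?_
    refine (hC ik a ρ t (M * ρ * b) _ ha haρ hρ ht (hmeas ik) (fun y => ?_) (fun y hy => ?_)).trans ?_
    · by_cases hy : R * ρ < ‖y‖
      · simp only [hs y hy, mul_zero, norm_zero]; positivity
      · rw [norm_mul, norm_real]
        gcongr
        · exact abs_ampF_le ik.1 ha haρ hρ ht hR ik.2 (not_lt.mp hy)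
        · exact hb y
    · simp [hs y hy]
    · rw [mul_assoc (C ik : ℝ≥0∞)]
      gcongr
      change _ ≤ ENNReal.ofReal M * _
      rw [← ENNReal.ofReal_mul hM0]
      apply le_of_eq
      congr 1
      ring

lemma pow_add_two_sub_le {a b : ℝ} (ha : 0 ≤ a) (hab : a ≤ b) (k : ℕ) :
    b ^ (k + 2) - a ^ (k + 2) ≤ (k + 2) * b ^ k * (b ^ 2 - a ^ 2) := by
  have hb := ha.trans hab
  have h2 : 0 ≤ b ^ 2 - a ^ 2 := by nlinarith
  induction k with
  | zero => simp; linarith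
  | succ k ih =>
    have h1 := mul_le_mul_of_nonneg_left ih hb
    have h3 : a ^ (k + 2) * (b - a) ≤ b ^ (k + 1) * (b ^ 2 - a ^ 2) := by
      calc a ^ (k + 2) * (b - a) = a ^ (k + 1) * (a * (b - a)) := by ring
        _ ≤ b ^ (k + 1) * (b ^ 2 - a ^ 2) := by gcongr; nlinarith
    push_cast
    have : b ^ (k + 1 + 2) - a ^ (k + 1 + 2) =
      b * (b ^ (k + 2) - a ^ (k + 2)) + a ^ (k + 2) * (b - a) := by ring
    rw [this]
    calc _ ≤ b * ((k + 2) * b ^ k * (b ^ 2 - a ^ 2)) + b ^ (k + 1) * (b ^ 2 - a ^ 2) := add_le_add h1 h3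
      _ = _ := by ring

/-- Volume of the neighbourhood `||x|² - t²| ≤ δ` of a sphere. -/
lemma volume_shell_le {n : ℕ} (hn : 2 ≤ n) {t τ δ : ℝ} (ht : |t| ≤ τ) (hδ : 0 ≤ δ) :
    volume {x : Rn n | |‖x‖ ^ 2 - t ^ 2| ≤ δ} ≤
      ENNReal.ofReal (2 * n * δ * (1 + τ ^ 2 + δ) ^ n) * ballVol n := by
  set b := √(t ^ 2 + δ)
  set a := √(t ^ 2 - δ)
  have ha : 0 ≤ a := Real.sqrt_nonneg _
  have hab : a ≤ b := Real.sqrt_le_sqrt (by linarith)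
  have hb : 0 ≤ b := Real.sqrt_nonneg _
  have hb2 : b ^ 2 = t ^ 2 + δ := Real.sq_sqrt (by positivity)
  have ha2 : t ^ 2 - δ ≤ a ^ 2 := by
    by_cases h : 0 ≤ t ^ 2 - δ
    · rw [Real.sq_sqrt h]
    · nlinarith
  have hsub : {x : Rn n | |‖x‖ ^ 2 - t ^ 2| ≤ δ} ⊆ Metric.closedBall 0 b \ Metric.ball 0 a := by
    intro x hx
    rw [Set.mem_ofPred_eq, abs_le] at hx
    constructor
    · simp only [Metric.mem_closedBall, dist_zero_right]
      exact Real.le_sqrt_of_sq_le (by linarith)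
    · simp only [Metric.mem_ball, dist_zero_right, not_lt]
      exact (Real.sqrt_le_left (norm_nonneg _)).mpr (by linarith)
  have hball : volume (Metric.ball (0 : Rn n) a) = ENNReal.ofReal a ^ n * ballVol n := by
    rw [← volume_closedBall_Rn n 0 ha]
    have : Nontrivial (Rn n) := by
      have : Nonempty (Fin n) := ⟨⟨0, by omega⟩⟩
      infer_instance
    exact (Measure.addHaar_closedBall_eq_addHaar_ball _ _ _).symm
  refine (measure_mono hsub).trans ?_
  rw [measure_sdiff (Metric.ball_subset_closedBall.trans (Metric.closedBall_subset_closedBall hab))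
    measurableSet_ball.nullMeasurableSet measure_ball_lt_top.ne, volume_closedBall_Rn n 0 hb, hball,
    ← ENNReal.sub_mul fun _ _ => ballVol_ne_top n, ← ENNReal.ofReal_pow hb, ← ENNReal.ofReal_pow ha,
    ← ENNReal.ofReal_sub _ (by positivity)]
  gcongr
  obtain ⟨k, rfl⟩ : ∃ k, n = k + 2 := ⟨n - 2, by omega⟩
  refine (pow_add_two_sub_le ha hab k).trans ?_
  have ht2 : t ^ 2 ≤ τ ^ 2 := by rw [← sq_abs t]; gcongr
  have h1 : b ^ 2 - a ^ 2 ≤ 2 * δ := by linarith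
  have h2 : b ^ k ≤ (1 + τ ^ 2 + δ) ^ (k + 2) := by
    have h3 : b ≤ 1 + τ ^ 2 + δ := by nlinarith
    calc b ^ k ≤ (1 + τ ^ 2 + δ) ^ k := by gcongr
      _ ≤ _ := pow_le_pow_right₀ (by nlinarith [sq_nonneg τ]) (by omega)
  have h0 : 0 ≤ b ^ 2 - a ^ 2 := by nlinarith
  calc ((k : ℝ) + 2) * b ^ k * (b ^ 2 - a ^ 2)
      ≤ ((k : ℝ) + 2) * (1 + τ ^ 2 + δ) ^ (k + 2) * (2 * δ) := by gcongr
    _ = _ := by push_cast; ring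

lemma lintegral_shell_le {n : ℕ} (hn : 2 ≤ n) (τ : ℝ) : ∃ C : ℝ≥0∞, C ≠ ∞ ∧ ∀ t ρ : ℝ, |t| ≤ τ →
    0 < ρ → ρ ≤ 1 →
    ∫⁻ x : Rn n, ENNReal.ofReal (((1 + |‖x‖ ^ 2 - t ^ 2| / ρ) ^ (n + 2))⁻¹) ≤ C * ENNReal.ofReal ρ := by
  set A : ℝ := 2 ^ (n + 2) * (2 * n * (2 + τ ^ 2) ^ n) with hA
  have hA0 : 0 ≤ A := by positivity
  refine ⟨ENNReal.ofReal A * ballVol n * ∑' k : ℕ, ENNReal.ofReal ((1 / 2) ^ k), ?_, ?_⟩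
  · refine ENNReal.mul_ne_top (ENNReal.mul_ne_top ENNReal.ofReal_ne_top (ballVol_ne_top n)) ?_
    rw [← ENNReal.ofReal_tsum_of_nonneg (fun _ => by positivity) summable_geometric_two]
    exact ENNReal.ofReal_ne_top
  intro t ρ ht hρ hρ1
  set w : Rn n → ℝ := fun x => |‖x‖ ^ 2 - t ^ 2| / ρ with hw
  have hw0 : ∀ x, 0 ≤ w x := fun x => by positivity
  have hwm : Measurable w := by fun_prop
  have hpt : ∀ x, ENNReal.ofReal (((1 + w x) ^ (n + 2))⁻¹) ≤
      ∑' k : ℕ, {x | w x ≤ 2 ^ k}.indicator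
        (fun _ => ENNReal.ofReal (2 ^ (n + 2) * (((2 : ℝ) ^ k) ^ (n + 2))⁻¹)) x := by
    intro x
    have hex : ∃ k : ℕ, w x ≤ 2 ^ k := by
      obtain ⟨k, hk⟩ := pow_unbounded_of_one_lt (w x) (by norm_num : (1 : ℝ) < 2)
      exact ⟨k, hk.le⟩
    classical
    refine le_trans ?_ (ENNReal.le_tsum (Nat.find hex))
    rw [Set.indicator_of_mem (by exact Nat.find_spec hex)]
    apply ENNReal.ofReal_le_ofReal
    set k := Nat.find hex with hk
    have hle : (2 : ℝ) ^ k ≤ 2 * (1 + w x) := by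
      rcases Nat.eq_zero_or_pos k with h0 | h0
      · rw [h0]; simp; nlinarith [hw0 x]
      · obtain ⟨m, hm⟩ : ∃ m, k = m + 1 := ⟨k - 1, by omega⟩
        have := Nat.find_min hex (m := m) (by omega)
        rw [hm, pow_succ]; linarith
    have : ((2 : ℝ) ^ k) ^ (n + 2) ≤ 2 ^ (n + 2) * (1 + w x) ^ (n + 2) := by
      rw [← mul_pow]; gcongr
    have h1 : 0 < (1 + w x) ^ (n + 2) := by have := hw0 x; positivity
    rw [inv_le_comm₀ h1 (by positivity), mul_inv, inv_inv]
    rw [inv_mul_le_iff₀ (by positivity)]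
    exact this
  refine (lintegral_mono hpt).trans ?_
  rw [lintegral_tsum fun k => (measurable_const.indicator
    (measurableSet_le hwm measurable_const)).aemeasurable, mul_right_comm, ← ENNReal.tsum_mul_left]
  refine ENNReal.tsum_le_tsum fun k => ?_
  rw [lintegral_indicator_const (measurableSet_le hwm measurable_const)]
  have hset : {x | w x ≤ 2 ^ k} = {x : Rn n | |‖x‖ ^ 2 - t ^ 2| ≤ 2 ^ k * ρ} := by
    ext x; simp only [hw, Set.mem_ofPred_eq, div_le_iff₀ hρ]
  rw [hset]
  refine (mul_le_mul' le_rfl (volume_shell_le hn ht (by positivity))).trans ?_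
  rw [← mul_assoc, ← ENNReal.ofReal_mul (by positivity), mul_right_comm _ (ballVol n),
    mul_right_comm _ (ballVol n), ← ENNReal.ofReal_mul hA0, ← ENNReal.ofReal_mul (by positivity)]
  refine mul_le_mul' (ENNReal.ofReal_le_ofReal ?_) le_rfl
  have h1 : 1 + τ ^ 2 + 2 ^ k * ρ ≤ (2 + τ ^ 2) * 2 ^ k := by
    have : (1 : ℝ) ≤ 2 ^ k := one_le_pow₀ (by norm_num)
    nlinarith [sq_nonneg τ]
  have h2 : (1 + τ ^ 2 + 2 ^ k * ρ) ^ n ≤ (2 + τ ^ 2) ^ n * (2 ^ k) ^ n := by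
    rw [← mul_pow]; gcongr
  calc 2 ^ (n + 2) * (((2 : ℝ) ^ k) ^ (n + 2))⁻¹ * (2 * n * (2 ^ k * ρ) * (1 + τ ^ 2 + 2 ^ k * ρ) ^ n)
      ≤ 2 ^ (n + 2) * (((2 : ℝ) ^ k) ^ (n + 2))⁻¹ * (2 * n * (2 ^ k * ρ) *
        ((2 + τ ^ 2) ^ n * (2 ^ k) ^ n)) := by gcongr
    _ = A * ρ * (1 / 2) ^ k := by
      rw [hA, one_div, inv_pow]
      have : (2 : ℝ) ^ k ≠ 0 := by positivity
      field_simp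
      try ring

/-- `L^{p₀}` bound for the half-wave operator applied to a function supported in one small ball. -/
lemma lintegral_kconv_ball_le {n : ℕ} (hn : 2 ≤ n) {p0 : ℝ} (hp0 : 0 < p0) (hp2 : p0 < 2)
    {R τ : ℝ} (hR : 0 ≤ R) (hτ : 0 ≤ τ) {c : Rn n → ℂ} (hc : Ann n c) :
    ∃ C : ℝ≥0∞, C ≠ ∞ ∧ ∀ (a ρ t b : ℝ) (g : Rn n → ℂ), 0 < a → a ≤ ρ → ρ ≤ 1 →
      |t| ≤ τ → Measurable g → (∀ y, ‖g y‖ ≤ b) → (∀ y, R * ρ < ‖y‖ → g y = 0) →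
      ∫⁻ x, ‖kconv n (wk n c a t) g x‖ₑ ^ p0 ≤
        C * ENNReal.ofReal b ^ p0 * ENNReal.ofReal ρ ^ ((n * p0 + 2 - p0) / 2) := by
  set θ : ℝ := 2 * p0 / (2 - p0) with hθ
  have h2p : 0 < 2 - p0 := by linarith
  have hθ0 : 0 < θ := by positivity
  set N : ℕ := ⌈(n + 2) / θ⌉₊ with hN
  have hNθ : (n + 2 : ℝ) ≤ N * θ := by
    rw [← div_le_iff₀ hθ0]; exact Nat.le_ceil _
  obtain ⟨C0, hC0⟩ := cone_pow_kconv_bound n 0 hR hτ c hc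
  obtain ⟨C1, hC1⟩ := cone_pow_kconv_bound n N hR hτ c hc
  obtain ⟨C2, hC2, hC2'⟩ := lintegral_shell_le hn τ
  refine ⟨((C0 + C1 : ℝ≥0) : ℝ≥0∞) ^ p0 * (ENNReal.ofReal (2 ^ N) ^ θ * C2) ^ ((2 - p0) / 2), ?_, ?_⟩
  · refine ENNReal.mul_ne_top (ENNReal.rpow_ne_top_of_nonneg hp0.le ENNReal.coe_ne_top)
      (ENNReal.rpow_ne_top_of_nonneg (by positivity) (ENNReal.mul_ne_top
        (ENNReal.rpow_ne_top_of_nonneg hθ0.le ENNReal.ofReal_ne_top) hC2))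
  intro a ρ t b g ha haρ hρ ht hg hb hs
  have hb0 : 0 ≤ b := (norm_nonneg _).trans (hb 0)
  have hρ0 : 0 < ρ := ha.trans_le haρ
  set T : Rn n → ℂ := kconv n (wk n c a t) g with hT
  have hTm : AEStronglyMeasurable T volume :=
    aestronglyMeasurable_kconv (hc.continuous_wk ha t) hg.aestronglyMeasurable
  set w : Rn n → ℝ := fun x => |‖x‖ ^ 2 - t ^ 2| / ρ with hw
  have hw0 : ∀ x, 0 ≤ w x := fun x => by positivity
  have hwm : Measurable w := by fun_prop
  set V : Rn n → ℂ := (((ρ ^ N)⁻¹ : ℝ) : ℂ) • fun x => cone n t x ^ N * T x with hV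
  have hVm : AEStronglyMeasurable V volume :=
    (((continuous_cone n t).pow N).aestronglyMeasurable.mul hTm).const_smul _
  have hVn : ∀ x, ‖V x‖ = w x ^ N * ‖T x‖ := by
    intro x
    simp only [hV, Pi.smul_apply, smul_eq_mul, norm_mul, norm_pow, norm_real, cone, hw, div_pow,
      Real.norm_eq_abs]
    rw [abs_of_pos (by positivity)]
    ring
  have hu2 : eLpNorm (fun x => ‖T x‖ + ‖V x‖) 2 volume ≤
      ((C0 + C1 : ℝ≥0) : ℝ≥0∞) * ENNReal.ofReal (b * ρ ^ ((n : ℝ) / 2)) := by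
    refine (eLpNorm_add_le hTm.norm hVm.norm (by norm_num)).trans ?_
    rw [eLpNorm_norm, eLpNorm_norm]
    push_cast
    rw [add_mul]
    gcongr
    · have := hC0 a ρ t b g ha haρ hρ ht hg hb hs
      simpa using this
    · rw [hV, eLpNorm_const_smul]
      have := hC1 a ρ t b g ha haρ hρ ht hg hb hs
      refine (mul_le_mul' le_rfl this).trans (le_of_eq ?_)
      rw [← ofReal_norm, norm_real, Real.norm_of_nonneg (by positivity)]
      rw [← mul_assoc, mul_comm _ (C1 : ℝ≥0∞), mul_assoc, ← ENNReal.ofReal_mul (by positivity)]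
      congr 2
      field_simp
  have hpt : ∀ x, ‖T x‖ₑ ^ p0 =
      ((fun x => ‖(‖T x‖ + ‖V x‖)‖ₑ ^ p0) * fun x => ENNReal.ofReal ((1 + w x ^ N)⁻¹) ^ p0) x := by
    intro x
    have hpos : 0 < 1 + w x ^ N := by have := hw0 x; positivity
    rw [Pi.mul_apply, ← ENNReal.mul_rpow_of_nonneg _ _ hp0.le]
    congr 1
    rw [← ofReal_norm, ← ofReal_norm, ← ENNReal.ofReal_mul (norm_nonneg _),
      Real.norm_of_nonneg (by positivity), hVn]
    congr 1
    field_simp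
  have hconj : (2 / p0).HolderConjugate (2 / (2 - p0)) := by
    rw [Real.holderConjugate_iff]
    constructor
    · rw [lt_div_iff₀ hp0]; linarith
    · field_simp; ring
  calc ∫⁻ x, ‖T x‖ₑ ^ p0 = ∫⁻ x, ((fun x => ‖(‖T x‖ + ‖V x‖)‖ₑ ^ p0) *
        fun x => ENNReal.ofReal ((1 + w x ^ N)⁻¹) ^ p0) x := lintegral_congr hpt
    _ ≤ (∫⁻ x, (‖(‖T x‖ + ‖V x‖)‖ₑ ^ p0) ^ (2 / p0)) ^ (1 / (2 / p0)) *
        (∫⁻ x, (ENNReal.ofReal ((1 + w x ^ N)⁻¹) ^ p0) ^ (2 / (2 - p0))) ^ (1 / (2 / (2 - p0))) := by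
      refine ENNReal.lintegral_mul_le_Lp_mul_Lq _ hconj ?_ ?_
      · exact (hTm.norm.add hVm.norm).enorm.pow_const p0
      · exact (by fun_prop : Measurable fun x => ENNReal.ofReal ((1 + w x ^ N)⁻¹)).aemeasurable.pow_const _
    _ ≤ (((C0 + C1 : ℝ≥0) : ℝ≥0∞) * ENNReal.ofReal (b * ρ ^ ((n : ℝ) / 2))) ^ p0 *
        (ENNReal.ofReal (2 ^ N) ^ θ * (C2 * ENNReal.ofReal ρ)) ^ ((2 - p0) / 2) := by
      gcongr ?_ * ?_
      · have e : (∫⁻ x, (‖(‖T x‖ + ‖V x‖)‖ₑ ^ p0) ^ (2 / p0)) ^ (1 / (2 / p0)) =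
            eLpNorm (fun x => ‖T x‖ + ‖V x‖) 2 volume ^ p0 := by
          rw [eLpNorm_eq_lintegral_rpow_enorm_toReal (by norm_num) (by norm_num)]
          simp only [← ENNReal.rpow_mul, ENNReal.toReal_ofNat]
          congr 1
          · congr 1; ext x; congr 1; field_simp
          · field_simp
        rw [e]
        gcongr
      · rw [one_div_div]
        gcongr
        refine le_trans ?_ (mul_le_mul' le_rfl (hC2' t ρ ht hρ0 hρ))
        rw [← lintegral_const_mul' _ _ (ENNReal.rpow_ne_top_of_nonneg hθ0.le ENNReal.ofReal_ne_top)]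
        refine lintegral_mono fun x => ?_
        have hw1 := hw0 x
        rw [← ENNReal.rpow_mul, show p0 * (2 / (2 - p0)) = θ by rw [hθ]; ring]
        have h1 : (1 + w x ^ N)⁻¹ ≤ 2 ^ N * ((1 + w x) ^ N)⁻¹ := by
          rw [inv_le_comm₀ (by positivity) (by positivity), mul_inv, inv_inv,
            inv_mul_le_iff₀ (by positivity)]
          rcases le_total (w x) 1 with h | h
          · calc (1 + w x) ^ N ≤ 2 ^ N := by gcongr; linarith
              _ ≤ 2 ^ N * (1 + w x ^ N) := le_mul_of_one_le_right (by positivity)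
                  (by have := pow_nonneg hw1 N; linarith)
          · calc (1 + w x) ^ N ≤ (2 * w x) ^ N := by gcongr; linarith
              _ = 2 ^ N * w x ^ N := mul_pow _ _ _
              _ ≤ _ := by gcongr; linarith
        calc ENNReal.ofReal ((1 + w x ^ N)⁻¹) ^ θ ≤ ENNReal.ofReal (2 ^ N * ((1 + w x) ^ N)⁻¹) ^ θ := by
              gcongr
          _ = ENNReal.ofReal (2 ^ N) ^ θ * ENNReal.ofReal (((1 + w x) ^ N)⁻¹) ^ θ := by
              rw [ENNReal.ofReal_mul (by positivity), ENNReal.mul_rpow_of_nonneg _ _ hθ0.le]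
          _ ≤ _ := by
              gcongr
              rw [ENNReal.ofReal_rpow_of_nonneg (by positivity) hθ0.le]
              apply ENNReal.ofReal_le_ofReal
              rw [Real.inv_rpow (by positivity)]
              gcongr
              rw [← Real.rpow_natCast (1 + w x) N, ← Real.rpow_mul (by positivity)]
              change (1 + w x) ^ (n + 2) ≤ _
              rw [← Real.rpow_natCast]
              apply Real.rpow_le_rpow_of_exponent_le (by linarith)
              push_cast
              exact hNθ
    _ = _ := by
      rw [ENNReal.ofReal_mul hb0, ENNReal.mul_rpow_of_nonneg _ _ hp0.le,
        ENNReal.mul_rpow_of_nonneg _ _ hp0.le, ← mul_assoc (_ ^ θ),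
        ENNReal.mul_rpow_of_nonneg (_ * C2) _ (by positivity), ← ENNReal.ofReal_rpow_of_pos hρ0,
        ← ENNReal.rpow_mul]
      rw [show (n * p0 + 2 - p0) / 2 = n / 2 * p0 + (2 - p0) / 2 by ring,
        ENNReal.rpow_add _ _ (by simpa using hρ0) ENNReal.ofReal_ne_top]
      ring

lemma exists_cell_eq (n m : ℕ) (v : Fin n → ℤ) : ∃ x, cell n m x = v := by
  by_contra! h
  have h1 : {x | cell n m x = v} = ∅ := Set.eq_empty_iff_forall_notMem.mpr fun x hx => h x hx
  have h2 := volume_cell n m v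
  rw [h1, measure_empty] at h2
  exact two_rpow_ne_zero _ h2.symm

lemma kconv_indicator_translate {n : ℕ} (K g : Rn n → ℂ) (x z : Rn n) :
    kconv n K g (x + z) = kconv n K (fun y => g (y + z)) x := by
  unfold kconv
  rw [← integral_add_right_eq_self _ z]
  refine integral_congr_ae (Filter.Eventually.of_forall fun y => ?_)
  simp only [add_sub_add_right_eq_sub]

/-- Estimate for the half-wave kernels acting on a function supported in one dyadic cube. -/
lemma lintegral_kconv_cell_le {n : ℕ} (hn : 2 ≤ n) {p0 τ : ℝ} (hp0 : 0 < p0) (hp2 : p0 < 2)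
    (hτ : 0 ≤ τ) {c : Rn n → ℂ} (hc : Ann n c) :
    ∃ C : ℝ≥0∞, C ≠ ∞ ∧ C ≠ 0 ∧ ∀ (j m : ℕ) (t : ℝ) (g : Rn n → ℂ) (d : Rn n → ℝ≥0∞)
      (v : Fin n → ℤ), m ≤ j → |t| ≤ τ → Measurable g →
      (∀ x y, cell n m x = cell n m y → d x = d y) → (∀ x, ‖g x‖ₑ ≤ d x) →
      ∫⁻ x, ‖kconv n (wk n c ((2 : ℝ) ^ j)⁻¹ t) ({x | cell n m x = v}.indicator g) x‖ₑ ^ p0 ≤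
        C * (2 : ℝ≥0∞) ^ ((m : ℝ) * (((n : ℝ) - 1) / 2 * (2 - p0))) *
          ∫⁻ x in {x | cell n m x = v}, d x ^ p0 := by
  obtain ⟨C, hC, hCb⟩ := lintegral_kconv_ball_le hn hp0 hp2 (Real.sqrt_nonneg n) hτ hc
  refine ⟨C + 1, by simp [hC], by simp, ?_⟩
  intro j m t g d v hmj ht hg hd hgd
  obtain ⟨z, hz⟩ := exists_cell_eq n m v
  have h_integrable : ∫⁻ x in {x | cell n m x = v}, d x ^ p0 =
      d z ^ p0 * (2 : ℝ≥0∞) ^ (-((m : ℝ) * n)) := by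
    rw [← volume_cell n m v, ← setLIntegral_const]
    refine setLIntegral_congr_fun (measurableSet_cell n m v) fun x hx => ?_
    have hx' : cell n m x = v := hx
    simp only [hd x z (hx'.trans hz.symm)]
  rw [h_integrable]
  rcases eq_or_ne (d z) ∞ with htop | htop
  · rw [htop, ENNReal.top_rpow_of_pos hp0, ENNReal.top_mul (two_rpow_ne_zero _),
      ENNReal.mul_top (mul_ne_zero (by simp) (two_rpow_ne_zero _))]
    exact le_top
  set b : ℝ := (d z).toReal with hb
  set E : Set (Rn n) := {x | cell n m x = v} with hE
  have hEm : MeasurableSet E := measurableSet_cell n m v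
  have h2m : (0 : ℝ) < 2 ^ m := by positivity
  have h1 := hCb ((2 : ℝ) ^ j)⁻¹ ((2 : ℝ) ^ m)⁻¹ t b (fun y => E.indicator g (y + z)) (by positivity)
    (by gcongr; norm_num) (inv_le_one_of_one_le₀ (one_le_pow₀ (by norm_num))) ht
    ((hg.indicator hEm).comp (measurable_add_const z)) (by
      intro y
      by_cases hy : y + z ∈ E
      · rw [Set.indicator_of_mem hy, hb, ← ENNReal.ofReal_le_iff_le_toReal htop, ofReal_norm]
        have hy' : cell n m (y + z) = v := hy
        rw [← hd (y + z) z (hy'.trans hz.symm)]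
        exact hgd _
      · rw [Set.indicator_of_notMem hy, norm_zero]
        exact ENNReal.toReal_nonneg) (by
      intro y hy
      refine Set.indicator_of_notMem (fun hyE => ?_) _
      have hy' : cell n m (y + z) = v := hyE
      have h3 := dist_le_of_cell_eq (hy'.trans hz.symm)
      rw [add_sub_cancel_right] at h3
      rw [← div_eq_mul_inv, div_lt_iff₀ h2m] at hy
      linarith)
  rw [← lintegral_add_right_eq_self _ z]
  simp only [kconv_indicator_translate]
  refine h1.trans ?_
  rw [hb, ENNReal.ofReal_toReal htop, ENNReal.ofReal_inv_of_pos h2m, ENNReal.ofReal_pow (by norm_num),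
    ENNReal.ofReal_ofNat, ← ENNReal.rpow_natCast, ← ENNReal.rpow_neg, ← ENNReal.rpow_mul]
  calc C * d z ^ p0 * (2 : ℝ≥0∞) ^ (-(m : ℝ) * ((n * p0 + 2 - p0) / 2))
      ≤ (C + 1) * d z ^ p0 * (2 : ℝ≥0∞) ^ (-(m : ℝ) * ((n * p0 + 2 - p0) / 2)) := by
        gcongr; exact le_self_add
    _ = (C + 1) * d z ^ p0 * ((2 : ℝ≥0∞) ^ ((m : ℝ) * (((n : ℝ) - 1) / 2 * (2 - p0))) *
        2 ^ (-((m : ℝ) * n))) := by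
        rw [← two_rpow_add]; congr 2; ring
    _ = _ := by ring

/-- `L^{p_0}` bounds, `p_0 ≤ 1`, for functions dominated by one which is constant on dyadic
cubes. -/
lemma lintegral_kconv_le_of_le_one {n : ℕ} (hn : 2 ≤ n) {p0 τ : ℝ} (hp0 : 0 < p0) (hp1 : p0 ≤ 1)
    (hτ : 0 ≤ τ) {c : Rn n → ℂ} (hc : Ann n c) :
    ∃ C : ℝ≥0∞, C ≠ ∞ ∧ C ≠ 0 ∧ ∀ (j m : ℕ) (t : ℝ) (g : Rn n → ℂ) (d : Rn n → ℝ≥0∞),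
      m ≤ j → |t| ≤ τ → Measurable g → MemLp g 2 volume →
      (∀ x y, cell n m x = cell n m y → d x = d y) → (∀ x, ‖g x‖ₑ ≤ d x) →
      ∫⁻ x, ‖kconv n (wk n c ((2 : ℝ) ^ j)⁻¹ t) g x‖ₑ ^ p0 ≤
        C * (2 : ℝ≥0∞) ^ ((m : ℝ) * (((n : ℝ) - 1) / 2 * (2 - p0))) * ∫⁻ x, d x ^ p0 := by
  obtain ⟨C, hC, hC0, hCb⟩ := lintegral_kconv_cell_le hn hp0 (by linarith) hτ hc
  refine ⟨C, hC, hC0, fun j m t g d hmj ht hg hg2 hd hgd => ?_⟩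
  set K := wk n c ((2 : ℝ) ^ j)⁻¹ t with hK
  have ha : (0 : ℝ) < ((2 : ℝ) ^ j)⁻¹ := by positivity
  have hKm : Continuous K := hc.continuous_wk ha t
  set E : (Fin n → ℤ) → Set (Rn n) := fun v => {x | cell n m x = v} with hE
  have hEm : ∀ v, MeasurableSet (E v) := measurableSet_cell n m
  have hEd : Pairwise (Function.onFun Disjoint E) := by
    intro v w hvw
    refine Set.disjoint_left.mpr fun x hx hx' => hvw ?_
    have h1 : cell n m x = v := hx
    have h2 : cell n m x = w := hx'
    rw [← h1, h2]
  have hEu : ⋃ v, E v = Set.univ := Set.eq_univ_of_forall fun x => Set.mem_iUnion.mpr ⟨cell n m x, rfl⟩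
  have hsum : ∀ x, ‖kconv n K g x‖ₑ ≤ ∑' v, ‖kconv n K ((E v).indicator g) x‖ₑ := by
    intro x
    have h1 : kconv n K g x = ∑' v, kconv n K ((E v).indicator g) x := by
      unfold kconv
      rw [← setIntegral_univ, ← hEu, integral_iUnion hEm hEd
        (integrable_kconv (hc.memLp_wk ha t 2) hg2 x).integrableOn]
      refine tsum_congr fun v => ?_
      rw [← integral_indicator (hEm v)]
      refine integral_congr_ae (Filter.Eventually.of_forall fun y => ?_)
      by_cases hy : y ∈ E v
      · simp only [Set.indicator_of_mem hy, hK]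
      · simp only [Set.indicator_of_notMem hy, mul_zero]
    rw [h1]
    exact enorm_tsum_le_tsum_enorm
  calc ∫⁻ x, ‖kconv n K g x‖ₑ ^ p0
      ≤ ∫⁻ x, ∑' v, ‖kconv n K ((E v).indicator g) x‖ₑ ^ p0 := by
        refine lintegral_mono fun x => ?_
        exact (ENNReal.rpow_le_rpow (hsum x) hp0.le).trans (tsum_rpow_le_tsum_rpow hp0 hp1 _)
    _ = ∑' v, ∫⁻ x, ‖kconv n K ((E v).indicator g) x‖ₑ ^ p0 := by
        refine lintegral_tsum fun v => ?_
        exact (aestronglyMeasurable_kconv hKm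
          (hg.indicator (hEm v)).aestronglyMeasurable).enorm.pow_const p0
    _ ≤ ∑' v, C * (2 : ℝ≥0∞) ^ ((m : ℝ) * (((n : ℝ) - 1) / 2 * (2 - p0))) *
          ∫⁻ x in E v, d x ^ p0 :=
        ENNReal.tsum_le_tsum fun v => hCb j m t g d v hmj ht hg hd hgd
    _ = _ := by
        rw [ENNReal.tsum_mul_left, ← lintegral_iUnion hEm hEd, hEu, setLIntegral_univ]

lemma measurable_kconv {n : ℕ} {K g : Rn n → ℂ} (hK : Continuous K)
    (hg : Measurable g) : Measurable (kconv n K g) := by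
  have : StronglyMeasurable (fun p : Rn n × Rn n => K (p.1 - p.2) * g p.2) :=
    ((hK.comp (continuous_fst.sub continuous_snd)).measurable.mul
      (hg.comp measurable_snd)).stronglyMeasurable
  exact this.integral_prod_right'.measurable

lemma lintegral_enorm_sq_eq {α : Type*} [MeasurableSpace α] {μ : Measure α} (f : α → ℂ) :
    ∫⁻ x, ‖f x‖ₑ ^ (2 : ℝ) ∂μ = eLpNorm f 2 μ ^ (2 : ℝ) := by
  rw [eLpNorm_eq_lintegral_rpow_enorm_toReal (by norm_num) (by norm_num), ← ENNReal.rpow_mul]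
  simp

lemma meas_lt_le_lintegral {α : Type*} [MeasurableSpace α] {μ : Measure α} {r : ℝ} (hr : 0 < r)
    {F : α → ℝ≥0∞} (hF : Measurable F) (k : ℤ) :
    μ {x | (2 : ℝ≥0∞) ^ ((k : ℝ) - 1) < F x} ≤
      2 ^ r * (2 ^ (-((k : ℝ) * r)) * ∫⁻ x, F x ^ r ∂μ) := by
  have h1 := mul_meas_ge_le_lintegral (μ := μ) (hF.pow_const r) ((2 : ℝ≥0∞) ^ (((k : ℝ) - 1) * r))
  have h2 : μ {x | (2 : ℝ≥0∞) ^ ((k : ℝ) - 1) < F x} ≤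
      μ {x | (2 : ℝ≥0∞) ^ (((k : ℝ) - 1) * r) ≤ F x ^ r} := by
    refine measure_mono fun x hx => ?_
    have hx' : (2 : ℝ≥0∞) ^ ((k : ℝ) - 1) < F x := hx
    rw [Set.mem_ofPred_eq, ENNReal.rpow_mul]
    gcongr
  refine h2.trans ?_
  rw [← mul_assoc, ← two_rpow_add]
  calc μ {x | (2 : ℝ≥0∞) ^ (((k : ℝ) - 1) * r) ≤ F x ^ r}
      = 2 ^ (r + -((k : ℝ) * r)) * ((2 : ℝ≥0∞) ^ (((k : ℝ) - 1) * r) *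
        μ {x | (2 : ℝ≥0∞) ^ (((k : ℝ) - 1) * r) ≤ F x ^ r}) := by
        rw [← mul_assoc, ← two_rpow_add]
        ring_nf
        rw [ENNReal.rpow_zero, one_mul]
    _ ≤ _ := by gcongr

/-- `L^p` bounds, `0 < p < 2`, for the half-wave kernels acting on functions dominated by one
which is constant on dyadic cubes. -/
lemma lintegral_kconv_rpow_le {n : ℕ} (hn : 2 ≤ n) {p τ : ℝ} (hp0 : 0 < p) (hp2 : p < 2)
    (hτ : 0 ≤ τ) {c : Rn n → ℂ} (hc : Ann n c) :
    ∃ C : ℝ≥0∞, C ≠ ∞ ∧ ∀ (j m : ℕ) (t : ℝ) (g : Rn n → ℂ) (d : Rn n → ℝ≥0∞),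
      m ≤ j → |t| ≤ τ → Measurable g → MemLp g 2 volume →
      (∀ x y, cell n m x = cell n m y → d x = d y) → (∀ x, ‖g x‖ₑ ≤ d x) →
      ∫⁻ x, ‖kconv n (wk n c ((2 : ℝ) ^ j)⁻¹ t) g x‖ₑ ^ p ≤
        C * (2 : ℝ≥0∞) ^ ((m : ℝ) * (((n : ℝ) - 1) / 2 * (2 - p))) * ∫⁻ x, d x ^ p := by
  have hr0 : 0 < p / 2 := by positivity
  have hrp : p / 2 < p := by linarith
  obtain ⟨C, hC, -, hCb⟩ := lintegral_kconv_le_of_le_one hn hr0 (by linarith) hτ hc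
  obtain ⟨B, hB⟩ := hc.bound
  set r := p / 2 with hr
  set β := ((n : ℝ) - 1) / 2 with hβ
  refine ⟨2 ^ p * (2 ^ r * C * geomSum (p - r) + 2 ^ (2 : ℝ) * (B : ℝ≥0∞) ^ (2 : ℝ) * geomSum (2 - p)), ?_, ?_⟩
  · have h1 := geomSum_ne_top (ε := p - r) (by linarith)
    have h2 := geomSum_ne_top (ε := 2 - p) (by linarith)
    refine ENNReal.mul_ne_top (two_rpow_ne_top _) (ENNReal.add_ne_top.mpr ⟨?_, ?_⟩)
    · exact ENNReal.mul_ne_top (ENNReal.mul_ne_top (two_rpow_ne_top _) hC) h1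
    · exact ENNReal.mul_ne_top (ENNReal.mul_ne_top (two_rpow_ne_top _)
        (ENNReal.rpow_ne_top_of_nonneg (by norm_num) ENNReal.coe_ne_top)) h2
  intro j m t g d hmj ht hg hg2 hd hgd
  have ha : (0 : ℝ) < ((2 : ℝ) ^ j)⁻¹ := by positivity
  set K := wk n c ((2 : ℝ) ^ j)⁻¹ t with hK
  have hKc : Continuous K := hc.continuous_wk ha t
  have hdm : Measurable d := measurable_of_cell hd
  have hF : Measurable fun x => ‖kconv n K g x‖ₑ := (measurable_kconv hKc hg).enorm
  set γ : ℝ≥0∞ := 2 ^ ((m : ℝ) * β) with hγ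
  have key := lintegral_rpow_le_of_meas_le (μ := (volume : Measure (Rn n))) (p := p) (p0 := r) hr0
    hrp hp2 (γ := γ) (A := 2 ^ r * (C * 2 ^ ((m : ℝ) * (β * (2 - r)))))
    (B := 2 ^ (2 : ℝ) * (B : ℝ≥0∞) ^ (2 : ℝ)) (two_rpow_ne_zero _) (two_rpow_ne_top _) hF hdm ?_
  · refine key.trans (le_of_eq ?_)
    congr 1
    have e1 : (2 : ℝ≥0∞) ^ ((m : ℝ) * (β * (2 - r))) * γ ^ (r - p) =
        2 ^ ((m : ℝ) * (β * (2 - p))) := by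
      rw [hγ, ← ENNReal.rpow_mul, ← two_rpow_add]; congr 1; ring
    have e2 : γ ^ (2 - p) = 2 ^ ((m : ℝ) * (β * (2 - p))) := by
      rw [hγ, ← ENNReal.rpow_mul]; congr 1; ring
    rw [mul_assoc ((2 : ℝ≥0∞) ^ p), add_mul, e2, ← e1]
    ring
  intro k
  set E : Set (Rn n) := {x | γ * 2 ^ (k : ℝ) < d x} with hE
  have hEm : MeasurableSet E := measurableSet_lt measurable_const hdm
  have hg1 : Measurable (E.indicator g) := hg.indicator hEm
  have hg2' : Measurable (Eᶜ.indicator g) := hg.indicator hEm.compl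
  have hL1 : MemLp (E.indicator g) 2 volume := hg2.indicator hEm
  have hL2 : MemLp (Eᶜ.indicator g) 2 volume := hg2.indicator hEm.compl
  have hsplit : ∀ x, kconv n K g x = kconv n K (E.indicator g) x + kconv n K (Eᶜ.indicator g) x := by
    intro x
    have hKL := hc.memLp_wk ha t 2
    unfold kconv
    rw [← integral_add (integrable_kconv hKL hL1 x) (integrable_kconv hKL hL2 x)]
    refine integral_congr_ae (Filter.Eventually.of_forall fun y => ?_)
    simp only
    rw [← mul_add, ← Pi.add_apply, Set.indicator_self_add_compl]
  have hsub : {x | (2 : ℝ≥0∞) ^ (k : ℝ) < ‖kconv n K g x‖ₑ} ⊆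
      {x | (2 : ℝ≥0∞) ^ ((k : ℝ) - 1) < ‖kconv n K (E.indicator g) x‖ₑ} ∪
      {x | (2 : ℝ≥0∞) ^ ((k : ℝ) - 1) < ‖kconv n K (Eᶜ.indicator g) x‖ₑ} := by
    intro x hx
    have hx' : (2 : ℝ≥0∞) ^ (k : ℝ) < ‖kconv n K g x‖ₑ := hx
    by_contra hcon
    simp only [Set.mem_union, Set.mem_ofPred_eq, not_or, not_lt] at hcon
    refine absurd hx' (not_lt.mpr ?_)
    rw [hsplit]
    refine (enorm_add_le _ _).trans ((add_le_add hcon.1 hcon.2).trans (le_of_eq ?_))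
    rw [← two_mul, show (k : ℝ) = 1 + ((k : ℝ) - 1) by ring, two_rpow_add, ENNReal.rpow_one]
    ring_nf
  refine (measure_mono hsub).trans ((measure_union_le _ _).trans (add_le_add ?_ ?_))
  · refine (meas_lt_le_lintegral hr0 (measurable_kconv hKc hg1).enorm k).trans ?_
    have h1 := hCb j m t (E.indicator g)
      (fun x => open Classical in if γ * 2 ^ (k : ℝ) < d x then d x else 0) hmj ht hg1 hL1
      (fun x y hxy => by simp only [hd x y hxy]) (fun x => by
        by_cases hx : γ * 2 ^ (k : ℝ) < d x
        · rw [if_pos hx]; exact (enorm_indicator_le_enorm_self _ _).trans (hgd x)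
        · rw [if_neg hx, Set.indicator_of_notMem (show x ∉ E from hx), enorm_zero])
    calc _ ≤ (2 : ℝ≥0∞) ^ r * (2 ^ (-((k : ℝ) * r)) * (C * 2 ^ ((m : ℝ) * (β * (2 - r))) *
          ∫⁻ x, (open Classical in if γ * 2 ^ (k : ℝ) < d x then d x else 0) ^ r)) := by
          gcongr
      _ = _ := by ring
  · refine (meas_lt_le_lintegral two_pos (measurable_kconv hKc hg2').enorm k).trans ?_
    have h1 : ∫⁻ x, ‖kconv n K (Eᶜ.indicator g) x‖ₑ ^ (2 : ℝ) ≤ (B : ℝ≥0∞) ^ (2 : ℝ) *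
        ∫⁻ x, (open Classical in if γ * 2 ^ (k : ℝ) < d x then 0 else d x) ^ (2 : ℝ) := by
      rw [lintegral_enorm_sq_eq]
      refine (ENNReal.rpow_le_rpow (hc.eLpNorm_kconv_le hB ha t hL2) (by norm_num)).trans ?_
      rw [ENNReal.mul_rpow_of_nonneg _ _ (by norm_num), ← lintegral_enorm_sq_eq]
      gcongr with x
      by_cases hx : γ * 2 ^ (k : ℝ) < d x
      · rw [if_pos hx, Set.indicator_of_notMem (by simpa [hE] using hx), enorm_zero]
      · rw [if_neg hx]; exact (enorm_indicator_le_enorm_self _ _).trans (hgd x)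
    calc _ ≤ (2 : ℝ≥0∞) ^ (2 : ℝ) * (2 ^ (-((k : ℝ) * 2)) * ((B : ℝ≥0∞) ^ (2 : ℝ) *
        ∫⁻ x, (open Classical in if γ * 2 ^ (k : ℝ) < d x then 0 else d x) ^ (2 : ℝ))) := by
          gcongr
      _ = _ := by ring

lemma tsum_ite_sub (i : ℕ) (D : ℕ → ℝ≥0∞) :
    ∑' j, (if i ≤ j then D (j - i) else 0) = ∑' m, D m := by
  rw [← (add_left_injective i).tsum_eq (f := fun j => if i ≤ j then D (j - i) else 0)]
  · simp
  · intro j hj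
    have : i ≤ j := by
      by_contra h
      exact hj (if_neg h)
    exact ⟨j - i, by simp [this]⟩

/-- Vector-valued estimate: the sum over dyadic frequencies of the half-wave kernels, normalised at
the critical order, acting on functions whose local maximal functions are dominated by `G`. -/
lemma tsum_lintegral_kconv_rpow_le {n : ℕ} (hn : 2 ≤ n) {p τ : ℝ} (hp0 : 0 < p) (hp2 : p < 2)
    (hτ : 0 ≤ τ) {c : Rn n → ℂ} (hc : Ann n c) :
    ∃ C : ℝ≥0∞, C ≠ ∞ ∧ ∀ (t : ℝ) (f : ℕ → Rn n → ℂ) (G : Rn n → ℝ≥0∞),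
      |t| ≤ τ → (∀ j, Measurable (f j)) → (∀ j, MemLp (f j) 2 volume) →
      (∀ j x y, cell n j x = cell n j y → ‖f j x‖ₑ ≤ G y) →
      ∑' j : ℕ, (2 : ℝ≥0∞) ^ (-((j : ℝ) * (((n : ℝ) - 1) / 2 * (2 - p)))) *
        ∫⁻ x, ‖kconv n (wk n c ((2 : ℝ) ^ j)⁻¹ t) (f j) x‖ₑ ^ p ≤ C * ∫⁻ x, G x ^ p := by
  obtain ⟨C, hC, hCb⟩ := lintegral_kconv_rpow_le hn hp0 hp2 hτ hc
  set κ := ((n : ℝ) - 1) / 2 * (2 - p) with hκ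
  have hn' : (2 : ℝ) ≤ n := by exact_mod_cast hn
  have hκ0 : 0 < κ := by
    have : 0 < ((n : ℝ) - 1) / 2 := by linarith
    have : 0 < 2 - p := by linarith
    positivity
  set δ := κ / 2 / p with hδ
  have hδp : δ * p = κ / 2 := by rw [hδ]; field_simp
  refine ⟨geomSum δ ^ p * (C * 2 ^ p) * (geomSum (κ / 2) * geomSum p), ?_, ?_⟩
  · have h1 := geomSum_ne_top (ε := δ) (by positivity)
    have h2 := geomSum_ne_top (ε := κ / 2) (by positivity)
    have h3 := geomSum_ne_top hp0
    exact ENNReal.mul_ne_top (ENNReal.mul_ne_top (ENNReal.rpow_ne_top_of_nonneg hp0.le h1)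
      (ENNReal.mul_ne_top hC (two_rpow_ne_top _))) (ENNReal.mul_ne_top h2 h3)
  intro t f G ht hfm hf2 hfG
  obtain ⟨d, hd, hdG, hex⟩ := exists_dyadic_decomposition n hp0 G
  have hdm : ∀ m, Measurable (d m) := fun m => measurable_of_cell (hd m)
  set D : ℕ → ℝ≥0∞ := fun m => ∫⁻ x, d m x ^ p with hD
  have hDs : ∑' m, D m ≤ geomSum p * ∫⁻ x, G x ^ p := by
    rw [← lintegral_tsum fun m => ((hdm m).pow_const p).aemeasurable,
      ← lintegral_const_mul' _ _ (geomSum_ne_top hp0)]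
    exact lintegral_mono hdG
  set E : ℕ → ℕ → Set (Rn n) := fun j m =>
    {x | ‖f j x‖ₑ ≤ 2 * d m x} \ ⋃ i ∈ Finset.range m, {x | ‖f j x‖ₑ ≤ 2 * d i x} with hE
  have hSm : ∀ j m, MeasurableSet {x | ‖f j x‖ₑ ≤ 2 * d m x} := fun j m =>
    measurableSet_le (hfm j).enorm ((hdm m).const_mul 2)
  have hEm : ∀ j m, MeasurableSet (E j m) := fun j m =>
    (hSm j m).diff (Finset.measurableSet_biUnion _ fun i _ => hSm j i)
  have hsplit : ∀ j x, f j x = ∑ m ∈ Finset.range (j + 1), (E j m).indicator (f j) x := by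
    intro j x
    obtain ⟨m, hmj, hm⟩ := hex j (fun x => ‖f j x‖ₑ) (hfG j) x enorm_ne_top
    have hex' : ∃ m, ‖f j x‖ₑ ≤ 2 * d m x := ⟨m, hm⟩
    classical
    have hfind : ∀ i, x ∈ E j i ↔ i = Nat.find hex' := by
      intro i
      simp only [hE, Set.mem_sdiff, Set.mem_ofPred_eq, Set.mem_iUnion, not_exists, Finset.mem_range]
      constructor
      · rintro ⟨h1, h2⟩
        exact ((Nat.find_eq_iff hex').mpr ⟨h1, fun k hk => h2 k hk⟩).symm
      · rintro rfl
        exact ⟨Nat.find_spec hex', fun k hk => Nat.find_min hex' hk⟩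
    rw [Finset.sum_eq_single (Nat.find hex')]
    · rw [Set.indicator_of_mem ((hfind _).mpr rfl)]
    · intro i _ hi
      exact Set.indicator_of_notMem (fun h => hi ((hfind i).mp h)) _
    · intro h
      exact absurd (Finset.mem_range.mpr (Nat.lt_succ_of_le ((Nat.find_min' hex' hm).trans hmj))) h
  have hbound : ∀ j : ℕ, (2 : ℝ≥0∞) ^ (-((j : ℝ) * κ)) *
      ∫⁻ x, ‖kconv n (wk n c ((2 : ℝ) ^ j)⁻¹ t) (f j) x‖ₑ ^ p ≤
      ∑' i : ℕ, geomSum δ ^ p * (C * 2 ^ p) * ((2 : ℝ≥0∞) ^ (-((i : ℝ) * (κ / 2))) *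
        (if i ≤ j then D (j - i) else 0)) := by
    intro j
    have ha : (0 : ℝ) < ((2 : ℝ) ^ j)⁻¹ := by positivity
    set K := wk n c ((2 : ℝ) ^ j)⁻¹ t with hK
    have hKc : Continuous K := hc.continuous_wk ha t
    set A : ℕ → Rn n → ℝ≥0∞ := fun i x =>
      if i ≤ j then ‖kconv n K ((E j (j - i)).indicator (f j)) x‖ₑ else 0 with hA
    have hA1 : ∀ x, ‖kconv n K (f j) x‖ₑ ≤ ∑' i, A i x := by
      intro x
      have e1 : kconv n K (f j) x =
          ∑ m ∈ Finset.range (j + 1), kconv n K ((E j m).indicator (f j)) x := by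
        unfold kconv
        rw [← integral_finsetSum _ fun m _ =>
          integrable_kconv (hc.memLp_wk ha t 2) ((hf2 j).indicator (hEm j m)) x]
        refine integral_congr_ae (Filter.Eventually.of_forall fun y => ?_)
        simp only
        rw [← Finset.mul_sum, ← hsplit]
      rw [e1]
      refine (enorm_sum_le _ _).trans ?_
      rw [← Finset.sum_range_reflect]
      refine le_trans (le_of_eq ?_) (ENNReal.sum_le_tsum (Finset.range (j + 1)))
      refine Finset.sum_congr rfl fun i hi => ?_
      rw [hA]
      simp only
      rw [if_pos (Nat.lt_succ_iff.mp (Finset.mem_range.mp hi)), Nat.add_sub_cancel]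
    have hAm : ∀ i, Measurable (A i) := by
      intro i
      by_cases hi : i ≤ j
      · simp only [hA, if_pos hi]
        exact (measurable_kconv hKc ((hfm j).indicator (hEm j _))).enorm
      · simp only [hA, if_neg hi]
        exact measurable_const
    have hAint : ∀ i : ℕ, (2 : ℝ≥0∞) ^ (-((j : ℝ) * κ)) * (2 ^ ((i : ℝ) * δ * p) * ∫⁻ x, A i x ^ p) ≤
        (C * 2 ^ p) * ((2 : ℝ≥0∞) ^ (-((i : ℝ) * (κ / 2))) * (if i ≤ j then D (j - i) else 0)) := by
      intro i
      by_cases hi : i ≤ j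
      · simp only [hA, if_pos hi]
        have h1 := hCb j (j - i) t ((E j (j - i)).indicator (f j)) (fun x => 2 * d (j - i) x)
          (Nat.sub_le _ _) ht ((hfm j).indicator (hEm j _)) ((hf2 j).indicator (hEm j _))
          (fun x y hxy => by simp only [hd _ x y hxy]) (fun x => by
            by_cases hx : x ∈ E j (j - i)
            · rw [Set.indicator_of_mem hx]; exact hx.1
            · rw [Set.indicator_of_notMem hx, enorm_zero]; exact zero_le)
        have h2 : ∫⁻ x, (2 * d (j - i) x) ^ p = 2 ^ p * D (j - i) := by
          rw [hD, ← lintegral_const_mul' _ _ (two_rpow_ne_top _)]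
          simp only [ENNReal.mul_rpow_of_nonneg _ _ hp0.le]
        rw [h2] at h1
        calc _ ≤ (2 : ℝ≥0∞) ^ (-((j : ℝ) * κ)) * (2 ^ ((i : ℝ) * δ * p) *
              (C * 2 ^ (((j - i : ℕ) : ℝ) * κ) * (2 ^ p * D (j - i)))) := by gcongr
          _ = (C * 2 ^ p) * (((2 : ℝ≥0∞) ^ (-((j : ℝ) * κ)) * 2 ^ ((i : ℝ) * δ * p) *
              2 ^ (((j - i : ℕ) : ℝ) * κ)) * D (j - i)) := by ring
          _ = _ := by
              rw [← two_rpow_add, ← two_rpow_add]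
              congr 4
              rw [Nat.cast_sub hi, mul_assoc (i : ℝ), hδp]
              ring
      · simp only [hA, if_neg hi, ENNReal.zero_rpow_of_pos hp0, lintegral_zero, mul_zero, le_refl]
    calc (2 : ℝ≥0∞) ^ (-((j : ℝ) * κ)) * ∫⁻ x, ‖kconv n K (f j) x‖ₑ ^ p
        ≤ (2 : ℝ≥0∞) ^ (-((j : ℝ) * κ)) * ∫⁻ x, geomSum δ ^ p *
            ∑' i : ℕ, (2 : ℝ≥0∞) ^ ((i : ℝ) * δ * p) * A i x ^ p := by
          gcongr with x
          exact (ENNReal.rpow_le_rpow (hA1 x) hp0.le).trans (tsum_rpow_le_geom hp0 _)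
      _ = geomSum δ ^ p * ∑' i : ℕ, (2 : ℝ≥0∞) ^ (-((j : ℝ) * κ)) *
            (2 ^ ((i : ℝ) * δ * p) * ∫⁻ x, A i x ^ p) := by
          rw [lintegral_const_mul' _ _ (ENNReal.rpow_ne_top_of_nonneg hp0.le
            (geomSum_ne_top (by positivity))), lintegral_tsum fun i =>
              (((hAm i).pow_const p).const_mul _).aemeasurable, ENNReal.tsum_mul_left]
          simp only [lintegral_const_mul' _ _ (two_rpow_ne_top _)]
          ring
      _ ≤ geomSum δ ^ p * ∑' i : ℕ, (C * 2 ^ p) * ((2 : ℝ≥0∞) ^ (-((i : ℝ) * (κ / 2))) *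
            (if i ≤ j then D (j - i) else 0)) := by
          exact mul_le_mul' le_rfl (ENNReal.tsum_le_tsum hAint)
      _ = _ := by rw [← ENNReal.tsum_mul_left]; simp only [mul_assoc]
  calc _ ≤ ∑' j : ℕ, ∑' i : ℕ, geomSum δ ^ p * (C * 2 ^ p) * ((2 : ℝ≥0∞) ^ (-((i : ℝ) * (κ / 2))) *
        (if i ≤ j then D (j - i) else 0)) := ENNReal.tsum_le_tsum hbound
    _ = geomSum δ ^ p * (C * 2 ^ p) * (geomSum (κ / 2) * ∑' m, D m) := by
        rw [ENNReal.tsum_comm]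
        simp only [ENNReal.tsum_mul_left, tsum_ite_sub]
        rw [ENNReal.tsum_mul_right]
        rfl
    _ ≤ geomSum δ ^ p * (C * 2 ^ p) * (geomSum (κ / 2) * (geomSum p * ∫⁻ x, G x ^ p)) := by gcongr
    _ = _ := by ring

/-- The `L¹`-normalised dyadic kernel `2^{jn} (1 + 2^j |z|)^{-N}`. -/
def dec (n j N : ℕ) (z : Rn n) : ℝ≥0∞ :=
  ENNReal.ofReal (((2 : ℝ) ^ j) ^ n / (1 + 2 ^ j * ‖z‖) ^ N)

lemma dec_eq_kap (n j : ℕ) : dec n j (n + 1) = kap n j := rfl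

lemma one_add_mul_norm_sub_le {n j : ℕ} (y z w : Rn n) :
    1 + (2 : ℝ) ^ j * ‖y - w‖ ≤ (1 + 2 ^ j * ‖y - z‖) * (1 + 2 ^ j * ‖z - w‖) := by
  have h1 := norm_sub_le_norm_sub_add_norm_sub y z w
  have h2 : (0 : ℝ) < 2 ^ j := by positivity
  have h3 := mul_le_mul_of_nonneg_left h1 h2.le
  have h4 : 0 ≤ ((2 : ℝ) ^ j * ‖y - z‖) * (2 ^ j * ‖z - w‖) := by positivity
  nlinarith

/-- The Peetre maximal inequality for functions which are controlled by their own averages. -/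
lemma enorm_le_rpow_kap_of_le_dec {n j N : ℕ} {r : ℝ} (hr0 : 0 < r) (hr1 : r ≤ 1)
    (hN : (n : ℝ) + 1 ≤ N * r) {A : ℝ≥0∞} {f : Rn n → ℂ} {b : ℝ}
    (hb : ∀ x, ‖f x‖ ≤ b)
    (hrep : ∀ x, ‖f x‖ₑ ≤ A * ∫⁻ y, dec n j N (x - y) * ‖f y‖ₑ) (x y : Rn n) :
    ‖f x‖ₑ ≤ ENNReal.ofReal ((1 + 2 ^ j * ‖y - x‖) ^ N) *
      (A * ∫⁻ w, kap n j (y - w) * ‖f w‖ₑ ^ r) ^ (1 / r) := by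
  set θ : Rn n → ℝ := fun z => 1 + 2 ^ j * ‖y - z‖ with hθ
  have hθ1 : ∀ z, 1 ≤ θ z := fun z => by
    have : (0 : ℝ) ≤ 2 ^ j * ‖y - z‖ := by positivity
    simp only [hθ]; linarith
  have hθ0 : ∀ z, 0 < θ z := fun z => zero_lt_one.trans_le (hθ1 z)
  set ω : Rn n → ℝ≥0∞ := fun z => ENNReal.ofReal ((θ z ^ N)⁻¹) with hω
  set P : ℝ≥0∞ := ⨆ z, ω z * ‖f z‖ₑ with hP
  set I : ℝ≥0∞ := A * ∫⁻ w, kap n j (y - w) * ‖f w‖ₑ ^ r with hI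
  have hω1 : ∀ z, ω z ≤ 1 := fun z => by
    rw [hω, ← ENNReal.ofReal_one]
    exact ENNReal.ofReal_le_ofReal (inv_le_one_of_one_le₀ (one_le_pow₀ (hθ1 z)))
  have hPtop : P ≠ ∞ := by
    refine ne_top_of_le_ne_top (ENNReal.ofReal_ne_top (r := b)) (iSup_le fun z => ?_)
    calc ω z * ‖f z‖ₑ ≤ 1 * ENNReal.ofReal b := by
          gcongr
          · exact hω1 z
          · rw [← ofReal_norm]; exact ENNReal.ofReal_le_ofReal (hb z)
      _ = _ := one_mul _
  have hPle : P ≤ P ^ (1 - r) * I := by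
    refine iSup_le fun z => ?_
    calc ω z * ‖f z‖ₑ ≤ ω z * (A * ∫⁻ w, dec n j N (z - w) * ‖f w‖ₑ) := by gcongr; exact hrep z
      _ = A * ∫⁻ w, ω z * (dec n j N (z - w) * ‖f w‖ₑ) := by
          rw [lintegral_const_mul' _ _ (by simp [hω])]; ring
      _ ≤ A * ∫⁻ w, P ^ (1 - r) * (kap n j (y - w) * ‖f w‖ₑ ^ r) := by
          refine mul_le_mul' le_rfl (lintegral_mono fun w => ?_)
          have h1 : ω z * dec n j N (z - w) ≤ ENNReal.ofReal (((2 : ℝ) ^ j) ^ n) * ω w := by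
            simp only [hω, dec]
            rw [← ENNReal.ofReal_mul (by have := hθ0 z; positivity), ← ENNReal.ofReal_mul (by positivity)]
            apply ENNReal.ofReal_le_ofReal
            rw [div_eq_mul_inv, mul_left_comm, ← mul_inv, ← mul_pow]
            have := hθ0 w
            gcongr
            exact one_add_mul_norm_sub_le y z w
          have h2 : ω w ^ r ≤ ENNReal.ofReal ((θ w ^ (n + 1))⁻¹) := by
            have := hθ0 w
            rw [hω, ENNReal.ofReal_rpow_of_nonneg (by positivity) hr0.le]
            apply ENNReal.ofReal_le_ofReal
            rw [Real.inv_rpow (by positivity)]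
            gcongr
            rw [← Real.rpow_natCast, ← Real.rpow_natCast, ← Real.rpow_mul this.le]
            apply Real.rpow_le_rpow_of_exponent_le (hθ1 w)
            push_cast
            exact hN
          calc ω z * (dec n j N (z - w) * ‖f w‖ₑ) = ω z * dec n j N (z - w) * ‖f w‖ₑ := by ring
            _ ≤ ENNReal.ofReal (((2 : ℝ) ^ j) ^ n) * ω w * ‖f w‖ₑ := by gcongr
            _ = ENNReal.ofReal (((2 : ℝ) ^ j) ^ n) * ((ω w * ‖f w‖ₑ) ^ (1 - r) * (ω w * ‖f w‖ₑ) ^ r) := by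
                rw [← ENNReal.rpow_add_of_nonneg _ _ (by linarith) hr0.le, sub_add_cancel,
                  ENNReal.rpow_one, mul_assoc]
            _ ≤ ENNReal.ofReal (((2 : ℝ) ^ j) ^ n) * (P ^ (1 - r) *
                (ENNReal.ofReal ((θ w ^ (n + 1))⁻¹) * ‖f w‖ₑ ^ r)) := by
                rw [ENNReal.mul_rpow_of_nonneg _ _ hr0.le]
                exact mul_le_mul' le_rfl (mul_le_mul' (ENNReal.rpow_le_rpow
                  (le_iSup (fun z => ω z * ‖f z‖ₑ) w) (by linarith)) (mul_le_mul' h2 le_rfl))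
            _ = P ^ (1 - r) * ((ENNReal.ofReal (((2 : ℝ) ^ j) ^ n) *
                ENNReal.ofReal ((θ w ^ (n + 1))⁻¹)) * ‖f w‖ₑ ^ r) := by ring
            _ = _ := by
                rw [← ENNReal.ofReal_mul (by positivity), ← div_eq_mul_inv]
                rfl
      _ = _ := by
          rw [lintegral_const_mul' _ _ (ENNReal.rpow_ne_top_of_nonneg (by linarith) hPtop), hI]
          ring
  have hPr : P ≤ I ^ (1 / r) := by
    rcases eq_or_ne P 0 with h0 | h0
    · rw [h0]; exact zero_le
    rw [one_div, ENNReal.le_rpow_inv_iff hr0]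
    have h1 : P ^ (1 - r) * P ^ r ≤ P ^ (1 - r) * I := by
      rw [← ENNReal.rpow_add_of_nonneg _ _ (by linarith) hr0.le, sub_add_cancel, ENNReal.rpow_one]
      exact hPle
    have h2 : P ^ (1 - r) ≠ 0 := by simp [ENNReal.rpow_eq_zero_iff, h0, hPtop]
    have h3 : P ^ (1 - r) ≠ ∞ := ENNReal.rpow_ne_top_of_nonneg (by linarith) hPtop
    exact (ENNReal.mul_le_mul_iff_right h2 h3).mp h1
  have hθx : 0 < θ x ^ N := pow_pos (hθ0 x) N
  calc ‖f x‖ₑ = ENNReal.ofReal (θ x ^ N) * (ω x * ‖f x‖ₑ) := by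
        rw [← mul_assoc, hω, ← ENNReal.ofReal_mul hθx.le, mul_inv_cancel₀ hθx.ne',
          ENNReal.ofReal_one, one_mul]
    _ ≤ ENNReal.ofReal (θ x ^ N) * I ^ (1 / r) := by
        gcongr
        exact (le_iSup (fun z => ω z * ‖f z‖ₑ) x).trans hPr

section

open scoped ContDiff

lemma exists_bound_iteratedFDeriv_slice {n : ℕ} {F : ℝ × Rn n → ℂ} (hF : ContDiff ℝ ∞ F)
    {R : ℝ} (hsupp : ∀ t η, R < ‖η‖ → F (t, η) = 0) (τ : ℝ) (l : ℕ) :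
    ∃ M : ℝ, 0 ≤ M ∧ ∀ t, |t| ≤ τ → ∀ η, ‖iteratedFDeriv ℝ l (fun η => F (t, η)) η‖ ≤
      (Metric.closedBall (0 : Rn n) R).indicator (fun _ => M) η := by
  have hcont : Continuous (iteratedFDeriv ℝ l F) := hF.continuous_iteratedFDeriv (by exact_mod_cast le_top)
  have hK : IsCompact (Set.Icc (-τ) τ ×ˢ Metric.closedBall (0 : Rn n) R) :=
    isCompact_Icc.prod (isCompact_closedBall _ _)
  obtain ⟨M, hM⟩ := hK.exists_bound_of_continuousOn hcont.continuousOn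
  set L := ContinuousLinearMap.inr ℝ ℝ (Rn n) with hL
  refine ⟨max M 0 * ‖L‖ ^ l, by positivity, fun t ht η => ?_⟩
  by_cases hη : η ∈ Metric.closedBall (0 : Rn n) R
  · rw [Set.indicator_of_mem hη]
    have e : (fun η => F (t, η)) = (fun z => F ((t, 0) + z)) ∘ L := by
      ext η; simp [hL]
    have hG : ContDiff ℝ ∞ fun z => F ((t, (0 : Rn n)) + z) := hF.comp (contDiff_const.add contDiff_id)
    rw [e, ContinuousLinearMap.iteratedFDeriv_comp_right L hG η (by exact_mod_cast le_top),
      iteratedFDeriv_comp_add_left]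
    refine (ContinuousMultilinearMap.norm_compContinuousLinearMap_le _ _).trans ?_
    rw [Finset.prod_const, Finset.card_univ, Fintype.card_fin]
    gcongr
    refine le_trans ?_ (le_max_left _ _)
    have := hM (t, η) ⟨abs_le.mp ht, hη⟩
    simpa [hL] using this
  · rw [Set.indicator_of_notMem hη]
    have h1 : tsupport (fun η => F (t, η)) ⊆ Metric.closedBall (0 : Rn n) R := by
      refine closure_minimal (fun η hη => ?_) Metric.isClosed_closedBall
      by_contra hcon
      rw [mem_closedBall_zero_iff, not_le] at hcon
      exact hη (hsupp t η hcon)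
    have h2 : iteratedFDeriv ℝ l (fun η => F (t, η)) η = 0 := by
      by_contra hcon
      exact hη (h1 (support_iteratedFDeriv_subset l hcon))
    rw [h2, norm_zero]

/-- Inverse Fourier transforms of smooth families of compactly supported functions decay rapidly,
uniformly for parameters in a compact set. -/
lemma exists_uniform_decay_fourierInv {n : ℕ} {F : ℝ × Rn n → ℂ} (hF : ContDiff ℝ ∞ F)
    {R : ℝ} (hsupp : ∀ t η, R < ‖η‖ → F (t, η) = 0) (τ : ℝ) (N : ℕ) :
    ∃ A : ℝ≥0, ∀ t, |t| ≤ τ → ∀ x, ‖𝓕⁻ (fun η => F (t, η)) x‖ₑ ≤ A * dec n 0 N x := by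
  choose M hM0 hM using exists_bound_iteratedFDeriv_slice hF hsupp τ
  have hgt : ∀ t, ContDiff ℝ ∞ fun η => F (t, η) := fun t =>
    hF.comp (contDiff_const.prodMk contDiff_id)
  set V : ℝ := (volume (Metric.closedBall (0 : Rn n) R)).toReal with hV
  have h_integrable : ∀ t, |t| ≤ τ → ∀ l : ℕ, Integrable (fun η => ‖iteratedFDeriv ℝ l (fun η => F (t, η)) η‖) ∧
      ∫ η, ‖iteratedFDeriv ℝ l (fun η => F (t, η)) η‖ ≤ M l * V := by
    intro t ht l
    have h1 : Integrable ((Metric.closedBall (0 : Rn n) R).indicator fun _ => M l) :=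
      (integrable_indicator_iff measurableSet_closedBall).mpr
        (integrableOn_const measure_closedBall_lt_top.ne)
    have h2 : Integrable (fun η => ‖iteratedFDeriv ℝ l (fun η => F (t, η)) η‖) := by
      refine h1.mono' ?_ (Filter.Eventually.of_forall fun η => ?_)
      · exact ((hgt t).continuous_iteratedFDeriv (by exact_mod_cast le_top)).norm.aestronglyMeasurable
      · rw [norm_norm]; exact hM l t ht η
    refine ⟨h2, (integral_mono h2 h1 (hM l t ht)).trans (le_of_eq ?_)⟩
    rw [integral_indicator measurableSet_closedBall, setIntegral_const, smul_eq_mul, mul_comm]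
    rfl
  have hbd : ∀ N : ℕ, ∃ C : ℝ, 0 ≤ C ∧ ∀ t, |t| ≤ τ → ∀ x,
      ‖x‖ ^ N * ‖𝓕⁻ (fun η => F (t, η)) x‖ ≤ C := by
    intro N
    refine ⟨2 ^ N * ∑ l ∈ Finset.range (N + 1), M l * V, ?_, fun t ht x => ?_⟩
    · refine mul_nonneg (by positivity) (Finset.sum_nonneg fun l _ => mul_nonneg (hM0 l) ENNReal.toReal_nonneg)
    have h1 := Real.pow_mul_norm_iteratedFDeriv_fourier_le (K := 0) (N := N)
      (f := fun η => F (t, η)) ((hgt t).of_le (by exact_mod_cast le_top)) (by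
        intro k l hk _
        obtain rfl : k = 0 := by simpa using hk
        simpa using (h_integrable t ht l).1) (k := 0) (n := N) le_rfl le_rfl (-x)
    rw [norm_iteratedFDeriv_zero, norm_neg] at h1
    rw [Real.fourierInv_eq_fourier_neg]
    refine h1.trans ?_
    simp only [pow_zero, one_mul, Nat.cast_zero, mul_zero, zero_add, Finset.range_one,
      Finset.singleton_product, Finset.sum_map, Function.Embedding.coeFn_mk]
    gcongr with l hl
    exact (h_integrable t ht l).2
  obtain ⟨C0, hC0, hb0⟩ := hbd 0
  obtain ⟨C1, hC1, hb1⟩ := hbd N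
  refine ⟨(2 ^ (N - 1) * (C0 + C1)).toNNReal, fun t ht x => ?_⟩
  have hx : 0 < (1 + ‖x‖) ^ N := by positivity
  have h1 : ‖𝓕⁻ (fun η => F (t, η)) x‖ ≤ 2 ^ (N - 1) * (C0 + C1) * (1 / (1 + ‖x‖) ^ N) := by
    rw [mul_one_div, le_div_iff₀ hx]
    have h2 := hb0 t ht x
    have h3 := hb1 t ht x
    rw [pow_zero, one_mul] at h2
    calc ‖𝓕⁻ (fun η => F (t, η)) x‖ * (1 + ‖x‖) ^ N
        ≤ ‖𝓕⁻ (fun η => F (t, η)) x‖ * (2 ^ (N - 1) * (1 ^ N + ‖x‖ ^ N)) := by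
          gcongr
          exact add_pow_le zero_le_one (norm_nonneg x) N
      _ = 2 ^ (N - 1) * (‖𝓕⁻ (fun η => F (t, η)) x‖ + ‖x‖ ^ N * ‖𝓕⁻ (fun η => F (t, η)) x‖) := by
          rw [one_pow]; ring
      _ ≤ _ := by gcongr
  rw [← ofReal_norm]
  refine (ENNReal.ofReal_le_ofReal h1).trans ?_
  rw [ENNReal.ofReal_mul (by positivity)]
  simp only [dec, pow_zero, one_pow, one_mul]
  rfl

lemma SmoothCpt.exists_ball {n : ℕ} {Φ : Rn n → ℂ} (h : SmoothCpt n Φ) :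
    ∃ R, ∀ η, R < ‖η‖ → Φ η = 0 := by
  obtain ⟨R, hR⟩ := h.2.isCompact.isBounded.subset_closedBall (0 : Rn n)
  refine ⟨R, fun η hη => ?_⟩
  by_contra hcon
  have := hR (subset_tsupport Φ hcon)
  rw [mem_closedBall_zero_iff] at this
  linarith

lemma fourierInv_comp_smul {n : ℕ} (Φ : Rn n → ℂ) {a : ℝ} (ha : 0 < a) (x : Rn n) :
    𝓕⁻ (fun η => Φ (a • η)) x = ((a ^ n)⁻¹ : ℝ) • 𝓕⁻ Φ (a⁻¹ • x) := by
  rw [Real.fourierInv_eq', Real.fourierInv_eq']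
  have h := Measure.integral_comp_smul (volume : Measure (Rn n))
    (fun η => Complex.exp (↑(2 * Real.pi * ⟪η, a⁻¹ • x⟫_ℝ) * I) • Φ η) a
  rw [finrank_euclideanSpace_fin, abs_of_nonneg (by positivity)] at h
  rw [← h]
  congr 1
  ext η
  rw [real_inner_smul_left, real_inner_smul_right, mul_inv_cancel_left₀ ha.ne']

lemma SmoothCpt.exists_dec_bound {n : ℕ} {Φ : Rn n → ℂ} (h : SmoothCpt n Φ) (N : ℕ) :
    ∃ A : ℝ≥0, ∀ (j : ℕ) x, ‖𝓕⁻ (fun η => Φ (((2 : ℝ) ^ j)⁻¹ • η)) x‖ₑ ≤ A * dec n j N x := by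
  obtain ⟨R, hR⟩ := h.exists_ball
  obtain ⟨A, hA⟩ := exists_uniform_decay_fourierInv (F := fun z => Φ z.2) (h.1.comp contDiff_snd)
    (R := R) (fun t η hη => hR η hη) 0 N
  refine ⟨A, fun j x => ?_⟩
  have h2 : (0 : ℝ) < 2 ^ j := by positivity
  rw [fourierInv_comp_smul Φ (by positivity), inv_inv, enorm_smul]
  have h1 := hA 0 (by simp) ((2 : ℝ) ^ j • x)
  calc _ ≤ ‖((((2 : ℝ) ^ j)⁻¹ ^ n)⁻¹ : ℝ)‖ₑ * (A * dec n 0 N ((2 : ℝ) ^ j • x)) := by gcongr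
    _ = A * (‖((((2 : ℝ) ^ j)⁻¹ ^ n)⁻¹ : ℝ)‖ₑ * dec n 0 N ((2 : ℝ) ^ j • x)) := by ring
    _ = _ := by
      congr 1
      rw [inv_pow, inv_inv, Real.enorm_of_nonneg (by positivity), dec, dec,
        ← ENNReal.ofReal_mul (by positivity), norm_smul, Real.norm_of_nonneg h2.le]
      congr 1
      simp only [pow_zero, one_pow, one_mul]
      ring

end

lemma SchwartzMap.exists_norm_le {n : ℕ} (f : 𝓢(Rn n, ℂ)) : ∃ b : ℝ, ∀ x, ‖f x‖ ≤ b := by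
  obtain ⟨b, -, hb⟩ := f.decay 0 0
  exact ⟨b, fun x => by simpa using hb x⟩

/-- The reproducing inequality satisfied by functions with spectrum in a ball of radius `2^j`. -/
def RepBound (n N : ℕ) (A : ℝ≥0∞) (F : ℕ → 𝓢(Rn n, ℂ)) : Prop :=
  ∀ j x, ‖F j x‖ₑ ≤ A * ∫⁻ y, dec n j N (x - y) * ‖F j y‖ₑ

lemma RepBound.enorm_le_maxFun {n N : ℕ} {A : ℝ≥0∞} {F : ℕ → 𝓢(Rn n, ℂ)} (hF : RepBound n N A F)
    {r : ℝ} (hr0 : 0 < r) (hr1 : r ≤ 1) (hN : (n : ℝ) + 1 ≤ N * r) {R : ℝ} {j : ℕ}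
    {x y : Rn n} (h : 2 ^ j * ‖y - x‖ ≤ R) :
    ‖F j x‖ₑ ≤ ENNReal.ofReal ((1 + R) ^ N) *
      (A * maxFun n (fun w => ⨆ j, ‖F j w‖ₑ ^ r) y) ^ (1 / r) := by
  obtain ⟨b, hb⟩ := (F j).exists_norm_le
  refine (enorm_le_rpow_kap_of_le_dec hr0 hr1 hN hb (hF j) x y).trans ?_
  gcongr
  refine le_trans (lintegral_mono fun w => ?_)
    (le_iSup (fun j => ∫⁻ w, kap n j (y - w) * ⨆ j, ‖F j w‖ₑ ^ r) j)
  exact mul_le_mul' le_rfl (le_iSup (fun j => ‖F j w‖ₑ ^ r) j)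

lemma measurable_iSup_enorm_rpow {n : ℕ} (F : ℕ → 𝓢(Rn n, ℂ)) (r : ℝ) :
    Measurable fun w => ⨆ j, ‖F j w‖ₑ ^ r :=
  Measurable.iSup fun j => ((F j).continuous.measurable.enorm).pow_const r

lemma lintegral_maxFun_iSup_le {n : ℕ} (hn : n ≠ 0) {p r : ℝ} (hr0 : 0 < r) (hrp : r < p) :
    ∃ C : ℝ≥0∞, C ≠ ∞ ∧ ∀ F : ℕ → 𝓢(Rn n, ℂ),
      ∫⁻ x, maxFun n (fun w => ⨆ j, ‖F j w‖ₑ ^ r) x ^ (p / r) ≤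
        C * ∫⁻ x, (⨆ j, ‖F j x‖ₑ) ^ p := by
  obtain ⟨C, hC, hCb⟩ := maxFun_strong_type n hn (a := p / r) (by rwa [one_lt_div hr0])
  refine ⟨C, hC, fun F => (hCb _ (measurable_iSup_enorm_rpow F r)).trans ?_⟩
  refine mul_le_mul' le_rfl (lintegral_mono fun x => ?_)
  calc (⨆ j, ‖F j x‖ₑ ^ r) ^ (p / r) ≤ ((⨆ j, ‖F j x‖ₑ) ^ r) ^ (p / r) := by
        refine ENNReal.rpow_le_rpow (iSup_le fun j => ?_) (by positivity [hr0.trans hrp])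
        exact ENNReal.rpow_le_rpow (le_iSup (fun j => ‖F j x‖ₑ) j) hr0.le
    _ = _ := by rw [← ENNReal.rpow_mul, mul_div_cancel₀ _ hr0.ne']

/-- The half-wave estimate below `L²`. -/
lemma tsum_lintegral_wk_le_of_lt_two {n : ℕ} (hn : 2 ≤ n) {p τ : ℝ} (hp0 : 0 < p) (hp2 : p < 2)
    (hτ : 0 ≤ τ) {c : Rn n → ℂ} (hc : Ann n c) {N : ℕ} (hN : (n : ℝ) + 1 ≤ N * (p / 2))
    {A : ℝ≥0∞} (hA : A ≠ ∞) :
    ∃ C : ℝ≥0∞, C ≠ ∞ ∧ ∀ (t : ℝ) (F : ℕ → 𝓢(Rn n, ℂ)), |t| ≤ τ → RepBound n N A F →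
      ∑' j : ℕ, (2 : ℝ≥0∞) ^ (-((j : ℝ) * (((n : ℝ) - 1) / 2 * (2 - p)))) *
        ∫⁻ x, ‖kconv n (wk n c ((2 : ℝ) ^ j)⁻¹ t) (F j) x‖ₑ ^ p ≤
          C * ∫⁻ x, (⨆ j, ‖F j x‖ₑ) ^ p := by
  obtain ⟨C1, hC1, hb1⟩ := tsum_lintegral_kconv_rpow_le hn hp0 hp2 hτ hc
  have hr0 : 0 < p / 2 := by linarith
  obtain ⟨C2, hC2, hb2⟩ := lintegral_maxFun_iSup_le (n := n) (by omega) (p := p) hr0 (by linarith)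
  set D : ℝ≥0∞ := ENNReal.ofReal ((1 + Real.sqrt n) ^ N) ^ p * A ^ (p / (p / 2)) with hD
  have hDt : D ≠ ∞ := ENNReal.mul_ne_top (ENNReal.rpow_ne_top_of_nonneg hp0.le ENNReal.ofReal_ne_top)
    (ENNReal.rpow_ne_top_of_nonneg (by positivity) hA)
  refine ⟨C1 * (D * C2), by finiteness, fun t F ht hF => ?_⟩
  refine (hb1 t (fun j => F j) (fun y => ENNReal.ofReal ((1 + Real.sqrt n) ^ N) *
      (A * maxFun n (fun w => ⨆ j, ‖F j w‖ₑ ^ (p / 2)) y) ^ (1 / (p / 2))) ht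
      (fun j => (F j).continuous.measurable) (fun j => (F j).memLp 2 volume) ?_).trans ?_
  · intro j x y h
    exact hF.enorm_le_maxFun hr0 (by linarith) hN (dist_le_of_cell_eq h.symm)
  · rw [mul_assoc C1]
    refine mul_le_mul' le_rfl ?_
    calc _ = ∫⁻ y, D * maxFun n (fun w => ⨆ j, ‖F j w‖ₑ ^ (p / 2)) y ^ (p / (p / 2)) := by
          refine lintegral_congr fun y => ?_
          rw [ENNReal.mul_rpow_of_nonneg _ _ hp0.le, ← ENNReal.rpow_mul,
            ENNReal.mul_rpow_of_nonneg _ _ (by positivity), hD, mul_assoc,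
            one_div_mul_eq_div]
      _ = D * ∫⁻ y, maxFun n (fun w => ⨆ j, ‖F j w‖ₑ ^ (p / 2)) y ^ (p / (p / 2)) :=
          lintegral_const_mul' _ _ hDt
      _ ≤ D * (C2 * ∫⁻ x, (⨆ j, ‖F j x‖ₑ) ^ p) := mul_le_mul' le_rfl (hb2 F)
      _ = _ := by ring

/-- The half-wave estimate in `L²`. -/
lemma tsum_lintegral_wk_le_two {n : ℕ} {c : Rn n → ℂ} (hc : Ann n c) :
    ∃ C : ℝ≥0∞, C ≠ ∞ ∧ ∀ (t : ℝ) (F : ℕ → 𝓢(Rn n, ℂ)),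
      ∑' j : ℕ, ∫⁻ x, ‖kconv n (wk n c ((2 : ℝ) ^ j)⁻¹ t) (F j) x‖ₑ ^ (2 : ℝ) ≤
          C * ∫⁻ x, ∑' j, ‖F j x‖ₑ ^ (2 : ℝ) := by
  obtain ⟨B, hB⟩ := hc.bound
  refine ⟨(B : ℝ≥0∞) ^ (2 : ℝ), by finiteness, fun t F => ?_⟩
  rw [lintegral_tsum fun j => (((F j).continuous.measurable.enorm).pow_const _).aemeasurable,
    ← ENNReal.tsum_mul_left]
  refine ENNReal.tsum_le_tsum fun j => ?_
  rw [lintegral_enorm_sq_eq, lintegral_enorm_sq_eq, ← ENNReal.mul_rpow_of_nonneg _ _ (by norm_num)]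
  exact ENNReal.rpow_le_rpow (hc.eLpNorm_kconv_le hB (by positivity) t ((F j).memLp 2 volume))
    (by norm_num)

lemma integral_kconv_mul {n : ℕ} (K f : 𝓢(Rn n, ℂ)) {g : Rn n → ℂ} {b : ℝ} (hg : Measurable g)
    (hb : ∀ x, ‖g x‖ ≤ b) :
    ∫ x, kconv n K f x * g x = ∫ y, f y * kconv n (fun z => K (-z)) g y := by
  have h_integrable : Integrable (fun z : Rn n × Rn n => K (z.1 - z.2) * f z.2)
      ((volume : Measure (Rn n)).prod volume) := by
    have := (f.integrable (μ := volume)).convolution_integrand (ContinuousLinearMap.mul ℂ ℂ)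
      (K.integrable (μ := volume))
    refine this.congr (Filter.Eventually.of_forall fun z => ?_)
    simp [mul_comm]
  have hint2 : Integrable (fun z : Rn n × Rn n => K (z.1 - z.2) * f z.2 * g z.1)
      ((volume : Measure (Rn n)).prod volume) :=
    h_integrable.mul_bdd (hg.comp measurable_fst).aestronglyMeasurable
      (Filter.Eventually.of_forall fun z => hb z.1)
  calc ∫ x, kconv n K f x * g x = ∫ x, ∫ y, K (x - y) * f y * g x := by
        simp_rw [kconv, integral_mul_const]
    _ = ∫ y, ∫ x, K (x - y) * f y * g x := integral_integral_swap hint2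
    _ = _ := by
        refine integral_congr_ae (Filter.Eventually.of_forall fun y => ?_)
        simp only [kconv]
        rw [← integral_const_mul]
        refine integral_congr_ae (Filter.Eventually.of_forall fun x => ?_)
        simp only [neg_sub]; ring

lemma fourierInv_neg_apply {n : ℕ} (F : Rn n → ℂ) (x : Rn n) :
    𝓕⁻ F (-x) = 𝓕⁻ (fun η => F (-η)) x := by
  rw [Real.fourierInv_eq', Real.fourierInv_eq', ← integral_neg_eq_self]
  simp

lemma wk_neg {n : ℕ} (c : Rn n → ℂ) (a t : ℝ) (x : Rn n) :
    wk n c a t (-x) = wk n (fun η => c (-η)) a t x := by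
  rw [wk, wk, fourierInv_neg_apply]
  have : symb n (fun η => c (-η)) a t = fun η => symb n c a t (-η) := by
    ext η; simp [symb]
  rw [this]

lemma Ann.neg {n : ℕ} {c : Rn n → ℂ} (h : Ann n c) : Ann n fun η => c (-η) := by
  simpa using h.scale (a := -1) (by norm_num)

lemma dec_neg (n j N : ℕ) (z : Rn n) : dec n j N (-z) = dec n j N z := by simp [dec]

lemma SmoothCpt.scale {n : ℕ} {Φ : Rn n → ℂ} (h : SmoothCpt n Φ) {a : ℝ} (ha : a ≠ 0) :
    SmoothCpt n (fun η => Φ (a • η)) :=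
  ⟨h.1.comp (by fun_prop), h.2.comp_homeomorph (Homeomorph.smulOfNeZero a ha)⟩

lemma SmoothCpt.exists_eq_one {n : ℕ} {c : Rn n → ℂ} (h : SmoothCpt n c) :
    ∃ Φ : Rn n → ℂ, SmoothCpt n Φ ∧ ∀ η, c η ≠ 0 → Φ η = 1 := by
  obtain ⟨R, hR⟩ := h.2.isCompact.isBounded.subset_closedBall 0
  let B : ContDiffBump (0 : Rn n) := ⟨|R| + 1, |R| + 2, by positivity, by linarith⟩
  refine ⟨fun η => (B η : ℂ), ⟨Complex.ofRealCLM.contDiff.comp B.contDiff,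
    B.hasCompactSupport.comp_left (g := fun x : ℝ => (x : ℂ)) rfl⟩, fun η hη => ?_⟩
  have h1 : η ∈ Metric.closedBall (0 : Rn n) R := hR (subset_tsupport _ hη)
  have h2 : B η = 1 := B.one_of_mem_closedBall
    (Metric.closedBall_subset_closedBall (by show R ≤ |R| + 1; linarith [le_abs_self R]) h1)
  simp [h2]

/-- The unimodular factor turning `u` into `‖u‖`. -/
def csgn (u : ℂ) : ℂ := (starRingEnd ℂ) u / ‖u‖

lemma mul_csgn (u : ℂ) : u * csgn u = ‖u‖ := by
  rw [csgn, ← mul_div_assoc, Complex.mul_conj, Complex.normSq_eq_norm_sq]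
  by_cases h : u = 0
  · simp [h]
  · have : (‖u‖ : ℂ) ≠ 0 := by simpa using h
    field_simp
    push_cast; ring

lemma norm_csgn_le (u : ℂ) : ‖csgn u‖ ≤ 1 := by
  rw [csgn, norm_div]; simp [div_self_le_one]

lemma measurable_csgn : Measurable csgn := by
  unfold csgn
  exact Complex.continuous_conj.measurable.div (by fun_prop)

lemma lintegral_enorm_mul_eq {n : ℕ} (u : 𝓢(Rn n, ℂ)) {h : Rn n → ℝ} (hm : Measurable h)
    (h0 : ∀ x, 0 ≤ h x) {b : ℝ} (hb : ∀ x, h x ≤ b) :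
    ∫⁻ x, ‖u x‖ₑ * ENNReal.ofReal (h x) = ‖∫ x, u x * (csgn (u x) * h x)‖ₑ := by
  have h1 : ∀ x, u x * (csgn (u x) * h x) = ((‖u x‖ * h x : ℝ) : ℂ) := fun x => by
    rw [← mul_assoc, mul_csgn]; push_cast; rfl
  simp_rw [h1]
  have h_integrable : Integrable (fun x => ‖u x‖ * h x) volume :=
    (u.integrable (μ := volume)).norm.mul_bdd hm.aestronglyMeasurable
      (Filter.Eventually.of_forall fun x => by rw [Real.norm_of_nonneg (h0 x)]; exact hb x)
  have h2 : ∫ x, ((‖u x‖ * h x : ℝ) : ℂ) = ((∫ x, ‖u x‖ * h x : ℝ) : ℂ) := integral_ofReal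
  rw [h2, ← ofReal_norm, Complex.norm_real, Real.norm_of_nonneg
    (integral_nonneg fun x => mul_nonneg (norm_nonneg _) (h0 x)),
    ofReal_integral_eq_lintegral_ofReal h_integrable
      (Filter.Eventually.of_forall fun x => mul_nonneg (norm_nonneg _) (h0 x))]
  refine lintegral_congr fun x => ?_
  rw [ENNReal.ofReal_mul (norm_nonneg _), ofReal_norm]

lemma exists_kconv_fourierInv {n : ℕ} (S g : 𝓢(Rn n, ℂ)) :
    ∃ u : 𝓢(Rn n, ℂ), kconv n ⇑(𝓕⁻ S : 𝓢(Rn n, ℂ)) g = u ∧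
      ∀ ξ, (𝓕 u : 𝓢(Rn n, ℂ)) ξ = S ξ * (𝓕 g : 𝓢(Rn n, ℂ)) ξ := by
  refine ⟨𝓕⁻ (SchwartzMap.pairing (ContinuousLinearMap.mul ℂ ℂ) S (𝓕 g)),
    kconv_fourierInv _ _ _ fun ξ => rfl, fun ξ => ?_⟩
  simp

lemma Ann.exists_dual {n : ℕ} {c : Rn n → ℂ} (hc : Ann n c) :
    ∃ D : ℝ≥0∞, D ≠ ∞ ∧ ∀ (j : ℕ) (t : ℝ) (f : 𝓢(Rn n, ℂ)) (h : Rn n → ℝ) (b : ℝ),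
      Measurable h → (∀ x, 0 ≤ h x) → (∀ x, h x ≤ b) → MemLp h 2 volume →
      ∃ w : Rn n → ℂ, Measurable w ∧ MemLp w 2 volume ∧
        (∀ x y, cell n j x = cell n j y →
          ‖w x‖ₑ ≤ D * maxFun n (fun z => ENNReal.ofReal (h z)) y) ∧
        ∫⁻ x, ‖kconv n (wk n c ((2 : ℝ) ^ j)⁻¹ t) f x‖ₑ * ENNReal.ofReal (h x) ≤
          ∫⁻ x, ‖f x‖ₑ * ‖kconv n (wk n (fun η => c (-η)) ((2 : ℝ) ^ j)⁻¹ t) w x‖ₑ := by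
  obtain ⟨Φ, hΦ, hΦ1⟩ := hc.1.exists_eq_one
  obtain ⟨A, hA⟩ := hΦ.exists_dec_bound (n + 1)
  obtain ⟨B, hB⟩ := hΦ.2.exists_bound_of_continuous hΦ.1.continuous
  set E := ENNReal.ofReal ((1 + Real.sqrt n) ^ (n + 1)) with hE
  refine ⟨A * E, by finiteness, fun j t f h b hm h0 hb hL => ?_⟩
  have ha : (0 : ℝ) < ((2 : ℝ) ^ j)⁻¹ := by positivity
  set a := ((2 : ℝ) ^ j)⁻¹ with haj
  set K : 𝓢(Rn n, ℂ) := 𝓕⁻ (hc.symb ha.ne' t).1.toS with hK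
  set Q : 𝓢(Rn n, ℂ) := 𝓕⁻ (hΦ.scale ha.ne').toS with hQ
  have hKw : wk n c a t = K := hc.wk_eq ha t
  obtain ⟨u, hu, hu'⟩ := exists_kconv_fourierInv (hc.symb ha.ne' t).1.toS f
  rw [← hK, ← hKw] at hu
  have hQu : kconv n Q u = u := by
    rw [hQ, kconv_fourierInv _ u (𝓕 u : 𝓢(Rn n, ℂ))]
    · simp
    · intro ξ
      rw [hu']
      simp only [SmoothCpt.coe_toS]
      by_cases h0 : c (a • ξ) = 0
      · simp [h0, _root_.symb]
      · rw [hΦ1 _ h0, one_mul]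
  set g : Rn n → ℂ := fun x => csgn (u x) * h x with hg
  have hgm : Measurable g :=
    (measurable_csgn.comp u.continuous.measurable).mul (Complex.measurable_ofReal.comp hm)
  have hgh : ∀ x, ‖g x‖ ≤ h x := fun x => by
    rw [hg, norm_mul, Complex.norm_real, Real.norm_of_nonneg (h0 x)]
    exact mul_le_of_le_one_left (h0 x) (norm_csgn_le _)
  have hgL : MemLp g 2 volume := hL.mono hgm.aestronglyMeasurable
    (Filter.Eventually.of_forall fun x => (hgh x).trans (le_abs_self _))
  have hQd : ∀ z, ‖Q (-z)‖ₑ ≤ A * kap n j z := fun z => by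
    rw [← dec_eq_kap, ← dec_neg, hQ, SmoothCpt.fourierInv_toS]
    exact hA j (-z)
  set Q' : Rn n → ℂ := fun z => Q (-z) with hQ'
  have hQc : Continuous Q' := Q.continuous.comp continuous_neg
  set w := kconv n Q' g with hw
  have hwm : Measurable w := measurable_kconv hQc hgm
  have hQ2 : Q' = ⇑(𝓕⁻ (hΦ.scale (neg_ne_zero.mpr ha.ne')).toS : 𝓢(Rn n, ℂ)) := by
    ext z
    rw [SmoothCpt.fourierInv_toS, hQ', hQ, SmoothCpt.fourierInv_toS]
    simp only [fourierInv_neg_apply]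
    simp
  have hwL : MemLp w 2 volume := by
    refine ⟨hwm.aestronglyMeasurable, ?_⟩
    have h1 := _root_.eLpNorm_kconv_le (B := B.toNNReal)
      (hΦ.scale (neg_ne_zero.mpr ha.ne')).toS (fun ξ => (hB _).trans (Real.le_coe_toNNReal B)) hgL
    rw [← hQ2] at h1
    exact h1.trans_lt (ENNReal.mul_lt_top ENNReal.coe_lt_top hgL.2)
  have hwb : ∀ x, ‖w x‖ ≤ (eLpNorm Q' 2 volume * eLpNorm g 2 volume).toReal := fun x => by
    rw [← ENNReal.ofReal_le_iff_le_toReal, ofReal_norm]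
    · exact enorm_kconv_le hQc.measurable hgL.1 x
    · refine ENNReal.mul_ne_top ?_ hgL.2.ne
      rw [hQ2]; exact (SchwartzMap.memLp _ 2 volume).2.ne
  refine ⟨w, hwm, hwL, fun x y hxy => ?_, ?_⟩
  · calc ‖w x‖ₑ ≤ ∫⁻ z, ‖Q' (x - z) * g z‖ₑ := enorm_integral_le_lintegral_enorm _
      _ ≤ ∫⁻ z, A * E * (kap n j (y - z) * ENNReal.ofReal (h z)) := by
          refine lintegral_mono fun z => ?_
          rw [enorm_mul]
          calc _ ≤ (A * (E * kap n j (y - z))) * ENNReal.ofReal (h z) := by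
                refine mul_le_mul' ((hQd _).trans (mul_le_mul' le_rfl
                  (kap_le_of_dist n j (Real.sqrt_nonneg _) (dist_le_of_cell_eq hxy) z))) ?_
                rw [← ofReal_norm]
                exact ENNReal.ofReal_le_ofReal (hgh z)
            _ = _ := by ring
      _ = A * E * ∫⁻ z, kap n j (y - z) * ENNReal.ofReal (h z) :=
          lintegral_const_mul' _ _ (by finiteness)
      _ ≤ _ := mul_le_mul' le_rfl
          (le_iSup (fun j => ∫⁻ z, kap n j (y - z) * ENNReal.ofReal (h z)) j)
  · rw [hu, lintegral_enorm_mul_eq u hm h0 hb]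
    have h1 : ∫ x, u x * g x = ∫ x, f x * kconv n (wk n (fun η => c (-η)) a t) w x := by
      calc ∫ x, u x * g x = ∫ x, kconv n Q u x * g x := by rw [hQu]
        _ = ∫ x, u x * w x := integral_kconv_mul Q u hgm fun x => (hgh x).trans (hb x)
        _ = ∫ x, kconv n K f x * w x := by rw [← hu, hKw]
        _ = _ := by
          rw [integral_kconv_mul K f hwm hwb]
          simp_rw [← hKw, wk_neg]
    rw [h1]
    refine (enorm_integral_le_lintegral_enorm _).trans_eq ?_
    simp_rw [enorm_mul]

lemma two_rpow_eq_ofReal (x : ℝ) : (2 : ℝ≥0∞) ^ x = ENNReal.ofReal ((2 : ℝ) ^ x) := by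
  rw [← ENNReal.ofReal_rpow_of_pos (by norm_num)]; norm_num

/-- Absorbing a power of a finite quantity. -/
lemma le_rpow_mul_of_le_mul_rpow {X Y : ℝ≥0∞} {p : ℝ} (hp : 1 < p) (hX : X ≠ ∞) (C : ℝ≥0∞)
    (h : X ≤ C * Y ^ (1 / p) * X ^ ((p - 1) / p)) : X ≤ C ^ p * Y := by
  by_cases hX0 : X = 0
  · simp [hX0]
  have hp0 : 0 < p := by linarith
  have h1 : X = X ^ (1 / p) * X ^ ((p - 1) / p) := by
    rw [← ENNReal.rpow_add _ _ hX0 hX, ← add_div]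
    rw [show 1 + (p - 1) = p by ring, div_self hp0.ne', ENNReal.rpow_one]
  have h2 : X ^ (1 / p) ≤ C * Y ^ (1 / p) := by
    by_contra hlt
    rw [not_le] at hlt
    have h3 : X ^ ((p - 1) / p) ≠ 0 := by
      rw [Ne, ENNReal.rpow_eq_zero_iff]; simp [hX0, hX]
    have h4 : X ^ ((p - 1) / p) ≠ ∞ :=
      ENNReal.rpow_ne_top_of_nonneg (div_nonneg (by linarith) hp0.le) hX
    have h5 := (ENNReal.mul_lt_mul_iff_left h3 h4).mpr hlt
    rw [← h1] at h5
    exact absurd h (not_le.mpr h5)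
  calc X = (X ^ (1 / p)) ^ p := by rw [← ENNReal.rpow_mul, one_div_mul_cancel hp0.ne', ENNReal.rpow_one]
    _ ≤ (C * Y ^ (1 / p)) ^ p := ENNReal.rpow_le_rpow h2 hp0.le
    _ = _ := by rw [ENNReal.mul_rpow_of_nonneg _ _ hp0.le, ← ENNReal.rpow_mul,
      one_div_mul_cancel hp0.ne', ENNReal.rpow_one]

lemma sum_lintegral_mul_le {n : ℕ} {p q : ℝ} (hpq : p.HolderConjugate q) (s : Finset ℕ)
    {f g : ℕ → Rn n → ℝ≥0∞} (hf : ∀ j, Measurable (f j)) (hg : ∀ j, Measurable (g j)) :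
    ∑ j ∈ s, ∫⁻ x, f j x * g j x ≤
      (∑ j ∈ s, ∫⁻ x, f j x ^ p) ^ (1 / p) * (∑ j ∈ s, ∫⁻ x, g j x ^ q) ^ (1 / q) := by
  calc _ ≤ ∑ j ∈ s, (∫⁻ x, f j x ^ p) ^ (1 / p) * (∫⁻ x, g j x ^ q) ^ (1 / q) :=
        Finset.sum_le_sum fun j _ => ENNReal.lintegral_mul_le_Lp_mul_Lq volume hpq
          (hf j).aemeasurable (hg j).aemeasurable
    _ ≤ _ := ENNReal.inner_le_Lp_mul_Lq s _ _ hpq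
    _ = _ := by
      simp_rw [← ENNReal.rpow_mul]
      simp [hpq.pos.ne', hpq.symm.pos.ne']

lemma lintegral_rpow_sum_wk_le {n : ℕ} (hn : 2 ≤ n) {p τ : ℝ} (hp : 2 < p)
    (hτ : 0 ≤ τ) {c : Rn n → ℂ} (hc : Ann n c) :
    ∃ C : ℝ≥0∞, C ≠ ∞ ∧ ∀ (t : ℝ) (F : ℕ → 𝓢(Rn n, ℂ)) (J : ℕ), |t| ≤ τ →
      ∫⁻ x, (∑ j ∈ Finset.range J, (2 : ℝ≥0∞) ^ (-((j : ℝ) * (((n : ℝ) - 1) / 2 * (1 - 2 / p)))) *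
        ‖kconv n (wk n c ((2 : ℝ) ^ j)⁻¹ t) (F j) x‖ₑ) ^ p ≤
          C * ∫⁻ x, ∑' j, ‖F j x‖ₑ ^ p := by
  set q := p / (p - 1) with hq
  have hp1 : 0 < p - 1 := by linarith
  have hp0 : 0 < p := by linarith
  have hpq : p.HolderConjugate q := by
    rw [Real.holderConjugate_iff]
    refine ⟨by linarith, ?_⟩
    rw [hq]; field_simp; ring
  have hq0 : 0 < q := hpq.symm.pos
  have hq1 : 1 < q := hpq.symm.lt
  have hq2 : q < 2 := by rw [hq, div_lt_iff₀ hp1]; linarith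
  set ν := ((n : ℝ) - 1) / 2 * (1 - 2 / p) with hν
  have hνq : ν * q = ((n : ℝ) - 1) / 2 * (2 - q) := by
    rw [hν, hq]; field_simp; ring
  obtain ⟨C1, hC1, hb1⟩ := tsum_lintegral_kconv_rpow_le hn hq0 hq2 hτ hc.neg
  obtain ⟨C2, hC2, hb2⟩ := maxFun_strong_type n (by omega) hq1
  obtain ⟨D, hD, hdual⟩ := hc.exists_dual
  set M : ℝ≥0∞ := (C1 * (D ^ q * C2)) ^ (1 / q) with hM
  have hDq : D ^ q ≠ ∞ := ENNReal.rpow_ne_top_of_nonneg hq0.le hD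
  have hMt : M ≠ ∞ := ENNReal.rpow_ne_top_of_nonneg (by positivity) (by finiteness)
  refine ⟨M ^ p, ENNReal.rpow_ne_top_of_nonneg hp0.le hMt, fun t F J ht => ?_⟩
  have hcw : ∀ j : ℕ, (0 : ℝ) < ((2 : ℝ) ^ j)⁻¹ := fun j => by positivity
  choose u hu _ using fun j : ℕ => exists_kconv_fourierInv (hc.symb (hcw j).ne' t).1.toS (F j)
  simp_rw [← hc.wk_eq (hcw _)] at hu
  set κ : ℕ → ℝ := fun j => (2 : ℝ) ^ (-((j : ℝ) * ν)) with hκ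
  have hκ0 : ∀ j, 0 ≤ κ j := fun j => by positivity
  set S : Rn n → ℝ := fun x => ∑ j ∈ Finset.range J, κ j * ‖u j x‖ with hS
  have hS0 : ∀ x, 0 ≤ S x := fun x => Finset.sum_nonneg fun j _ => by positivity
  have hSc : Continuous S := continuous_finsetSum _ fun j _ => continuous_const.mul (u j).continuous.norm
  have hSL : ∀ r : ℝ≥0∞, MemLp S r volume := fun r =>
    memLp_finsetSum _ fun j _ => (((u j).memLp r volume).norm).const_mul (κ j)
  choose b hb using fun j => (u j).exists_norm_le
  set b' := ∑ j ∈ Finset.range J, κ j * b j with hb'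
  have hSb : ∀ x, S x ≤ b' := fun x =>
    Finset.sum_le_sum fun j _ => mul_le_mul_of_nonneg_left (hb j x) (hκ0 j)
  have hSe : ∀ x, ENNReal.ofReal (S x) = ∑ j ∈ Finset.range J, (2 : ℝ≥0∞) ^ (-((j : ℝ) * ν)) *
      ‖kconv n (wk n c ((2 : ℝ) ^ j)⁻¹ t) (F j) x‖ₑ := fun x => by
    rw [hS, ENNReal.ofReal_sum_of_nonneg fun j _ => by positivity]
    refine Finset.sum_congr rfl fun j _ => ?_
    rw [ENNReal.ofReal_mul (hκ0 j), hu, two_rpow_eq_ofReal, ofReal_norm]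
  simp_rw [← hSe]
  set h : Rn n → ℝ := fun x => S x ^ (p - 1) with hh
  have hhm : Measurable h := hSc.measurable.pow_const _
  have hh0 : ∀ x, 0 ≤ h x := fun x => Real.rpow_nonneg (hS0 x) _
  have hhb : ∀ x, h x ≤ b' ^ (p - 1) := fun x => Real.rpow_le_rpow (hS0 x) (hSb x) hp1.le
  have hhL : MemLp h 2 volume := by
    refine (hSL 2).of_le_mul (c := b' ^ (p - 2)) hhm.aestronglyMeasurable
      (Filter.Eventually.of_forall fun x => ?_)
    rw [Real.norm_of_nonneg (hh0 x), Real.norm_of_nonneg (hS0 x), hh]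
    have : S x ^ (p - 1) = S x ^ (p - 2) * S x := by
      by_cases h0 : S x = 0
      · simp [h0, Real.zero_rpow hp1.ne']
      · rw [← Real.rpow_add_one h0]; congr 1; ring
    simp only [this]
    exact mul_le_mul_of_nonneg_right
      (Real.rpow_le_rpow (hS0 x) (hSb x) (by linarith)) (hS0 x)
  have hXt : ∫⁻ x, ENNReal.ofReal (S x) ^ p ≠ ∞ := by
    have h1 := (hSL (ENNReal.ofReal p)).2
    rw [eLpNorm_lt_top_iff_lintegral_rpow_enorm_lt_top (by simpa using hp0) ENNReal.ofReal_ne_top,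
      ENNReal.toReal_ofReal hp0.le] at h1
    simp_rw [Real.enorm_of_nonneg (hS0 _)] at h1
    exact h1.ne
  choose w hwm hwL hwG hwd using fun j => hdual j t (F j) h _ hhm hh0 hhb hhL
  have hK := hb1 t w _ ht hwm hwL hwG
  have hhp : ∀ x, ENNReal.ofReal (h x) ^ q = ENNReal.ofReal (S x) ^ p := fun x => by
    rw [hh, ← ENNReal.ofReal_rpow_of_nonneg (hS0 x) hp1.le, ← ENNReal.rpow_mul]
    congr 1; rw [hq]; field_simp
  refine le_rpow_mul_of_le_mul_rpow (by linarith) hXt M ?_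
  calc ∫⁻ x, ENNReal.ofReal (S x) ^ p
      = ∫⁻ x, ∑ j ∈ Finset.range J, (2 : ℝ≥0∞) ^ (-((j : ℝ) * ν)) *
          (‖kconv n (wk n c ((2 : ℝ) ^ j)⁻¹ t) (F j) x‖ₑ * ENNReal.ofReal (h x)) := by
        refine lintegral_congr fun x => ?_
        simp_rw [← mul_assoc]
        rw [← Finset.sum_mul, ← hSe, hh, ← ENNReal.ofReal_rpow_of_nonneg (hS0 x) hp1.le]
        conv_lhs => rw [show p = 1 + (p - 1) by ring]
        rw [ENNReal.rpow_add_of_nonneg _ _ (by norm_num) hp1.le, ENNReal.rpow_one]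
    _ = ∑ j ∈ Finset.range J, (2 : ℝ≥0∞) ^ (-((j : ℝ) * ν)) *
          ∫⁻ x, ‖kconv n (wk n c ((2 : ℝ) ^ j)⁻¹ t) (F j) x‖ₑ * ENNReal.ofReal (h x) := by
        rw [lintegral_finsetSum]
        · simp_rw [lintegral_const_mul' _ _ (two_rpow_ne_top _)]
        · intro j _
          rw [hu]
          exact ((u j).continuous.measurable.enorm.mul hhm.ennreal_ofReal).const_mul _
    _ ≤ ∑ j ∈ Finset.range J, ∫⁻ x, ‖F j x‖ₑ * ((2 : ℝ≥0∞) ^ (-((j : ℝ) * ν)) *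
          ‖kconv n (wk n (fun η => c (-η)) ((2 : ℝ) ^ j)⁻¹ t) (w j) x‖ₑ) := by
        refine Finset.sum_le_sum fun j _ => ?_
        refine (mul_le_mul' le_rfl (hwd j)).trans_eq ?_
        rw [← lintegral_const_mul' _ _ (two_rpow_ne_top _)]
        refine lintegral_congr fun x => ?_
        ring
    _ ≤ (∑ j ∈ Finset.range J, ∫⁻ x, ‖F j x‖ₑ ^ p) ^ (1 / p) *
          (∑ j ∈ Finset.range J, ∫⁻ x, ((2 : ℝ≥0∞) ^ (-((j : ℝ) * ν)) *
          ‖kconv n (wk n (fun η => c (-η)) ((2 : ℝ) ^ j)⁻¹ t) (w j) x‖ₑ) ^ q) ^ (1 / q) :=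
        sum_lintegral_mul_le hpq _ (fun j => (F j).continuous.measurable.enorm) fun j =>
          (measurable_kconv (hc.neg.continuous_wk (hcw j) t) (hwm j)).enorm.const_mul _
    _ ≤ (∫⁻ x, ∑' j, ‖F j x‖ₑ ^ p) ^ (1 / p) *
          (C1 * (D ^ q * (C2 * ∫⁻ x, ENNReal.ofReal (S x) ^ p))) ^ (1 / q) := by
        refine mul_le_mul' (ENNReal.rpow_le_rpow ?_ (by positivity))
          (ENNReal.rpow_le_rpow ?_ (by positivity))
        · rw [lintegral_tsum fun j => ((F j).continuous.measurable.enorm.pow_const _).aemeasurable]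
          exact ENNReal.sum_le_tsum _
        · calc _ = ∑ j ∈ Finset.range J,
                (2 : ℝ≥0∞) ^ (-((j : ℝ) * (((n : ℝ) - 1) / 2 * (2 - q)))) *
                ∫⁻ x, ‖kconv n (wk n (fun η => c (-η)) ((2 : ℝ) ^ j)⁻¹ t) (w j) x‖ₑ ^ q := by
                refine Finset.sum_congr rfl fun j _ => ?_
                rw [← lintegral_const_mul' _ _ (two_rpow_ne_top _)]
                refine lintegral_congr fun x => ?_
                rw [ENNReal.mul_rpow_of_nonneg _ _ hq0.le, ← ENNReal.rpow_mul, ← hνq]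
                congr 2; ring
            _ ≤ _ := ENNReal.sum_le_tsum _
            _ ≤ _ := hK
            _ = C1 * (D ^ q * ∫⁻ x, maxFun n (fun z => ENNReal.ofReal (h z)) x ^ q) := by
                rw [← lintegral_const_mul' _ _ hDq]
                simp_rw [ENNReal.mul_rpow_of_nonneg _ _ hq0.le]
            _ ≤ _ := by
                refine mul_le_mul' le_rfl (mul_le_mul' le_rfl ((hb2 _ hhm.ennreal_ofReal).trans_eq ?_))
                simp_rw [hhp]
    _ = _ := by
        have h1 : (p - 1) / p = 1 / q := by rw [hq]; field_simp
        rw [h1, hM, mul_right_comm, ← ENNReal.mul_rpow_of_nonneg _ _ (by positivity), mul_comm]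
        congr 2; ring

/-- The half-wave estimate above `L²`. -/
lemma lintegral_rpow_tsum_wk_le {n : ℕ} (hn : 2 ≤ n) {p τ : ℝ} (hp : 2 < p)
    (hτ : 0 ≤ τ) {c : Rn n → ℂ} (hc : Ann n c) :
    ∃ C : ℝ≥0∞, C ≠ ∞ ∧ ∀ (t : ℝ) (F : ℕ → 𝓢(Rn n, ℂ)), |t| ≤ τ →
      ∫⁻ x, (∑' j : ℕ, (2 : ℝ≥0∞) ^ (-((j : ℝ) * (((n : ℝ) - 1) / 2 * (1 - 2 / p)))) *
        ‖kconv n (wk n c ((2 : ℝ) ^ j)⁻¹ t) (F j) x‖ₑ) ^ p ≤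
          C * ∫⁻ x, ∑' j, ‖F j x‖ₑ ^ p := by
  obtain ⟨C, hC, hCb⟩ := lintegral_rpow_sum_wk_le hn hp hτ hc
  refine ⟨C, hC, fun t F ht => ?_⟩
  have hp0 : 0 < p := by linarith
  have hlim : ∀ x, (∑' j : ℕ, (2 : ℝ≥0∞) ^ (-((j : ℝ) * (((n : ℝ) - 1) / 2 * (1 - 2 / p)))) *
        ‖kconv n (wk n c ((2 : ℝ) ^ j)⁻¹ t) (F j) x‖ₑ) ^ p = ⨆ J : ℕ,
      (∑ j ∈ Finset.range J, (2 : ℝ≥0∞) ^ (-((j : ℝ) * (((n : ℝ) - 1) / 2 * (1 - 2 / p)))) *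
        ‖kconv n (wk n c ((2 : ℝ) ^ j)⁻¹ t) (F j) x‖ₑ) ^ p := fun x => by
    rw [ENNReal.tsum_eq_iSup_nat]
    exact (ENNReal.orderIsoRpow p hp0).map_iSup _
  simp_rw [hlim]
  rw [lintegral_iSup]
  · exact iSup_le fun J => hCb t F J ht
  · intro J
    refine Measurable.pow_const ?_ _
    exact Finset.measurable_sum _ fun j _ =>
      (measurable_kconv (hc.continuous_wk (by positivity) t)
        (F j).continuous.measurable).enorm.const_mul _
  · intro J J' hJ x
    refine ENNReal.rpow_le_rpow ?_ hp0.le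
    exact Finset.sum_le_sum_of_subset (Finset.range_mono hJ)

section

open scoped ContDiff

lemma contDiff_tsum_mul_pow {a : ℕ → ℝ} (ha : ∀ k, a k ≠ 0)
    (hlim : Filter.Tendsto (fun k => ‖a k.succ‖ / ‖a k‖) Filter.atTop (𝓝 0)) :
    ContDiff ℝ ∞ fun ρ : ℝ => ∑' k, a k * ρ ^ k := by
  have hr := FormalMultilinearSeries.ofScalars_radius_eq_top_of_tendsto ℝ a
    (Filter.Eventually.of_forall ha) hlim
  have h := (FormalMultilinearSeries.ofScalars ℝ a).hasFPowerSeriesOnBall (by rw [hr]; simp)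
  rw [hr] at h
  have hs : (FormalMultilinearSeries.ofScalars ℝ a).sum = fun ρ : ℝ => ∑' k, a k * ρ ^ k := by
    have := FormalMultilinearSeries.ofScalars_sum_eq (E := ℝ) a
    ext ρ
    exact (this ρ).trans (by simp)
  rw [← hs]
  exact contDiff_iff_contDiffAt.mpr fun ρ => (h.analyticOnNhd ρ (by simp)).contDiffAt

lemma tendsto_ratio_of_le {a : ℕ → ℝ} (h : ∀ k, ‖a k.succ‖ / ‖a k‖ ≤ 1 / ((k : ℝ) + 1)) :
    Filter.Tendsto (fun k => ‖a k.succ‖ / ‖a k‖) Filter.atTop (𝓝 0) :=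
  squeeze_zero (fun k => by positivity) h tendsto_one_div_add_atTop_nhds_zero_nat

lemma norm_alternating_ratio_le {m : ℕ → ℕ} {k : ℕ} (hm : m (k + 1) = m k + 2) (hk : k ≤ m k) :
    ‖(-1 : ℝ) ^ (k + 1) / ((m (k + 1)).factorial : ℝ)‖ / ‖(-1 : ℝ) ^ k / ((m k).factorial : ℝ)‖ ≤
      1 / ((k : ℝ) + 1) := by
  have h0 : (0 : ℝ) < (m k).factorial := by positivity
  have hk' : (k : ℝ) ≤ m k := by exact_mod_cast hk
  have hk0 : (0 : ℝ) ≤ k := by positivity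
  have h : ((m (k + 1)).factorial : ℝ) = (m k + 2) * ((m k + 1) * (m k).factorial) := by
    rw [hm, Nat.factorial_succ, Nat.factorial_succ]
    push_cast; ring
  rw [norm_div, norm_div, norm_pow, norm_pow, norm_neg, norm_one, one_pow, one_pow, h,
    Real.norm_of_nonneg (by positivity), Real.norm_of_nonneg (by positivity)]
  have h2 : 1 / (((m k : ℝ) + 2) * ((m k + 1) * (m k).factorial)) / (1 / ((m k).factorial : ℝ)) =
      1 / (((m k : ℝ) + 2) * (m k + 1)) := by field_simp
  rw [h2]
  apply one_div_le_one_div_of_le (by positivity)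
  nlinarith

lemma exists_contDiff_cos : ∃ g : ℝ → ℝ, ContDiff ℝ ∞ g ∧ ∀ x, g (x ^ 2) = Real.cos x := by
  set a : ℕ → ℝ := fun k => (-1) ^ k / ((2 * k).factorial : ℝ) with ha
  have h0 : ∀ k, a k ≠ 0 := fun k =>
    div_ne_zero (pow_ne_zero _ (by norm_num)) (Nat.cast_ne_zero.mpr (Nat.factorial_ne_zero _))
  have h1 := contDiff_tsum_mul_pow h0 (tendsto_ratio_of_le fun k =>
    norm_alternating_ratio_le (m := fun k => 2 * k) (by ring) (by omega))
  refine ⟨_, h1, fun x => ?_⟩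
  rw [← (Real.hasSum_cos x).tsum_eq]
  congr 1; ext k
  rw [ha, pow_mul]; ring

lemma exists_contDiff_sin : ∃ g : ℝ → ℝ, ContDiff ℝ ∞ g ∧ ∀ x, x * g (x ^ 2) = Real.sin x := by
  set a : ℕ → ℝ := fun k => (-1) ^ k / ((2 * k + 1).factorial : ℝ) with ha
  have h0 : ∀ k, a k ≠ 0 := fun k =>
    div_ne_zero (pow_ne_zero _ (by norm_num)) (Nat.cast_ne_zero.mpr (Nat.factorial_ne_zero _))
  have h1 := contDiff_tsum_mul_pow h0 (tendsto_ratio_of_le fun k =>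
    norm_alternating_ratio_le (m := fun k => 2 * k + 1) (by ring) (by omega))
  refine ⟨_, h1, fun x => ?_⟩
  rw [← (Real.hasSum_sin x).tsum_eq, ← tsum_mul_left]
  congr 1; ext k
  rw [ha, ← pow_mul]; ring

/-- The low-frequency part of the propagator of the initial position. -/
def lowCos (n : ℕ) (Φ : Rn n → ℂ) (t : ℝ) (η : Rn n) : ℂ :=
  Φ η * ((Real.cos (2 * Real.pi * t * ‖η‖) : ℝ) : ℂ)

/-- The low-frequency part of the propagator of the initial velocity. -/
def lowSin (n : ℕ) (Φ : Rn n → ℂ) (t : ℝ) (η : Rn n) : ℂ :=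
  Φ η * ((if η = 0 then t else Real.sin (2 * Real.pi * t * ‖η‖) / (2 * Real.pi * ‖η‖) : ℝ) : ℂ)

lemma contDiff_lowCos {n : ℕ} {Φ : Rn n → ℂ} (hΦ : ContDiff ℝ ∞ Φ) :
    ContDiff ℝ ∞ fun z : ℝ × Rn n => lowCos n Φ z.1 z.2 := by
  obtain ⟨g, hg, hg'⟩ := exists_contDiff_cos
  have h : (fun z : ℝ × Rn n => lowCos n Φ z.1 z.2) = fun z : ℝ × Rn n =>
      Φ z.2 * Complex.ofRealCLM (g ((2 * Real.pi * z.1) ^ 2 * ‖z.2‖ ^ 2)) := by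
    ext z
    rw [← mul_pow, hg']; rfl
  rw [h]
  have hn : ContDiff ℝ ∞ fun z : ℝ × Rn n => (2 * Real.pi * z.1) ^ 2 * ‖z.2‖ ^ 2 :=
    ((contDiff_const.mul contDiff_fst).pow 2).mul (contDiff_snd.norm_sq ℝ)
  exact (hΦ.comp contDiff_snd).mul (Complex.ofRealCLM.contDiff.comp (hg.comp hn))

lemma contDiff_lowSin {n : ℕ} {Φ : Rn n → ℂ} (hΦ : ContDiff ℝ ∞ Φ) :
    ContDiff ℝ ∞ fun z : ℝ × Rn n => lowSin n Φ z.1 z.2 := by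
  obtain ⟨g, hg, hg'⟩ := exists_contDiff_sin
  have hg1 : g 0 = 1 := by
    have h1 : HasDerivAt (fun x : ℝ => x * g (x ^ 2)) (1 * g (0 ^ 2) + 0 * deriv (fun x => g (x ^ 2)) 0) 0 :=
      (hasDerivAt_id (0 : ℝ)).mul
        ((hg.comp (contDiff_id.pow 2)).differentiable (by simp) 0).hasDerivAt
    have h2 : (fun x : ℝ => x * g (x ^ 2)) = Real.sin := by ext x; exact hg' x
    rw [h2] at h1
    have h3 := h1.unique (Real.hasDerivAt_sin 0)
    simpa using h3
  have h : (fun z : ℝ × Rn n => lowSin n Φ z.1 z.2) = fun z : ℝ × Rn n =>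
      Φ z.2 * Complex.ofRealCLM (z.1 * g ((2 * Real.pi * z.1) ^ 2 * ‖z.2‖ ^ 2)) := by
    ext z
    rw [lowSin, Complex.ofRealCLM_apply]
    congr 2
    by_cases h0 : z.2 = 0
    · simp [h0, hg1]
    · have h0' : ‖z.2‖ ≠ 0 := by simpa using h0
      rw [if_neg h0, ← mul_pow, ← hg', div_eq_iff (by positivity)]
      ring
  rw [h]
  have hn : ContDiff ℝ ∞ fun z : ℝ × Rn n => (2 * Real.pi * z.1) ^ 2 * ‖z.2‖ ^ 2 :=
    ((contDiff_const.mul contDiff_fst).pow 2).mul (contDiff_snd.norm_sq ℝ)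
  exact (hΦ.comp contDiff_snd).mul (Complex.ofRealCLM.contDiff.comp (contDiff_fst.mul (hg.comp hn)))

lemma SmoothCpt.lowCos {n : ℕ} {Φ : Rn n → ℂ} (h : SmoothCpt n Φ) (t : ℝ) :
    SmoothCpt n (lowCos n Φ t) :=
  ⟨(contDiff_lowCos h.1).comp (contDiff_const.prodMk contDiff_id), h.2.mul_right⟩

lemma SmoothCpt.lowSin {n : ℕ} {Φ : Rn n → ℂ} (h : SmoothCpt n Φ) (t : ℝ) :
    SmoothCpt n (lowSin n Φ t) :=
  ⟨(contDiff_lowSin h.1).comp (contDiff_const.prodMk contDiff_id), h.2.mul_right⟩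

lemma SmoothCpt.exists_low_bound {n : ℕ} {Φ : Rn n → ℂ} (h : SmoothCpt n Φ) (τ : ℝ) (N : ℕ) :
    ∃ A : ℝ≥0, ∀ t, |t| ≤ τ → ∀ x, ‖𝓕⁻ (_root_.lowCos n Φ t) x‖ₑ ≤ A * dec n 0 N x ∧
      ‖𝓕⁻ (_root_.lowSin n Φ t) x‖ₑ ≤ A * dec n 0 N x := by
  obtain ⟨R, hR⟩ := h.exists_ball
  obtain ⟨A, hA⟩ := exists_uniform_decay_fourierInv (contDiff_lowCos h.1) (R := R)
    (fun t η hη => by simp [_root_.lowCos, hR η hη]) τ N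
  obtain ⟨A', hA'⟩ := exists_uniform_decay_fourierInv (contDiff_lowSin h.1) (R := R)
    (fun t η hη => by simp [_root_.lowSin, hR η hη]) τ N
  refine ⟨max A A', fun t ht x => ⟨(hA t ht x).trans ?_, (hA' t ht x).trans ?_⟩⟩
  · gcongr; exact le_max_left _ _
  · gcongr; exact le_max_right _ _

end

lemma dec_mul_ofReal (n j N M : ℕ) (z : Rn n) :
    dec n j (N + M) z * ENNReal.ofReal ((1 + 2 ^ j * ‖z‖) ^ N) = dec n j M z := by
  rw [dec, dec, ← ENNReal.ofReal_mul (by positivity)]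
  congr 1
  have : 0 < 1 + 2 ^ j * ‖z‖ := by positivity
  rw [pow_add]; field_simp

/-- Convolution with a fixed rapidly decreasing kernel at unit scale. -/
lemma lintegral_kconv_low_le {n : ℕ} (hn : n ≠ 0) {p r : ℝ} (hr0 : 0 < r) (hr1 : r ≤ 1) (hrp : r < p)
    {N : ℕ} (hN : (n : ℝ) + 1 ≤ N * r) (A A' : ℝ≥0) :
    ∃ C : ℝ≥0∞, C ≠ ∞ ∧ ∀ (L : Rn n → ℂ) (F : ℕ → 𝓢(Rn n, ℂ)),
      (∀ x, ‖L x‖ₑ ≤ A' * dec n 0 (N + (n + 1)) x) → RepBound n N A F →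
      ∫⁻ x, ‖kconv n L (F 0) x‖ₑ ^ p ≤ C * ∫⁻ x, (⨆ j, ‖F j x‖ₑ) ^ p := by
  have hp0 : 0 < p := hr0.trans hrp
  obtain ⟨C, hC, hCb⟩ := lintegral_maxFun_iSup_le (n := n) hn (p := p) hr0 hrp
  set D : ℝ≥0∞ := A' * (2 ^ (n + 2) * ballVol n) with hD
  have hDt : D ≠ ∞ := by
    have := ballVol_ne_top n
    finiteness
  set B : ℝ≥0∞ := D ^ p * (A : ℝ≥0∞) ^ (p / r) with hB
  have hBt : B ≠ ∞ := ENNReal.mul_ne_top (ENNReal.rpow_ne_top_of_nonneg hp0.le hDt)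
    (ENNReal.rpow_ne_top_of_nonneg (by positivity) ENNReal.coe_ne_top)
  refine ⟨B * C, by finiteness, fun L F hL hF => ?_⟩
  have key : ∀ x, ‖kconv n L (F 0) x‖ₑ ^ p ≤
      B * maxFun n (fun w => ⨆ j, ‖F j w‖ₑ ^ r) x ^ (p / r) := fun x => by
    set m := (A * maxFun n (fun w => ⨆ j, ‖F j w‖ₑ ^ r) x) ^ (1 / r) with hm
    have h1 : ‖kconv n L (F 0) x‖ₑ ≤ D * m := by
      calc _ ≤ ∫⁻ y, ‖L (x - y) * F 0 y‖ₑ := enorm_integral_le_lintegral_enorm _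
        _ ≤ ∫⁻ y, A' * kap n 0 (x - y) * m := by
            refine lintegral_mono fun y => ?_
            rw [enorm_mul]
            have h2 := hF.enorm_le_maxFun hr0 hr1 hN (j := 0) (x := y) (y := x) le_rfl
            refine (mul_le_mul' (hL _) h2).trans_eq ?_
            rw [← dec_eq_kap, ← hm]
            have h3 := dec_mul_ofReal n 0 N (n + 1) (x - y)
            rw [← h3]
            ring
        _ = (∫⁻ y, A' * kap n 0 (x - y)) * m :=
            lintegral_mul_const _ (((measurable_kap n 0).comp (measurable_const.sub measurable_id)).const_mul _)
        _ ≤ D * m := by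
            rw [lintegral_const_mul' _ _ ENNReal.coe_ne_top]
            exact mul_le_mul' (mul_le_mul' le_rfl (lintegral_kap_le n 0 x)) le_rfl
    refine (ENNReal.rpow_le_rpow h1 hp0.le).trans_eq ?_
    rw [hB, mul_assoc (D ^ p), ENNReal.mul_rpow_of_nonneg D _ hp0.le, hm, ← ENNReal.rpow_mul,
      one_div_mul_eq_div, ENNReal.mul_rpow_of_nonneg (A : ℝ≥0∞) _ (by positivity)]
  calc _ ≤ ∫⁻ x, B * maxFun n (fun w => ⨆ j, ‖F j w‖ₑ ^ r) x ^ (p / r) := lintegral_mono key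
    _ = B * ∫⁻ x, maxFun n (fun w => ⨆ j, ‖F j w‖ₑ ^ r) x ^ (p / r) := lintegral_const_mul' _ _ hBt
    _ ≤ B * (C * ∫⁻ x, (⨆ j, ‖F j x‖ₑ) ^ p) := mul_le_mul' le_rfl (hCb F)
    _ = _ := by ring

lemma integral_rescale {n : ℕ} (f : Rn n → ℂ) :
    ((((2 * Real.pi) ^ n)⁻¹ : ℝ) : ℂ) * ∫ ξ, f ξ = ∫ η, f ((2 * Real.pi) • η) := by
  rw [Measure.integral_comp_smul, finrank_euclideanSpace_fin, abs_of_nonneg (by positivity),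
    Complex.real_smul]

lemma fourierInv_eq_integral {n : ℕ} (f : Rn n → ℂ) (x : Rn n) :
    𝓕⁻ f x = ∫ η, exp (I * ((⟪x, (2 * Real.pi) • η⟫_ℝ : ℝ) : ℂ)) * f η := by
  rw [Real.fourierInv_eq']
  congr 1; ext η
  rw [smul_eq_mul, inner_smul_right, real_inner_comm, mul_comm I]

lemma invFT_eq {n : ℕ} (h : Rn n → ℝ) :
    invFT n h = 𝓕⁻ (fun η => ((h ((2 * Real.pi) • η) : ℝ) : ℂ)) := by
  ext x
  rw [fourierInv_eq_integral, invFT,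
    integral_rescale fun ξ => exp (I * ((⟪x, ξ⟫_ℝ : ℝ) : ℂ)) * ((h ξ : ℝ) : ℂ)]

lemma ftransform_smul {n : ℕ} (f : 𝓢(Rn n, ℂ)) (η : Rn n) :
    ftransform n f ((2 * Real.pi) • η) = (𝓕 f : 𝓢(Rn n, ℂ)) η := by
  rw [SchwartzMap.fourier_coe, Real.fourier_eq', ftransform]
  congr 1; ext x
  rw [smul_eq_mul, inner_smul_right]
  congr 2
  push_cast; ring

lemma integrableOn_norm_inv {n : ℕ} (hn : 2 ≤ n) :
    IntegrableOn (fun η : Rn n => ‖η‖⁻¹) (Metric.ball 0 1) volume := by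
  have : Nontrivial (Rn n) := by
    have : Nontrivial (Fin n) := Fin.nontrivial_iff_two_le.mpr hn
    have : Nonempty (Fin n) := ⟨⟨0, by omega⟩⟩
    infer_instance
  rw [integrableOn_fun_norm_addHaar volume (f := fun y => y⁻¹) , finrank_euclideanSpace_fin]
  have h : IntegrableOn (fun y : ℝ => y ^ (n - 2)) (Set.Ioo 0 1) :=
    ((continuous_pow _).integrableOn_Icc (a := 0) (b := 1)).mono_set Set.Ioo_subset_Icc_self
  refine h.congr_fun (fun y hy => ?_) measurableSet_Ioo
  have hy0 : y ≠ 0 := hy.1.ne'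
  obtain ⟨m, rfl⟩ := Nat.exists_eq_add_of_le hn
  have : 2 + m - 1 = m + 1 := by omega
  simp only [this, smul_eq_mul, Nat.add_sub_cancel_left]
  field_simp
  ring

lemma integrable_div_norm {n : ℕ} (hn : 2 ≤ n) (g : 𝓢(Rn n, ℂ)) :
    Integrable (fun η => g η / (‖η‖ : ℂ)) volume := by
  obtain ⟨b, hb⟩ := SchwartzMap.exists_norm_le g
  have h1 : Integrable ((Metric.ball (0 : Rn n) 1).indicator fun η => b * ‖η‖⁻¹) volume :=
    (integrable_indicator_iff measurableSet_ball).mpr ((integrableOn_norm_inv hn).const_mul b)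
  have h2 : Integrable (fun η => ‖g η‖) volume := g.integrable.norm
  refine (h1.add h2).mono' ?_ (Filter.Eventually.of_forall fun η => ?_)
  · exact (g.continuous.measurable.div
      (Complex.measurable_ofReal.comp measurable_norm)).aestronglyMeasurable
  · rw [norm_div, Complex.norm_real, norm_norm, Pi.add_apply, div_eq_mul_inv]
    by_cases hη : η ∈ Metric.ball (0 : Rn n) 1
    · rw [Set.indicator_of_mem hη]
      have := mul_le_mul_of_nonneg_right (hb η) (inv_nonneg.mpr (norm_nonneg η))
      linarith [norm_nonneg (g η)]
    · rw [Set.indicator_of_notMem hη, zero_add]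
      have h1 : 1 ≤ ‖η‖ := by simpa using hη
      exact mul_le_of_le_one_right (norm_nonneg _) (inv_le_one_of_one_le₀ h1)

/-- The Fourier transform of the two half-wave components of the solution of the wave equation. -/
def halfWave (n : ℕ) (f0 f1 : 𝓢(Rn n, ℂ)) (t : ℝ) (η : Rn n) : ℂ :=
  exp (((2 * Real.pi * t * ‖η‖ : ℝ) : ℂ) * I) *
    ((𝓕 f0 : 𝓢(Rn n, ℂ)) η / 2 + (𝓕 f1 : 𝓢(Rn n, ℂ)) η / (‖η‖ : ℂ) / (4 * Real.pi * I))

lemma integrable_halfWave {n : ℕ} (hn : 2 ≤ n) (f0 f1 : 𝓢(Rn n, ℂ)) (t : ℝ) :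
    Integrable (halfWave n f0 f1 t) volume := by
  have h : Integrable (fun η => (𝓕 f0 : 𝓢(Rn n, ℂ)) η / 2 +
      (𝓕 f1 : 𝓢(Rn n, ℂ)) η / (‖η‖ : ℂ) / (4 * Real.pi * I)) volume :=
    ((𝓕 f0 : 𝓢(Rn n, ℂ)).integrable.div_const 2).add ((integrable_div_norm hn (𝓕 f1)).div_const _)
  refine h.bdd_mul (c := 1) ?_ (Filter.Eventually.of_forall fun η => ?_)
  · exact (Continuous.cexp (by fun_prop)).aestronglyMeasurable
  · rw [norm_exp_ofReal_mul_I]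

lemma integrable_exp_inner_mul {n : ℕ} {f : Rn n → ℂ} (hf : Integrable f volume) (x : Rn n) :
    Integrable (fun η => exp (I * ((⟪x, (2 * Real.pi) • η⟫_ℝ : ℝ) : ℂ)) * f η) volume := by
  refine hf.bdd_mul (c := 1) ?_ (Filter.Eventually.of_forall fun η => ?_)
  · exact (Continuous.cexp (by fun_prop)).aestronglyMeasurable
  · rw [mul_comm, norm_exp_ofReal_mul_I]

/-- The Fourier transform of the solution of the wave equation. -/
def waveSymb (n : ℕ) (f0 f1 : 𝓢(Rn n, ℂ)) (t : ℝ) (η : Rn n) : ℂ :=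
  halfWave n f0 f1 t η + halfWave n f0 (-f1) (-t) η

lemma integrable_waveSymb {n : ℕ} (hn : 2 ≤ n) (f0 f1 : 𝓢(Rn n, ℂ)) (t : ℝ) :
    Integrable (waveSymb n f0 f1 t) volume :=
  (integrable_halfWave hn f0 f1 t).add (integrable_halfWave hn f0 (-f1) (-t))

lemma waveSol_eq {n : ℕ} (hn : 2 ≤ n) (f0 f1 : 𝓢(Rn n, ℂ)) (t : ℝ) :
    waveSol n f0 f1 t = 𝓕⁻ (waveSymb n f0 f1 t) := by
  ext x
  have hpi : (0 : ℝ) ≤ 2 * Real.pi := by positivity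
  rw [waveSol, integral_rescale fun ξ : Rn n =>
      Complex.exp (Complex.I * (((⟪x, ξ⟫_ℝ + t * ‖ξ‖ : ℝ)) : ℂ)) *
        (ftransform n f0 ξ / 2 + ftransform n f1 ξ / (2 * Complex.I * (‖ξ‖ : ℂ))),
    integral_rescale fun ξ : Rn n =>
      Complex.exp (Complex.I * (((⟪x, ξ⟫_ℝ - t * ‖ξ‖ : ℝ)) : ℂ)) *
        (ftransform n f0 ξ / 2 - ftransform n f1 ξ / (2 * Complex.I * (‖ξ‖ : ℂ))),
    fourierInv_eq_integral]
  rw [show (fun η => exp (I * ((⟪x, (2 * Real.pi) • η⟫_ℝ : ℝ) : ℂ)) * waveSymb n f0 f1 t η) =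
      fun η => exp (I * ((⟪x, (2 * Real.pi) • η⟫_ℝ : ℝ) : ℂ)) * halfWave n f0 f1 t η +
        exp (I * ((⟪x, (2 * Real.pi) • η⟫_ℝ : ℝ) : ℂ)) * halfWave n f0 (-f1) (-t) η from
    funext fun η => mul_add _ _ _]
  rw [integral_add (integrable_exp_inner_mul (integrable_halfWave hn f0 f1 t) x)
    (integrable_exp_inner_mul (integrable_halfWave hn f0 (-f1) (-t)) x)]
  have key : ∀ (a b : ℝ) (z : ℂ), exp (I * ((a + t * b : ℝ) : ℂ)) * z =
      exp (I * (a : ℂ)) * (exp (((t * b : ℝ) : ℂ) * I) * z) := by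
    intro a b z
    rw [← mul_assoc, ← Complex.exp_add]; congr 2; push_cast; ring
  have key' : ∀ (a b : ℝ) (z : ℂ), exp (I * ((a - t * b : ℝ) : ℂ)) * z =
      exp (I * (a : ℂ)) * (exp ((((-t) * b : ℝ) : ℂ) * I) * z) := by
    intro a b z
    rw [← mul_assoc, ← Complex.exp_add]; congr 2; push_cast; ring
  have hneg : ∀ η, (𝓕 (-f1) : 𝓢(Rn n, ℂ)) η = -(𝓕 f1 : 𝓢(Rn n, ℂ)) η := by
    intro η; rw [FourierTransform.fourier_neg]; rfl
  congr 1 <;> congr 1 <;> ext η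
  · rw [key, ftransform_smul, ftransform_smul, halfWave, norm_smul, Real.norm_of_nonneg hpi,
      show t * (2 * Real.pi * ‖η‖) = 2 * Real.pi * t * ‖η‖ by ring,
      show 2 * I * ((2 * Real.pi * ‖η‖ : ℝ) : ℂ) = (‖η‖ : ℂ) * (4 * Real.pi * I) by
        push_cast; ring, div_div]
  · rw [key', ftransform_smul, ftransform_smul, halfWave, norm_smul, Real.norm_of_nonneg hpi, hneg,
      show -t * (2 * Real.pi * ‖η‖) = 2 * Real.pi * (-t) * ‖η‖ by ring,
      show 2 * I * ((2 * Real.pi * ‖η‖ : ℝ) : ℂ) = (‖η‖ : ℂ) * (4 * Real.pi * I) by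
        push_cast; ring, div_div, neg_div, sub_eq_add_neg]

lemma kconv_fourierInv_of_integrable {n : ℕ} (S : 𝓢(Rn n, ℂ)) {U : Rn n → ℂ}
    (hU : Integrable U volume) :
    kconv n ⇑(𝓕⁻ S : 𝓢(Rn n, ℂ)) (𝓕⁻ U) = 𝓕⁻ (fun η => S η * U η) := by
  ext x
  set G : Rn n → ℂ := fun v => exp (((2 * Real.pi * ⟪v, x⟫_ℝ : ℝ) : ℂ) * I) * S v with hG
  have hGc : Continuous G := by
    have := S.continuous
    exact (Continuous.cexp (by fun_prop)).mul this
  have hGi : Integrable G volume := by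
    refine S.integrable.bdd_mul (c := 1) ?_ (Filter.Eventually.of_forall fun η => ?_)
    · exact (Continuous.cexp (by fun_prop)).aestronglyMeasurable
    · rw [norm_exp_ofReal_mul_I]
  have hFG : 𝓕 G = fun y => (𝓕⁻ S : 𝓢(Rn n, ℂ)) (x - y) := by
    ext y
    rw [SchwartzMap.fourierInv_coe, Real.fourierInv_eq', Real.fourier_eq']
    congr 1; ext v
    rw [hG, smul_eq_mul, smul_eq_mul, ← mul_assoc, ← Complex.exp_add, inner_sub_right]
    congr 2; push_cast; ring
  have hFGi : Integrable (𝓕 G) volume := by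
    rw [hFG]; exact (𝓕⁻ S : 𝓢(Rn n, ℂ)).integrable.comp_sub_left x
  have hinv := hGc.fourierInv_fourier_eq hGi hFGi
  have hflip : ∫ y, 𝓕 (fun v => U (-v)) y • 𝓕 G y = ∫ v, U (-v) • 𝓕 (𝓕 G) v := by
    simpa using! VectorFourier.integral_fourierIntegral_smul_eq_flip (L := innerₗ (Rn n))
      Real.continuous_fourierChar continuous_inner hU.comp_neg hFGi
  rw [kconv]
  calc ∫ y, (𝓕⁻ S : 𝓢(Rn n, ℂ)) (x - y) * 𝓕⁻ U y
      = ∫ y, 𝓕 (fun v => U (-v)) y • 𝓕 G y := by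
        congr 1; ext y; rw [hFG, Real.fourierInv_eq_fourier_comp_neg, smul_eq_mul, mul_comm]
    _ = ∫ v, U (-v) * G (-v) := by
        rw [hflip]; congr 1; ext v
        rw [smul_eq_mul, ← neg_neg v, ← Real.fourierInv_eq_fourier_neg, hinv, neg_neg]
    _ = ∫ v, U v * G v := integral_neg_eq_self (fun v => U v * G v) volume
    _ = _ := by
        rw [Real.fourierInv_eq']
        congr 1; ext v
        rw [hG, smul_eq_mul]; ring

lemma kconv_fourierInv_eq_of_ae {n : ℕ} (S V : 𝓢(Rn n, ℂ)) {U : Rn n → ℂ}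
    (hU : Integrable U volume)
    (h : ∀ η ≠ 0, (𝓕 V : 𝓢(Rn n, ℂ)) η = S η * U η) (hn : n ≠ 0) :
    kconv n ⇑(𝓕⁻ S : 𝓢(Rn n, ℂ)) (𝓕⁻ U) = V := by
  have : Nonempty (Fin n) := ⟨⟨0, Nat.pos_of_ne_zero hn⟩⟩
  rw [kconv_fourierInv_of_integrable S hU]
  have h1 : (V : Rn n → ℂ) = 𝓕⁻ ⇑(𝓕 V : 𝓢(Rn n, ℂ)) := by
    rw [← SchwartzMap.fourierInv_coe, FourierTransform.fourierInv_fourier_eq]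
  rw [h1]
  ext x
  rw [Real.fourierInv_eq', Real.fourierInv_eq']
  refine integral_congr_ae ?_
  filter_upwards [compl_mem_ae_iff.mpr (measure_singleton (0 : Rn n))] with η hη
  rw [h η hη]

/-- The Littlewood–Paley multipliers with the normalisation of the Fourier transform `𝓕`. -/
def lpMul (n : ℕ) (ψ0 : Rn n → ℝ) (j : ℕ) (η : Rn n) : ℂ := (lpPiece n ψ0 j ((2 * Real.pi) • η) : ℝ)

lemma smoothOp_lpPiece (n : ℕ) (ψ0 : Rn n → ℝ) (j : ℕ) (g : Rn n → ℂ) :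
    smoothOp n (lpPiece n ψ0 j) g = kconv n (𝓕⁻ (lpMul n ψ0 j)) g := by
  ext x
  rw [smoothOp, invFT_eq]; rfl

lemma IsLPBase.smoothCpt {n : ℕ} {ψ0 : Rn n → ℝ} (h : IsLPBase n ψ0) :
    SmoothCpt n fun η => ((ψ0 η : ℝ) : ℂ) := by
  refine ⟨Complex.ofRealCLM.contDiff.comp h.1, ?_⟩
  refine HasCompactSupport.of_support_subset_isCompact (isCompact_closedBall (0 : Rn n) 2) fun x hx => ?_
  by_contra hx2
  exact hx (by simp [h.2.2 x (by simpa using hx2)])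

lemma IsLPBase.smoothCpt_smul {n : ℕ} {ψ0 : Rn n → ℝ} (h : IsLPBase n ψ0) {a : ℝ} (ha : a ≠ 0) :
    SmoothCpt n fun η => ((ψ0 (a • η) : ℝ) : ℂ) := h.smoothCpt.scale ha

lemma SmoothCpt.sub {n : ℕ} {F G : Rn n → ℂ} (hF : SmoothCpt n F) (hG : SmoothCpt n G) :
    SmoothCpt n fun η => F η - G η := ⟨hF.1.sub hG.1, hF.2.sub hG.2⟩

lemma lpMul_zero (n : ℕ) (ψ0 : Rn n → ℝ) :
    lpMul n ψ0 0 = fun η => ((ψ0 ((2 * Real.pi) • η) : ℝ) : ℂ) := by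
  ext η; simp [lpMul, lpPiece]

lemma lpMul_of_ne_zero (n : ℕ) (ψ0 : Rn n → ℝ) {j : ℕ} (hj : j ≠ 0) :
    lpMul n ψ0 j = fun η => ((ψ0 ((((2 : ℝ) ^ j)⁻¹ * (2 * Real.pi)) • η) : ℝ) : ℂ) -
      ((ψ0 ((((2 : ℝ) ^ j)⁻¹ * (4 * Real.pi)) • η) : ℝ) : ℂ) := by
  ext η
  rw [lpMul, lpPiece, if_neg hj, smul_smul, smul_smul, zpow_neg, zpow_add₀ two_ne_zero, zpow_neg,
    zpow_natCast, zpow_one, Complex.ofReal_sub]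
  congr 4; ring

lemma IsLPBase.smoothCpt_lpMul {n : ℕ} {ψ0 : Rn n → ℝ} (h : IsLPBase n ψ0) (j : ℕ) :
    SmoothCpt n (lpMul n ψ0 j) := by
  have hpi := Real.pi_pos
  by_cases hj : j = 0
  · subst hj; rw [lpMul_zero]; exact h.smoothCpt_smul (by positivity)
  · rw [lpMul_of_ne_zero n ψ0 hj]
    exact (h.smoothCpt_smul (by positivity)).sub (h.smoothCpt_smul (by positivity))

/-- A multiplier localising to frequencies at most comparable to one. -/
def lowMul (n : ℕ) (ψ0 : Rn n → ℝ) (η : Rn n) : ℂ := (ψ0 (Real.pi • η) : ℝ)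

/-- A multiplier localising to frequencies comparable to one. -/
def annMul (n : ℕ) (ψ0 : Rn n → ℝ) (η : Rn n) : ℂ :=
  ((ψ0 (Real.pi • η) : ℝ) : ℂ) - ((ψ0 ((8 * Real.pi) • η) : ℝ) : ℂ)

lemma IsLPBase.smoothCpt_lowMul {n : ℕ} {ψ0 : Rn n → ℝ} (h : IsLPBase n ψ0) :
    SmoothCpt n (lowMul n ψ0) := h.smoothCpt_smul Real.pi_ne_zero

lemma IsLPBase.ann_annMul {n : ℕ} {ψ0 : Rn n → ℝ} (h : IsLPBase n ψ0) : Ann n (annMul n ψ0) := by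
  have hpi := Real.pi_pos
  refine ⟨(h.smoothCpt_smul hpi.ne').sub (h.smoothCpt_smul (by positivity)), ?_⟩
  filter_upwards [Metric.ball_mem_nhds (0 : Rn n) (show 0 < 1 / (8 * Real.pi) by positivity)] with η hη
  have h1 : 8 * Real.pi * ‖η‖ ≤ 1 := by
    have : ‖η‖ < 1 / (8 * Real.pi) := by simpa using hη
    rw [lt_div_iff₀ (by positivity)] at this
    linarith
  rw [annMul, h.2.1, h.2.1, sub_self, Pi.zero_apply]
  · rwa [norm_smul, Real.norm_of_nonneg (by positivity)]
  · rw [norm_smul, Real.norm_of_nonneg (by positivity)]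
    nlinarith [mul_nonneg hpi.le (norm_nonneg η)]

lemma IsLPBase.lpMul_mul_lowMul {n : ℕ} {ψ0 : Rn n → ℝ} (h : IsLPBase n ψ0) (j : ℕ) (η : Rn n) :
    lowMul n ψ0 (((2 : ℝ) ^ j)⁻¹ • η) * lpMul n ψ0 j η = lpMul n ψ0 j η := by
  have hpi := Real.pi_pos
  by_cases hη : ‖((2 : ℝ) ^ j)⁻¹ • η‖ ≤ 1 / Real.pi
  · rw [lowMul, h.2.1, ofReal_one, one_mul]
    rw [norm_smul, Real.norm_of_nonneg hpi.le, mul_comm]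
    exact (le_div_iff₀ hpi).mp hη
  · suffices lpMul n ψ0 j η = 0 by rw [this, mul_zero]
    rw [not_le, norm_smul, Real.norm_of_nonneg (by positivity), div_lt_iff₀ hpi] at hη
    by_cases hj : j = 0
    · subst hj
      rw [lpMul_zero]
      simp only
      rw [h.2.2, ofReal_zero]
      rw [norm_smul, Real.norm_of_nonneg (by positivity)]
      simp only [pow_zero, inv_one, one_mul] at hη
      linarith
    · rw [lpMul_of_ne_zero n ψ0 hj]
      simp only
      rw [h.2.2, h.2.2, sub_self]
      · rw [norm_smul, Real.norm_of_nonneg (by positivity)]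
        linarith
      · rw [norm_smul, Real.norm_of_nonneg (by positivity)]
        linarith

lemma IsLPBase.lpMul_mul_annMul {n : ℕ} {ψ0 : Rn n → ℝ} (h : IsLPBase n ψ0) {j : ℕ} (hj : j ≠ 0)
    (η : Rn n) : annMul n ψ0 (((2 : ℝ) ^ j)⁻¹ • η) * lpMul n ψ0 j η = lpMul n ψ0 j η := by
  have hpi := Real.pi_pos
  by_cases hη : 4 * Real.pi * ‖((2 : ℝ) ^ j)⁻¹ • η‖ ≤ 1
  · suffices lpMul n ψ0 j η = 0 by rw [this, mul_zero]
    rw [norm_smul, Real.norm_of_nonneg (by positivity)] at hη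
    have h0 : 0 ≤ Real.pi * (((2 : ℝ) ^ j)⁻¹ * ‖η‖) := by positivity
    rw [lpMul_of_ne_zero n ψ0 hj]
    simp only
    rw [h.2.1, h.2.1, sub_self]
    · rw [norm_smul, Real.norm_of_nonneg (by positivity)]
      linarith
    · rw [norm_smul, Real.norm_of_nonneg (by positivity)]
      linarith
  · rw [annMul, h.2.2 ((8 * Real.pi) • _), ofReal_zero, sub_zero]
    · exact h.lpMul_mul_lowMul j η
    · rw [norm_smul _ (((2 : ℝ) ^ j)⁻¹ • η), Real.norm_of_nonneg (by positivity)]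
      linarith

/-- The Littlewood–Paley pieces of a Schwartz function, as Schwartz functions. -/
def lpSchwartz {n : ℕ} {ψ0 : Rn n → ℝ} (h : IsLPBase n ψ0) (j : ℕ) (f : 𝓢(Rn n, ℂ)) : 𝓢(Rn n, ℂ) :=
  𝓕⁻ (SchwartzMap.pairing (ContinuousLinearMap.mul ℂ ℂ) (h.smoothCpt_lpMul j).toS (𝓕 f))

lemma fourier_lpSchwartz {n : ℕ} {ψ0 : Rn n → ℝ} (h : IsLPBase n ψ0) (j : ℕ) (f : 𝓢(Rn n, ℂ))
    (η : Rn n) : (𝓕 (lpSchwartz h j f) : 𝓢(Rn n, ℂ)) η =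
      lpMul n ψ0 j η * (𝓕 f : 𝓢(Rn n, ℂ)) η := by
  rw [lpSchwartz, FourierTransform.fourier_fourierInv_eq]; rfl

lemma smoothOp_lpPiece_schwartz {n : ℕ} {ψ0 : Rn n → ℝ} (h : IsLPBase n ψ0) (j : ℕ)
    (f : 𝓢(Rn n, ℂ)) : smoothOp n (lpPiece n ψ0 j) f = lpSchwartz h j f := by
  rw [smoothOp_lpPiece, ← (h.smoothCpt_lpMul j).fourierInv_toS]
  exact kconv_fourierInv _ _ _ fun ξ => rfl

lemma repBound_lpSchwartz {n : ℕ} {ψ0 : Rn n → ℝ} (h : IsLPBase n ψ0) (N : ℕ) :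
    ∃ A : ℝ≥0, ∀ (a : ℕ → ℂ) (f : 𝓢(Rn n, ℂ)), RepBound n N A fun j => a j • lpSchwartz h j f := by
  obtain ⟨A, hA⟩ := h.smoothCpt_lowMul.exists_dec_bound N
  refine ⟨A, fun a f j x => ?_⟩
  have ha : ((2 : ℝ) ^ j)⁻¹ ≠ 0 := by positivity
  have hS := h.smoothCpt_lowMul.scale ha
  have h1 : kconv n (𝓕⁻ fun η => lowMul n ψ0 (((2 : ℝ) ^ j)⁻¹ • η)) ⇑(a j • lpSchwartz h j f) =
      ⇑(a j • lpSchwartz h j f) := by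
    rw [← hS.fourierInv_toS, kconv_fourierInv hS.toS (a j • lpSchwartz h j f)
      (𝓕 (a j • lpSchwartz h j f)) ?_, FourierTransform.fourierInv_fourier_eq]
    intro ξ
    rw [FourierTransform.fourier_smul, smul_apply, fourier_lpSchwartz,
      SmoothCpt.coe_toS, smul_eq_mul]
    rw [← h.lpMul_mul_lowMul]
    linear_combination (-(a j) * (𝓕 f : 𝓢(Rn n, ℂ)) ξ * lowMul n ψ0 (((2 : ℝ) ^ j)⁻¹ • ξ)) *
      h.lpMul_mul_lowMul j ξ
  calc ‖(a j • lpSchwartz h j f) x‖ₑ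
      = ‖kconv n (𝓕⁻ fun η => lowMul n ψ0 (((2 : ℝ) ^ j)⁻¹ • η)) ⇑(a j • lpSchwartz h j f) x‖ₑ := by
        rw [h1]
    _ ≤ ∫⁻ y, ‖(𝓕⁻ fun η => lowMul n ψ0 (((2 : ℝ) ^ j)⁻¹ • η)) (x - y) *
          (a j • lpSchwartz h j f) y‖ₑ := enorm_integral_le_lintegral_enorm _
    _ ≤ ∫⁻ y, A * (dec n j N (x - y) * ‖(a j • lpSchwartz h j f) y‖ₑ) := by
        refine lintegral_mono fun y => ?_
        rw [enorm_mul, ← mul_assoc]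
        exact mul_le_mul' (hA j _) le_rfl
    _ = _ := lintegral_const_mul' _ _ ENNReal.coe_ne_top

section

open scoped ContDiff

/-- The multiplier `c(η) / (4πi|η|)`. -/
def divNorm (n : ℕ) (c : Rn n → ℂ) (η : Rn n) : ℂ := ((‖η‖ : ℝ) : ℂ)⁻¹ * (4 * Real.pi * I)⁻¹ * c η

lemma Ann.divNorm {n : ℕ} {c : Rn n → ℂ} (h : Ann n c) : Ann n (divNorm n c) := by
  refine h.mul fun η hη => ContDiffAt.mul ?_ contDiffAt_const
  refine ContDiffAt.inv ?_ (by simpa using hη)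
  exact Complex.ofRealCLM.contDiff.contDiffAt.comp η (contDiffAt_norm ℝ hη)

lemma Ann.exists_kconv_wk {n : ℕ} {c : Rn n → ℂ} (h : Ann n c) {a : ℝ} (ha : 0 < a) (t : ℝ)
    (g : 𝓢(Rn n, ℂ)) :
    ∃ u : 𝓢(Rn n, ℂ), kconv n (wk n c a t) g = u ∧
      ∀ ξ, (𝓕 u : 𝓢(Rn n, ℂ)) ξ = _root_.symb n c a t ξ * (𝓕 g : 𝓢(Rn n, ℂ)) ξ := by
  rw [h.wk_eq ha t]
  exact exists_kconv_fourierInv _ _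

lemma fourier_neg_apply {n : ℕ} (f : 𝓢(Rn n, ℂ)) (η : Rn n) :
    (𝓕 (-f) : 𝓢(Rn n, ℂ)) η = -(𝓕 f : 𝓢(Rn n, ℂ)) η := by
  rw [FourierTransform.fourier_neg]; rfl

/-- The dyadic pieces of the solution of the wave equation at high frequencies. -/
lemma smoothOp_waveSol_of_ne_zero {n : ℕ} (hn : 2 ≤ n) {ψ0 : Rn n → ℝ} (h : IsLPBase n ψ0)
    (f0 f1 : 𝓢(Rn n, ℂ)) (t : ℝ) {j : ℕ} (hj : j ≠ 0) (x : Rn n) :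
    smoothOp n (lpPiece n ψ0 j) (waveSol n f0 f1 t) x =
      (1 / 2) * (kconv n (wk n (annMul n ψ0) ((2 : ℝ) ^ j)⁻¹ t) (lpSchwartz h j f0) x +
        kconv n (wk n (annMul n ψ0) ((2 : ℝ) ^ j)⁻¹ (-t)) (lpSchwartz h j f0) x) +
      (((2 : ℝ) ^ j)⁻¹ : ℝ) *
        (kconv n (wk n (divNorm n (annMul n ψ0)) ((2 : ℝ) ^ j)⁻¹ t) (lpSchwartz h j f1) x -
        kconv n (wk n (divNorm n (annMul n ψ0)) ((2 : ℝ) ^ j)⁻¹ (-t)) (lpSchwartz h j f1) x) := by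
  have ha : (0 : ℝ) < ((2 : ℝ) ^ j)⁻¹ := by positivity
  obtain ⟨u1, hu1, hv1⟩ := h.ann_annMul.exists_kconv_wk ha t (lpSchwartz h j f0)
  obtain ⟨u2, hu2, hv2⟩ := h.ann_annMul.exists_kconv_wk ha (-t) (lpSchwartz h j f0)
  obtain ⟨u3, hu3, hv3⟩ := h.ann_annMul.divNorm.exists_kconv_wk ha t (lpSchwartz h j f1)
  obtain ⟨u4, hu4, hv4⟩ := h.ann_annMul.divNorm.exists_kconv_wk ha (-t) (lpSchwartz h j f1)
  rw [hu1, hu2, hu3, hu4, smoothOp_lpPiece, waveSol_eq hn,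
    ← (h.smoothCpt_lpMul j).fourierInv_toS,
    kconv_fourierInv_eq_of_ae _ ((1 / 2 : ℂ) • (u1 + u2) + ((((2 : ℝ) ^ j)⁻¹ : ℝ) : ℂ) • (u3 - u4))
      (integrable_waveSymb hn f0 f1 t) ?_ (by omega)]
  · rfl
  intro η hη
  have e1 := h.lpMul_mul_annMul hj η
  have ha' : ((((2 : ℝ) ^ j)⁻¹ : ℝ) : ℂ) ≠ 0 := by exact_mod_cast ha.ne'
  simp only [FourierTransform.fourier_add, FourierTransform.fourier_smul,
    sub_eq_add_neg u3, add_apply, smul_apply, smul_eq_mul, hv1, hv2, hv3, hv4, fourier_lpSchwartz, symb, divNorm, waveSymb, halfWave, fourier_neg_apply,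
    SmoothCpt.coe_toS]
  rw [norm_smul, Real.norm_of_nonneg ha.le, ofReal_mul (((2 : ℝ) ^ j)⁻¹)]
  generalize exp (((2 * Real.pi * t * ‖η‖ : ℝ) : ℂ) * I) = E
  generalize exp (((2 * Real.pi * (-t) * ‖η‖ : ℝ) : ℂ) * I) = E'
  generalize ((((2 : ℝ) ^ j)⁻¹ : ℝ) : ℂ) = b at *
  generalize ((‖η‖ : ℝ) : ℂ) = r at *
  generalize (𝓕 f0 : 𝓢(Rn n, ℂ)) η = g0
  generalize (𝓕 f1 : 𝓢(Rn n, ℂ)) η = g1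
  rw [mul_inv b r]
  have hb : b * b⁻¹ = 1 := mul_inv_cancel₀ ha'
  simp only [div_eq_mul_inv, mul_inv]
  linear_combination (1 / 2 * (E + E') * g0 + (E - E') * (r⁻¹ * (4⁻¹ * (Real.pi : ℂ)⁻¹ * I⁻¹)) * g1) * e1 +
    (E - E') * (r⁻¹ * (4⁻¹ * (Real.pi : ℂ)⁻¹ * I⁻¹)) * g1 * annMul n ψ0 (((2 : ℝ) ^ j)⁻¹ • η) *
      lpMul n ψ0 j η * hb

/-- The dyadic piece of the solution of the wave equation at low frequencies. -/
lemma smoothOp_waveSol_zero {n : ℕ} (hn : 2 ≤ n) {ψ0 : Rn n → ℝ} (h : IsLPBase n ψ0)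
    (f0 f1 : 𝓢(Rn n, ℂ)) (t : ℝ) (x : Rn n) :
    smoothOp n (lpPiece n ψ0 0) (waveSol n f0 f1 t) x =
      kconv n (𝓕⁻ (lowCos n (lowMul n ψ0) t)) (lpSchwartz h 0 f0) x +
        kconv n (𝓕⁻ (lowSin n (lowMul n ψ0) t)) (lpSchwartz h 0 f1) x := by
  have hs1 := h.smoothCpt_lowMul.lowCos t
  have hs2 := h.smoothCpt_lowMul.lowSin t
  obtain ⟨u1, hu1, hv1⟩ := exists_kconv_fourierInv hs1.toS (lpSchwartz h 0 f0)
  obtain ⟨u2, hu2, hv2⟩ := exists_kconv_fourierInv hs2.toS (lpSchwartz h 0 f1)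
  rw [← hs1.fourierInv_toS, ← hs2.fourierInv_toS, hu1, hu2, smoothOp_lpPiece, waveSol_eq hn,
    ← (h.smoothCpt_lpMul 0).fourierInv_toS,
    kconv_fourierInv_eq_of_ae _ (u1 + u2) (integrable_waveSymb hn f0 f1 t) ?_ (by omega)]
  · rfl
  intro η hη
  have e1 := h.lpMul_mul_lowMul 0 η
  rw [pow_zero, inv_one, one_smul] at e1
  simp only [FourierTransform.fourier_add, add_apply, hv1, hv2, fourier_lpSchwartz, lowCos, lowSin,
    waveSymb, halfWave, fourier_neg_apply, SmoothCpt.coe_toS, if_neg hη]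
  have hE : exp (((2 * Real.pi * t * ‖η‖ : ℝ) : ℂ) * I) =
      ((Real.cos (2 * Real.pi * t * ‖η‖) : ℝ) : ℂ) + ((Real.sin (2 * Real.pi * t * ‖η‖) : ℝ) : ℂ) * I := by
    rw [Complex.exp_mul_I]; simp
  have hE' : exp (((2 * Real.pi * (-t) * ‖η‖ : ℝ) : ℂ) * I) =
      ((Real.cos (2 * Real.pi * t * ‖η‖) : ℝ) : ℂ) - ((Real.sin (2 * Real.pi * t * ‖η‖) : ℝ) : ℂ) * I := by
    rw [Complex.exp_mul_I, show 2 * Real.pi * (-t) * ‖η‖ = -(2 * Real.pi * t * ‖η‖) by ring]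
    simp [sub_eq_add_neg]
  rw [hE, hE', ofReal_div, ofReal_mul (2 * Real.pi), ofReal_mul 2, ofReal_ofNat]
  generalize ((Real.cos (2 * Real.pi * t * ‖η‖) : ℝ) : ℂ) = co
  generalize ((Real.sin (2 * Real.pi * t * ‖η‖) : ℝ) : ℂ) = si
  generalize ((‖η‖ : ℝ) : ℂ) = r at *
  generalize (𝓕 f0 : 𝓢(Rn n, ℂ)) η = g0
  generalize (𝓕 f1 : 𝓢(Rn n, ℂ)) η = g1
  have hI : I * I⁻¹ = 1 := mul_inv_cancel₀ I_ne_zero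
  simp only [div_eq_mul_inv, mul_inv]
  linear_combination (co * g0 + si * (2⁻¹ * (Real.pi : ℂ)⁻¹ * r⁻¹) * g1) * e1 -
    lpMul n ψ0 0 η * si * (2⁻¹ * (Real.pi : ℂ)⁻¹ * r⁻¹) * g1 * hI

end

lemma ENNReal.add_rpow_le_two_rpow_mul (a b : ℝ≥0∞) {r : ℝ} (hr : 0 ≤ r) :
    (a + b) ^ r ≤ 2 ^ r * (a ^ r + b ^ r) := by
  wlog h : a ≤ b generalizing a b
  · rw [add_comm a, add_comm (a ^ r)]
    exact this b a (le_of_not_ge h)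
  calc (a + b) ^ r ≤ (2 * b) ^ r := by
        refine ENNReal.rpow_le_rpow ?_ hr
        rw [two_mul]; exact add_le_add h le_rfl
    _ = 2 ^ r * b ^ r := ENNReal.mul_rpow_of_nonneg _ _ hr
    _ ≤ _ := mul_le_mul' le_rfl le_add_self

lemma tsum_rpow_rpow_le {q r : ℝ} (hr : 0 < r) (hrq : r ≤ q) (v : ℕ → ℝ≥0∞) :
    (∑' j, v j ^ q) ^ (r / q) ≤ ∑' j, v j ^ r := by
  have hq : 0 < q := hr.trans_le hrq
  refine (tsum_rpow_le_tsum_rpow (div_pos hr hq) ((div_le_one hq).mpr hrq) _).trans_eq ?_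
  congr 1; ext j
  rw [← ENNReal.rpow_mul, mul_div_cancel₀ _ hq.ne']

lemma tsum_rpow_le_rpow {q p : ℝ} (hq : 0 < q) (hqp : q ≤ p) (v : ℕ → ℝ≥0∞) :
    ∑' j, v j ^ p ≤ (∑' j, v j ^ q) ^ (p / q) := by
  have hp : 0 < p := hq.trans_le hqp
  have h := ENNReal.rpow_le_rpow (tsum_rpow_rpow_le hq hqp v) (div_pos hp hq).le
  rwa [← ENNReal.rpow_mul, div_mul_div_cancel₀ hp.ne', div_self hq.ne', ENNReal.rpow_one] at h

lemma iSup_rpow_le {q p : ℝ} (hq : 0 < q) (hp : 0 < p) (v : ℕ → ℝ≥0∞) :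
    (⨆ j, v j) ^ p ≤ (∑' j, v j ^ q) ^ (p / q) := by
  have h : ⨆ j, v j ≤ (∑' j, v j ^ q) ^ (1 / q) := by
    refine iSup_le fun j => ?_
    calc v j = (v j ^ q) ^ (1 / q) := by
          rw [← ENNReal.rpow_mul, mul_one_div_cancel hq.ne', ENNReal.rpow_one]
      _ ≤ _ := ENNReal.rpow_le_rpow (ENNReal.le_tsum j) (by positivity)
  refine (ENNReal.rpow_le_rpow h hp.le).trans_eq ?_
  rw [← ENNReal.rpow_mul]; congr 1; ring

/-- The `p`-th power of the `L^p(ℓ^q)` quasi-norm of a sequence of functions. -/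
def lpq (n : ℕ) (q p : ℝ) (V : ℕ → Rn n → ℝ≥0∞) : ℝ≥0∞ := ∫⁻ x, (∑' j, V j x ^ q) ^ (p / q)

lemma lpq_mono {n : ℕ} {q p : ℝ} (hq : 0 < q) (hp : 0 < p) {V W : ℕ → Rn n → ℝ≥0∞}
    (h : ∀ j x, V j x ≤ W j x) : lpq n q p V ≤ lpq n q p W :=
  lintegral_mono fun x => ENNReal.rpow_le_rpow
    (ENNReal.tsum_le_tsum fun j => ENNReal.rpow_le_rpow (h j x) hq.le) (by positivity)

lemma lpq_add_le (n : ℕ) {q p : ℝ} (hq : 0 < q) (hp : 0 < p) :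
    ∃ D : ℝ≥0∞, D ≠ ∞ ∧ ∀ V W : ℕ → Rn n → ℝ≥0∞, (∀ j, Measurable (V j)) →
      lpq n q p (fun j x => V j x + W j x) ≤ D * (lpq n q p V + lpq n q p W) := by
  have hpq : 0 ≤ p / q := by positivity
  have hD : ((2 : ℝ≥0∞) ^ q) ^ (p / q) * 2 ^ (p / q) ≠ ∞ := by finiteness
  refine ⟨_, hD, fun V W hV => ?_⟩
  rw [lpq, lpq, lpq, ← lintegral_add_left
    ((Measurable.tsum fun j => (hV j).pow_const q).pow_const _), ← lintegral_const_mul' _ _ hD]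
  refine lintegral_mono fun x => ?_
  calc (∑' j, (V j x + W j x) ^ q) ^ (p / q)
      ≤ (2 ^ q * (∑' j, V j x ^ q + ∑' j, W j x ^ q)) ^ (p / q) := by
        refine ENNReal.rpow_le_rpow ?_ hpq
        rw [← ENNReal.tsum_add, ← ENNReal.tsum_mul_left]
        exact ENNReal.tsum_le_tsum fun j => ENNReal.add_rpow_le_two_rpow_mul _ _ hq.le
    _ ≤ _ := by
        rw [ENNReal.mul_rpow_of_nonneg _ _ hpq, mul_assoc]
        exact mul_le_mul' le_rfl (ENNReal.add_rpow_le_two_rpow_mul _ _ hpq)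

lemma lpq_single {n : ℕ} {q p : ℝ} (hq : 0 < q) (v : Rn n → ℝ≥0∞) :
    lpq n q p (fun j x => if j = 0 then v x else 0) = ∫⁻ x, v x ^ p := by
  refine lintegral_congr fun x => ?_
  rw [tsum_eq_single 0 (fun j hj => by simp only [if_neg hj, ENNReal.zero_rpow_of_pos hq])]
  simp only [if_true]
  rw [← ENNReal.rpow_mul, mul_div_cancel₀ _ hq.ne']

/-- Boundedness of the frequency-localised half-wave operators in the scale `L^p(ℓ^q)`. -/
lemma lpq_wk_le {n : ℕ} (hn : 2 ≤ n) {p q τ : ℝ} (hp : 0 < p) (hq1 : min 2 p ≤ q) (hq2 : q ≤ max 2 p)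
    (hτ : 0 ≤ τ) {c : Rn n → ℂ} (hc : Ann n c) {N : ℕ} (hN : (n : ℝ) + 1 ≤ N * (p / 2))
    {A : ℝ≥0∞} (hA : A ≠ ∞) :
    ∃ C : ℝ≥0∞, C ≠ ∞ ∧ ∀ (t : ℝ) (F : ℕ → 𝓢(Rn n, ℂ)), |t| ≤ τ → RepBound n N A F →
      lpq n q p (fun j x => (2 : ℝ≥0∞) ^ (-((j : ℝ) * (((n : ℝ) - 1) * |1 / p - 1 / 2|))) *
        ‖kconv n (wk n c ((2 : ℝ) ^ j)⁻¹ t) (F j) x‖ₑ) ≤ C * lpq n q p fun j x => ‖F j x‖ₑ := by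
  have hmeas : ∀ (t : ℝ) (F : ℕ → 𝓢(Rn n, ℂ)) (j : ℕ),
      Measurable fun x => ‖kconv n (wk n c ((2 : ℝ) ^ j)⁻¹ t) (F j) x‖ₑ := fun t F j =>
    (measurable_kconv (hc.continuous_wk (by positivity) t) (F j).continuous.measurable).enorm
  rcases lt_trichotomy p 2 with h | h | h
  · rw [min_eq_right h.le] at hq1
    obtain ⟨C, hC, hb⟩ := tsum_lintegral_wk_le_of_lt_two hn hp h hτ hc hN hA
    refine ⟨C, hC, fun t F ht hF => ?_⟩
    calc _ ≤ ∫⁻ x, ∑' j : ℕ, ((2 : ℝ≥0∞) ^ (-((j : ℝ) * (((n : ℝ) - 1) * |1 / p - 1 / 2|))) *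
            ‖kconv n (wk n c ((2 : ℝ) ^ j)⁻¹ t) (F j) x‖ₑ) ^ p :=
          lintegral_mono fun x => tsum_rpow_rpow_le hp hq1 _
      _ = ∑' j : ℕ, (2 : ℝ≥0∞) ^ (-((j : ℝ) * (((n : ℝ) - 1) / 2 * (2 - p)))) *
            ∫⁻ x, ‖kconv n (wk n c ((2 : ℝ) ^ j)⁻¹ t) (F j) x‖ₑ ^ p := by
          rw [lintegral_tsum fun j => (((hmeas t F j).const_mul _).pow_const _).aemeasurable]
          congr 1; ext j
          rw [← lintegral_const_mul' _ _ (two_rpow_ne_top _)]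
          refine lintegral_congr fun x => ?_
          rw [ENNReal.mul_rpow_of_nonneg _ _ hp.le, ← ENNReal.rpow_mul]
          congr 2
          have : 1 / 2 < 1 / p := one_div_lt_one_div_of_lt hp h
          rw [abs_of_pos (by linarith)]
          field_simp
      _ ≤ C * ∫⁻ x, (⨆ j, ‖F j x‖ₑ) ^ p := hb t F ht hF
      _ ≤ _ := mul_le_mul' le_rfl
          (lintegral_mono fun x => iSup_rpow_le (hp.trans_le hq1) hp _)
  · subst h
    rw [min_self] at hq1
    rw [max_self] at hq2
    obtain rfl := le_antisymm hq2 hq1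
    obtain ⟨C, hC, hb⟩ := tsum_lintegral_wk_le_two hc
    refine ⟨C, hC, fun t F ht hF => ?_⟩
    simp only [lpq, div_self (two_ne_zero (α := ℝ)), ENNReal.rpow_one, sub_self, abs_zero, mul_zero,
      neg_zero, ENNReal.rpow_zero, one_mul]
    rw [lintegral_tsum fun j => ((hmeas t F j).pow_const _).aemeasurable]
    exact hb t F
  · rw [min_eq_left h.le] at hq1
    rw [max_eq_right h.le] at hq2
    obtain ⟨C, hC, hb⟩ := lintegral_rpow_tsum_wk_le hn h hτ hc
    refine ⟨C, hC, fun t F ht hF => ?_⟩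
    have hq : 0 < q := by linarith
    calc _ ≤ ∫⁻ x, (∑' j : ℕ, (2 : ℝ≥0∞) ^ (-((j : ℝ) * (((n : ℝ) - 1) / 2 * (1 - 2 / p)))) *
            ‖kconv n (wk n c ((2 : ℝ) ^ j)⁻¹ t) (F j) x‖ₑ) ^ p := by
          refine lintegral_mono fun x => ?_
          have he : ((n : ℝ) - 1) * |1 / p - 1 / 2| = ((n : ℝ) - 1) / 2 * (1 - 2 / p) := by
            have : 1 / p < 1 / 2 := one_div_lt_one_div_of_lt two_pos h
            rw [abs_of_neg (by linarith)]
            field_simp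
            ring
          simp only [he]
          have h1 := ENNReal.rpow_le_rpow (tsum_rpow_rpow_le one_pos (by linarith : (1 : ℝ) ≤ q)
            fun j : ℕ => (2 : ℝ≥0∞) ^ (-((j : ℝ) * (((n : ℝ) - 1) / 2 * (1 - 2 / p)))) *
            ‖kconv n (wk n c ((2 : ℝ) ^ j)⁻¹ t) (F j) x‖ₑ) hp.le
          simp only [ENNReal.rpow_one] at h1
          rw [← ENNReal.rpow_mul, one_div_mul_eq_div] at h1
          exact h1
      _ ≤ C * ∫⁻ x, ∑' j, ‖F j x‖ₑ ^ p := hb t F ht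
      _ ≤ _ := mul_le_mul' le_rfl (lintegral_mono fun x => tsum_rpow_le_rpow hq hq2 _)

lemma tlNorm_eq {n : ℕ} (ψ0 : Rn n → ℝ) (s : ℝ) {p q : ℝ≥0∞} (hp : p ≠ ∞) (hq : q ≠ ∞)
    (g : Rn n → ℂ) :
    tlNorm n ψ0 s p q g = (lpq n q.toReal p.toReal fun j x => (2 : ℝ≥0∞) ^ ((j : ℝ) * s) *
      ‖smoothOp n (lpPiece n ψ0 j) g x‖ₑ) ^ (1 / p.toReal) := by
  rw [tlNorm, if_neg hp]
  congr 1
  refine lintegral_congr fun x => ?_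
  rw [lqSum, if_neg hq, ← ENNReal.rpow_mul, one_div_mul_eq_div]
  simp only [two_rpow_eq_ofReal, enorm_eq_nnnorm]

/-- The Littlewood–Paley pieces of a Schwartz function, weighted for smoothness `σ`. -/
def lpScaled {n : ℕ} {ψ0 : Rn n → ℝ} (h : IsLPBase n ψ0) (σ : ℝ) (f : 𝓢(Rn n, ℂ)) (j : ℕ) :
    𝓢(Rn n, ℂ) := (((2 : ℝ) ^ ((j : ℝ) * σ) : ℝ) : ℂ) • lpSchwartz h j f

lemma enorm_two_rpow (x : ℝ) : ‖(((2 : ℝ) ^ x : ℝ) : ℂ)‖ₑ = (2 : ℝ≥0∞) ^ x := by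
  rw [two_rpow_eq_ofReal, ← ofReal_norm, Complex.norm_real, Real.norm_of_nonneg (by positivity)]

lemma tlNorm_schwartz {n : ℕ} {ψ0 : Rn n → ℝ} (h : IsLPBase n ψ0) (σ : ℝ) {p q : ℝ≥0∞} (hp : p ≠ ∞)
    (hq : q ≠ ∞) (f : 𝓢(Rn n, ℂ)) :
    tlNorm n ψ0 σ p q f =
      (lpq n q.toReal p.toReal fun j x => ‖lpScaled h σ f j x‖ₑ) ^ (1 / p.toReal) := by
  rw [tlNorm_eq ψ0 σ hp hq]
  congr 2; ext j x
  rw [smoothOp_lpPiece_schwartz h, lpScaled, smul_apply, smul_eq_mul, enorm_mul, enorm_two_rpow]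

lemma enorm_kconv_lpScaled {n : ℕ} {ψ0 : Rn n → ℝ} (h : IsLPBase n ψ0) (σ : ℝ) (f : 𝓢(Rn n, ℂ))
    (j : ℕ) (K : Rn n → ℂ) (x : Rn n) :
    ‖kconv n K (lpScaled h σ f j) x‖ₑ =
      (2 : ℝ≥0∞) ^ ((j : ℝ) * σ) * ‖kconv n K (lpSchwartz h j f) x‖ₑ := by
  rw [← enorm_two_rpow, ← enorm_mul, kconv, kconv, ← integral_const_mul]
  congr 2; ext y
  rw [lpScaled, smul_apply, smul_eq_mul]; ring

lemma enorm_half_mul_add_le (b k1 k2 k3 k4 : ℂ) :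
    ‖(1 / 2) * (k1 + k2) + b * (k3 - k4)‖ₑ ≤ ‖k1‖ₑ + ‖k2‖ₑ + ‖b‖ₑ * (‖k3‖ₑ + ‖k4‖ₑ) := by
  refine (enorm_add_le _ _).trans (add_le_add ?_ ?_)
  · rw [enorm_mul]
    refine (mul_le_mul' ?_ (enorm_add_le _ _)).trans_eq (one_mul _)
    rw [← ofReal_norm, ENNReal.ofReal_le_one]
    norm_num
  · rw [enorm_mul]
    exact mul_le_mul' le_rfl enorm_sub_le

lemma enorm_smoothOp_waveSol_le {n : ℕ} (hn : 2 ≤ n) {ψ0 : Rn n → ℝ} (h : IsLPBase n ψ0)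
    (f0 f1 : 𝓢(Rn n, ℂ)) (s ν t : ℝ) (j : ℕ) (x : Rn n) :
    (2 : ℝ≥0∞) ^ ((j : ℝ) * s) * ‖smoothOp n (lpPiece n ψ0 j) (waveSol n f0 f1 t) x‖ₑ ≤
      (2 : ℝ≥0∞) ^ (-((j : ℝ) * ν)) *
          ‖kconv n (wk n (annMul n ψ0) ((2 : ℝ) ^ j)⁻¹ t) (lpScaled h (s + ν) f0 j) x‖ₑ +
      ((2 : ℝ≥0∞) ^ (-((j : ℝ) * ν)) *
          ‖kconv n (wk n (annMul n ψ0) ((2 : ℝ) ^ j)⁻¹ (-t)) (lpScaled h (s + ν) f0 j) x‖ₑ +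
      ((2 : ℝ≥0∞) ^ (-((j : ℝ) * ν)) *
          ‖kconv n (wk n (divNorm n (annMul n ψ0)) ((2 : ℝ) ^ j)⁻¹ t)
            (lpScaled h (s + ν - 1) f1 j) x‖ₑ +
      ((2 : ℝ≥0∞) ^ (-((j : ℝ) * ν)) *
          ‖kconv n (wk n (divNorm n (annMul n ψ0)) ((2 : ℝ) ^ j)⁻¹ (-t))
            (lpScaled h (s + ν - 1) f1 j) x‖ₑ +
      ((if j = 0 then
          ‖kconv n (𝓕⁻ (lowCos n (lowMul n ψ0) t)) (lpScaled h (s + ν) f0 0) x‖ₑ else 0) +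
        (if j = 0 then
          ‖kconv n (𝓕⁻ (lowSin n (lowMul n ψ0) t)) (lpScaled h (s + ν - 1) f1 0) x‖ₑ else 0))))) := by
  by_cases hj : j = 0
  · subst hj
    rw [if_pos rfl, if_pos rfl]
    refine le_trans ?_ (le_add_self.trans (le_add_self.trans (le_add_self.trans le_add_self)))
    rw [smoothOp_waveSol_zero hn h, enorm_kconv_lpScaled, enorm_kconv_lpScaled]
    simp only [Nat.cast_zero, zero_mul, ENNReal.rpow_zero, one_mul]
    exact enorm_add_le _ _
  · rw [if_neg hj, if_neg hj, add_zero, add_zero, smoothOp_waveSol_of_ne_zero hn h f0 f1 t hj]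
    simp only [enorm_kconv_lpScaled]
    refine (mul_le_mul' le_rfl (enorm_half_mul_add_le _ _ _ _ _)).trans_eq ?_
    have h1 : (2 : ℝ≥0∞) ^ (-((j : ℝ) * ν)) * (2 : ℝ≥0∞) ^ ((j : ℝ) * (s + ν)) =
        (2 : ℝ≥0∞) ^ ((j : ℝ) * s) := by
      rw [← two_rpow_add]; congr 1; ring
    have h2 : (2 : ℝ≥0∞) ^ (-((j : ℝ) * ν)) * (2 : ℝ≥0∞) ^ ((j : ℝ) * (s + ν - 1)) =
        (2 : ℝ≥0∞) ^ ((j : ℝ) * s) * ‖((((2 : ℝ) ^ j)⁻¹ : ℝ) : ℂ)‖ₑ := by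
      rw [← Real.rpow_natCast, ← Real.rpow_neg two_pos.le, enorm_two_rpow, ← two_rpow_add,
        ← two_rpow_add]
      congr 1; ring
    simp only [← mul_assoc, h1, h2]
    ring

lemma measurable_if_enorm_kconv {n : ℕ} {L : Rn n → ℂ} (hL : Continuous L) (g : 𝓢(Rn n, ℂ)) (j : ℕ) :
    Measurable fun x => if j = 0 then ‖kconv n L g x‖ₑ else 0 := by
  by_cases hj : j = 0
  · simpa [hj] using (measurable_kconv hL g.continuous.measurable).enorm
  · simp [hj]

lemma SmoothCpt.continuous_fourierInv {n : ℕ} {F : Rn n → ℂ} (h : SmoothCpt n F) :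
    Continuous (𝓕⁻ F) := by
  rw [← h.fourierInv_toS]; exact (𝓕⁻ h.toS : 𝓢(Rn n, ℂ)).continuous

/-- The estimate for the solution of the wave equation for `p`-th powers of the norms. -/
lemma lpq_waveSol_le {n : ℕ} (hn : 2 ≤ n) {ψ0 : Rn n → ℝ} (h : IsLPBase n ψ0) {p q τ : ℝ} (s : ℝ)
    (hp : 0 < p) (hq1 : min 2 p ≤ q) (hq2 : q ≤ max 2 p) (hτ : 0 ≤ τ)
    {ν : ℝ} (hν : ν = ((n : ℝ) - 1) * |1 / p - 1 / 2|) :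
    ∃ C : ℝ≥0∞, C ≠ ∞ ∧ ∀ (f0 f1 : 𝓢(Rn n, ℂ)) (t : ℝ), |t| ≤ τ →
      lpq n q p (fun j x => (2 : ℝ≥0∞) ^ ((j : ℝ) * s) *
        ‖smoothOp n (lpPiece n ψ0 j) (waveSol n f0 f1 t) x‖ₑ) ≤
      C * (lpq n q p (fun j x => ‖lpScaled h (s + ν) f0 j x‖ₑ) +
        lpq n q p fun j x => ‖lpScaled h (s + ν - 1) f1 j x‖ₑ) := by
  have hq : 0 < q := (lt_min two_pos hp).trans_le hq1
  set r : ℝ := min 1 (p / 2) with hr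
  have hr0 : 0 < r := lt_min one_pos (by positivity)
  have hrp : r ≤ p / 2 := min_le_right _ _
  obtain ⟨N, hN⟩ := exists_nat_ge (((n : ℝ) + 1) / r)
  rw [div_le_iff₀ hr0] at hN
  have hN' : (n : ℝ) + 1 ≤ N * (p / 2) := hN.trans (by gcongr)
  obtain ⟨A, hA⟩ := repBound_lpSchwartz h N
  obtain ⟨A', hA'⟩ := h.smoothCpt_lowMul.exists_low_bound τ (N + (n + 1))
  obtain ⟨D, hD, hadd⟩ := lpq_add_le n hq hp
  obtain ⟨C0, hC0, hb0⟩ := lpq_wk_le hn hp hq1 hq2 hτ h.ann_annMul hN' (A := A) ENNReal.coe_ne_top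
  obtain ⟨C1, hC1, hb1⟩ := lpq_wk_le hn hp hq1 hq2 hτ h.ann_annMul.divNorm hN' (A := A)
    ENNReal.coe_ne_top
  obtain ⟨C2, hC2, hb2⟩ := lintegral_kconv_low_le (n := n) (by omega) hr0 (min_le_left _ _)
    (show r < p by linarith) hN A A'
  rw [← hν] at hb0 hb1
  refine ⟨D * (C0 + D * (C0 + D * (C1 + D * (C1 + D * (C2 + C2))))), by finiteness,
    fun f0 f1 t ht => ?_⟩
  have ht' : |-t| ≤ τ := by rwa [abs_neg]
  have hF0 := hA (fun j => (((2 : ℝ) ^ ((j : ℝ) * (s + ν)) : ℝ) : ℂ)) f0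
  have hF1 := hA (fun j => (((2 : ℝ) ^ ((j : ℝ) * (s + ν - 1)) : ℝ) : ℂ)) f1
  have hlow : ∀ (L : Rn n → ℂ) (F : ℕ → 𝓢(Rn n, ℂ)),
      (∀ x, ‖L x‖ₑ ≤ A' * dec n 0 (N + (n + 1)) x) → RepBound n N A F →
      lpq n q p (fun j x => if j = 0 then ‖kconv n L (F 0) x‖ₑ else 0) ≤
        C2 * lpq n q p fun j x => ‖F j x‖ₑ := by
    intro L F hL hF
    rw [lpq_single hq]
    exact (hb2 L F hL hF).trans
      (mul_le_mul' le_rfl (lintegral_mono fun x => iSup_rpow_le hq hp _))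
  have hmeas : ∀ {c : Rn n → ℂ}, Ann n c → ∀ (t : ℝ) (F : ℕ → 𝓢(Rn n, ℂ)) (j : ℕ),
      Measurable fun x => (2 : ℝ≥0∞) ^ (-((j : ℝ) * ν)) *
        ‖kconv n (wk n c ((2 : ℝ) ^ j)⁻¹ t) (F j) x‖ₑ := fun hc t F j =>
    (measurable_kconv (hc.continuous_wk (by positivity) t)
      (F j).continuous.measurable).enorm.const_mul _
  have hX0 : lpq n q p (fun j x => ‖lpScaled h (s + ν) f0 j x‖ₑ) ≤
      lpq n q p (fun j x => ‖lpScaled h (s + ν) f0 j x‖ₑ) +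
        lpq n q p fun j x => ‖lpScaled h (s + ν - 1) f1 j x‖ₑ := le_self_add
  have hX1 : lpq n q p (fun j x => ‖lpScaled h (s + ν - 1) f1 j x‖ₑ) ≤
      lpq n q p (fun j x => ‖lpScaled h (s + ν) f0 j x‖ₑ) +
        lpq n q p fun j x => ‖lpScaled h (s + ν - 1) f1 j x‖ₑ := le_add_self
  refine (lpq_mono hq hp (enorm_smoothOp_waveSol_le hn h f0 f1 s ν t)).trans ?_
  have b1 := (hb0 t _ ht hF0).trans (mul_le_mul' le_rfl hX0)
  have b2 := (hb0 (-t) _ ht' hF0).trans (mul_le_mul' le_rfl hX0)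
  have b3 := (hb1 t _ ht hF1).trans (mul_le_mul' le_rfl hX1)
  have b4 := (hb1 (-t) _ ht' hF1).trans (mul_le_mul' le_rfl hX1)
  have b5 := (hlow _ _ (fun x => (hA' t ht x).1) hF0).trans (mul_le_mul' le_rfl hX0)
  have b6 := (hlow _ _ (fun x => (hA' t ht x).2) hF1).trans (mul_le_mul' le_rfl hX1)
  have hstep : ∀ {V W : ℕ → Rn n → ℝ≥0∞} {B B' X : ℝ≥0∞}, (∀ j, Measurable (V j)) →
      lpq n q p V ≤ B * X → lpq n q p W ≤ B' * X →
      lpq n q p (fun j x => V j x + W j x) ≤ D * (B + B') * X := by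
    intro V W B B' X hV h1 h2
    refine (hadd V W hV).trans ?_
    rw [mul_assoc, add_mul]
    exact mul_le_mul' le_rfl (add_le_add h1 h2)
  refine hstep (hmeas h.ann_annMul t _) b1 (hstep (hmeas h.ann_annMul (-t) _) b2
    (hstep (hmeas h.ann_annMul.divNorm t _) b3 (hstep (hmeas h.ann_annMul.divNorm (-t) _) b4
      (hstep (measurable_if_enorm_kconv
        (h.smoothCpt_lowMul.lowCos t).continuous_fourierInv _) b5 b6))))

/-- Global Triebel–Lizorkin estimate for the solution of the wave equation:
for `n ≥ 2`, `n/(n+1) < p < ∞`, `min(2,p) ≤ q ≤ max(2,p)`, `s ∈ ℝ` and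
`ν = (n-1)|1/p - 1/2|`,
`sup_{t ∈ [-τ,τ]} ‖u(t,·)‖_{F^s_{p,q}} ≤ C_τ (‖f0‖_{F^{s+ν}_{p,q}} + ‖f1‖_{F^{s+ν-1}_{p,q}})`. -/
theorem global_triebel_lizorkin_estimate_wave_equation
    (n : ℕ) (hn : 2 ≤ n) (s : ℝ) (p q : ℝ≥0∞)
    (hp : ENNReal.ofReal ((n : ℝ) / ((n : ℝ) + 1)) < p) (hp' : p ≠ ∞)
    (hq1 : min 2 p ≤ q) (hq2 : q ≤ max 2 p)
    (ψ0 : Rn n → ℝ) (hψ0 : IsLPBase n ψ0)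
    (ν : ℝ) (hν : ν = ((n : ℝ) - 1) * |p⁻¹.toReal - 1 / 2|)
    (τ : ℝ) (hτ : 0 < τ) :
    ∃ C : ℝ≥0, ∀ f0 f1 : SchwartzMap (Rn n) ℂ, ∀ t ∈ Set.Icc (-τ) τ,
      tlNorm n ψ0 s p q (waveSol n ⇑f0 ⇑f1 t) ≤
        (C : ℝ≥0∞) *
          (tlNorm n ψ0 (s + ν) p q ⇑f0 + tlNorm n ψ0 (s + ν - 1) p q ⇑f1) := by
  have hp0 : 0 < p.toReal := ENNReal.toReal_pos (bot_le.trans_lt hp).ne' hp'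
  have h2 : (2 : ℝ≥0∞) ≠ ∞ := by norm_num
  have hmax : max 2 p ≠ ∞ := by simp [hp']
  have hq : q ≠ ∞ := ne_top_of_le_ne_top hmax hq2
  have hq1' : min 2 p.toReal ≤ q.toReal := by
    have := ENNReal.toReal_mono hq hq1
    rwa [ENNReal.toReal_min h2 hp', ENNReal.toReal_ofNat] at this
  have hq2' : q.toReal ≤ max 2 p.toReal := by
    have := ENNReal.toReal_mono hmax hq2
    rwa [ENNReal.toReal_max h2 hp', ENNReal.toReal_ofNat] at this
  rw [ENNReal.toReal_inv, ← one_div] at hν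
  obtain ⟨C, hC, hb⟩ := lpq_waveSol_le hn hψ0 s hp0 hq1' hq2' hτ.le hν
  have hr : 0 ≤ 1 / p.toReal := by positivity
  have hfin : C ^ (1 / p.toReal) * 2 ^ (1 / p.toReal) ≠ ∞ := by finiteness
  refine ⟨(C ^ (1 / p.toReal) * 2 ^ (1 / p.toReal)).toNNReal, fun f0 f1 t ht => ?_⟩
  rw [ENNReal.coe_toNNReal hfin, tlNorm_eq ψ0 s hp' hq, tlNorm_schwartz hψ0 _ hp' hq,
    tlNorm_schwartz hψ0 _ hp' hq]
  refine (ENNReal.rpow_le_rpow (hb f0 f1 t (abs_le.mpr ht)) hr).trans ?_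
  rw [ENNReal.mul_rpow_of_nonneg _ _ hr, mul_assoc]
  exact mul_le_mul' le_rfl (ENNReal.add_rpow_le_two_rpow_mul _ _ hr)
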